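/- Let q be a prime power that is a perfect square and let a, b ∈ (1,2). Suppose there exist reals β > 0 and α > √q + 1 such that a > (α + β − 1)/D and b > 1 + (2·log_q 2 + F_q(2β, √q−1) − F_q(β, √q−1) + α − 1 + (√q−1)·log_q(1 − q^{−1}))/D, where D = F_q(β, √q−1) + α + 2(√q−1)·log_q(1 − q^{−1}) − 2. Then there exist arbitrarily large finite sets A ⊆ 𝔽_q((t)) with |A+A| ≤ |A|^a and |AA| ≤ |A|^b; that is, for every N there is a finite A ⊆ 𝔽_q((t)) with |A| ≥ N satisfying both bounds. -/

import Mathlib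

open Pointwise

/-- `F_q(x,y) = (x+y) log_q(x+y) - x log_q(x) - y log_q(y)`. -/
noncomputable def Fq (q : ℕ) (x y : ℝ) : ℝ :=
  (x + y) * Real.logb q (x + y) - x * Real.logb q x - y * Real.logb q y

/-- The recursive tower of Garcia and Stichtenoth inside a field `Ω` over `F`. -/
structure GSTower (F Ω : Type*) [Field F] [Field Ω] [Algebra F Ω] (l : ℕ) where
  x : ℕ → Ω
  transcendental : Transcendental F (x 0)
  two_le : 2 ≤ l
  add_pow : ∀ a b : Ω, (a + b) ^ l = a ^ l + b ^ l
  rel : ∀ i, (x (i + 1) ^ l + x (i + 1)) * (x i ^ (l - 1) + 1) = x i ^ l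

section ValuationPolynomial

variable {Ω Γ : Type*} [Field Ω] [LinearOrderedCommGroupWithZero Γ] (v : Valuation Ω Γ) {l : ℕ}

theorem val_pow_add_self_of_one_lt (hl : 2 ≤ l) {s : Ω} (hs : 1 < v s) :
    v (s ^ l + s) = v s ^ l := by
  rw [Valuation.map_add_eq_of_lt_left v, map_pow]
  rw [map_pow]
  calc v s = v s ^ 1 := (pow_one _).symm
    _ < v s ^ l := pow_lt_pow_right₀ hs hl

theorem val_pow_add_self_of_lt_one (hl : 2 ≤ l) {s : Ω} (hs : v s < 1) :
    v (s ^ l + s) = v s := by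
  rcases eq_or_ne s 0 with rfl | h0
  · rw [zero_pow (by omega), add_zero]
  rw [Valuation.map_add_eq_of_lt_right v]
  rw [map_pow]
  have : 0 < v s := by rwa [zero_lt_iff, Valuation.ne_zero_iff]
  calc v s ^ l < v s ^ 1 := pow_lt_pow_right_of_lt_one₀ this hs hl
    _ = v s := pow_one _

theorem val_le_one_of_pow_add_self (hl : 2 ≤ l) {s : Ω} (hs : v (s ^ l + s) ≤ 1) : v s ≤ 1 := by
  by_contra! h
  rw [val_pow_add_self_of_one_lt v hl h] at hs
  exact absurd hs (not_le.2 (one_lt_pow₀ h (by omega)))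

theorem eq_one_of_pow_eq_one₀ {n : ℕ} (hn : n ≠ 0) {a : Γ} (h : a ^ n = 1) : a = 1 := by
  rcases lt_trichotomy a 1 with h' | h' | h'
  · exact absurd h (pow_lt_one₀ zero_le h' hn).ne
  · exact h'
  · exact absurd h (one_lt_pow₀ h' hn).ne'

end ValuationPolynomial

namespace GSTower

variable {F Ω : Type*} [Field F] [Field Ω] [Algebra F Ω] {l : ℕ} (G : GSTower F Ω l)

/-- The denominator of the right-hand side of the recursion. -/
def u (i : ℕ) : Ω := G.x i ^ (l - 1) + 1

theorem pow_eq (i : ℕ) : G.x i ^ l = G.x i * G.x i ^ (l - 1) := by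
  have := G.two_le
  rw [← pow_succ', Nat.sub_add_cancel (by omega)]

theorem pow_add_self (i : ℕ) : G.x i ^ l + G.x i = G.x i * G.u i := by
  rw [pow_eq, u]; ring

theorem rel' (i : ℕ) : (G.x (i + 1) ^ l + G.x (i + 1)) * G.u i = G.x i ^ l := G.rel i

theorem x_ne_zero (i : ℕ) : G.x i ≠ 0 := by
  have := G.two_le
  induction i with
  | zero => exact fun h => G.transcendental (h ▸ isAlgebraic_zero)
  | succ i ih =>
    intro h
    have := G.rel' i
    rw [h, zero_pow (by omega), add_zero, zero_mul] at this
    exact ih (pow_eq_zero_iff (by omega) |>.1 this.symm)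

theorem u_ne_zero (i : ℕ) : G.u i ≠ 0 := by
  intro h
  have := G.rel' i
  rw [h, mul_zero] at this
  exact pow_ne_zero l (G.x_ne_zero i) this.symm

theorem pow_add_self_succ (i : ℕ) : G.x (i + 1) ^ l + G.x (i + 1) = G.x i ^ l / G.u i := by
  rw [eq_div_iff (G.u_ne_zero i), rel']

theorem neg_one_pow (G : GSTower F Ω l) : (-1 : Ω) ^ l = -1 := by
  have h := G.add_pow 1 (-1)
  have := G.two_le
  rw [add_neg_cancel, zero_pow (by omega), one_pow] at h
  linear_combination -h

theorem sub_pow (G : GSTower F Ω l) (a b : Ω) : (a - b) ^ l = a ^ l - b ^ l := by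
  rw [sub_eq_add_neg, G.add_pow, neg_pow, G.neg_one_pow]; ring

/-- The reciprocal relation between consecutive generators. -/
theorem inv_pow_add_inv (i : ℕ) :
    (G.x i)⁻¹ ^ l + (G.x i)⁻¹ = (G.x (i + 1) * G.u (i + 1))⁻¹ := by
  have h0 := G.x_ne_zero i
  have hu := G.u_ne_zero i
  rw [← pow_add_self, pow_add_self_succ, inv_div, inv_pow]
  rw [eq_div_iff (pow_ne_zero _ h0), u, add_mul, inv_mul_cancel₀ (pow_ne_zero _ h0), pow_eq]
  field_simp
  ring

section Val

variable {Γ : Type*} [LinearOrderedCommGroupWithZero Γ] (v : Valuation Ω Γ)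

theorem val_u_of_one_lt {i : ℕ} (h : 1 < v (G.x i)) : v (G.u i) = v (G.x i) ^ (l - 1) := by
  have := G.two_le
  rw [u, Valuation.map_add_eq_of_lt_left v, map_pow]
  rw [map_pow, map_one]
  exact one_lt_pow₀ h (by omega)

theorem val_u_of_lt_one {i : ℕ} (h : v (G.x i) < 1) : v (G.u i) = 1 := by
  have := G.two_le
  rw [u, Valuation.map_add_eq_of_lt_right v, map_one]
  rw [map_pow, map_one]
  exact pow_lt_one₀ zero_le h (by omega)

theorem val_u_le_one {i : ℕ} (h : v (G.x i) ≤ 1) : v (G.u i) ≤ 1 := by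
  refine (v.map_add _ _).trans (max_le ?_ (by simp))
  rw [map_pow]; exact pow_le_one' h _

theorem val_rel (i : ℕ) :
    v (G.x (i + 1) ^ l + G.x (i + 1)) * v (G.u i) = v (G.x i) ^ l := by
  rw [← map_mul, rel', map_pow]

theorem val_x_pos (i : ℕ) : 0 < v (G.x i) := by
  rw [zero_lt_iff, Valuation.ne_zero_iff]; exact G.x_ne_zero i

theorem val_succ_of_one_lt {i : ℕ} (h : 1 < v (G.x i)) :
    1 < v (G.x (i + 1)) ∧ v (G.x (i + 1)) ^ l = v (G.x i) := by
  have hl := G.two_le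
  have h1 := G.val_rel v i
  have h2 : v (G.x (i + 1) ^ l + G.x (i + 1)) = v (G.x i) := by
    rw [G.val_u_of_one_lt v h] at h1
    have : v (G.x i) ^ l = v (G.x i) * v (G.x i) ^ (l - 1) := by
      rw [← pow_succ', Nat.sub_add_cancel (by omega)]
    rw [this] at h1
    exact mul_right_cancel₀ (pow_ne_zero _ (zero_lt_one.trans h).ne') h1
  have h3 : 1 < v (G.x (i + 1)) := by
    by_contra! h4
    rw [← h2] at h
    refine absurd h (not_lt.2 ((v.map_add _ _).trans (max_le ?_ h4)))
    rw [map_pow]; exact pow_le_one' h4 _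
  exact ⟨h3, by rw [← h2, val_pow_add_self_of_one_lt v hl h3]⟩

theorem one_lt_val {i j : ℕ} (h : 1 < v (G.x i)) (hij : i ≤ j) : 1 < v (G.x j) := by
  induction hij with
  | refl => exact h
  | step _ ih => exact (G.val_succ_of_one_lt v ih).1

theorem val_pow_of_one_lt {i : ℕ} (h : 1 < v (G.x i)) (m : ℕ) :
    v (G.x (i + m)) ^ l ^ m = v (G.x i) := by
  induction m with
  | zero => simp
  | succ m ih =>
    rw [pow_succ', pow_mul, ← add_assoc,
      (G.val_succ_of_one_lt v (G.one_lt_val v h (Nat.le_add_right i m))).2, ih]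

/-- The place is a zero of `x i` for `i < j` and `x j` reduces to a nonzero root of `T ^ l + T`. -/
def IsRamified (j : ℕ) : Prop := (∀ i < j, v (G.x i) < 1) ∧ v (G.x j) = 1 ∧ v (G.u j) < 1

/-- One step of the recursion at a zero. -/
theorem val_succ_of_lt_one {i : ℕ} (h : v (G.x i) < 1) :
    (v (G.x (i + 1)) < 1 ∧ v (G.x (i + 1)) = v (G.x i) ^ l) ∨
    (v (G.x (i + 1)) = 1 ∧ v (G.u (i + 1)) < 1 ∧ v (G.u (i + 1)) = v (G.x i) ^ l) := by
  have hl := G.two_le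
  have h1 := G.val_rel v i
  rw [G.val_u_of_lt_one v h, mul_one] at h1
  have hlt : v (G.x i) ^ l < 1 := pow_lt_one₀ zero_le h (by omega)
  rcases lt_trichotomy (v (G.x (i + 1))) 1 with h2 | h2 | h2
  · left
    rw [val_pow_add_self_of_lt_one v hl h2] at h1
    exact ⟨h2, h1⟩
  · right
    rw [pow_add_self, map_mul, h2, one_mul] at h1
    exact ⟨h2, h1 ▸ hlt, h1⟩
  · have := val_le_one_of_pow_add_self v hl (h1.trans_le hlt.le)
    exact absurd h2 (not_lt.2 this)

theorem val_succ_of_eq_one {i : ℕ} (h : v (G.x i) = 1) (hu : v (G.u i) = 1) :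
    v (G.x (i + 1)) = 1 ∧ v (G.u (i + 1)) = 1 := by
  have hl := G.two_le
  have h1 := G.val_rel v i
  rw [hu, mul_one, h, one_pow] at h1
  have h2 := val_le_one_of_pow_add_self v hl h1.le
  rcases h2.lt_or_eq with h3 | h3
  · rw [val_pow_add_self_of_lt_one v hl h3] at h1
    exact absurd h1 h3.ne
  · rw [pow_add_self, map_mul, h3, one_mul] at h1
    exact ⟨h3, h1⟩

theorem val_trichotomy (h : v (G.x 0) ≤ 1) (n : ℕ) :
    (∀ i ≤ n, v (G.x i) < 1) ∨ (∀ i ≤ n, v (G.x i) = 1 ∧ v (G.u i) = 1) ∨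
      ∃ j ≤ n, G.IsRamified v j := by
  induction n with
  | zero =>
    rcases h.lt_or_eq with h | h
    · left; intro i hi; rwa [Nat.le_zero.1 hi]
    · rcases (G.val_u_le_one v h.le).lt_or_eq with h' | h'
      · exact Or.inr (Or.inr ⟨0, le_rfl, by simp, h, h'⟩)
      · right; left; intro i hi; rw [Nat.le_zero.1 hi]; exact ⟨h, h'⟩
  | succ n ih =>
    rcases ih with ih | ih | ⟨j, hj, ih⟩
    · rcases G.val_succ_of_lt_one v (ih n le_rfl) with h' | h'
      · left; intro i hi
        rcases Nat.le_succ_iff.1 hi with hi | rfl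
        exacts [ih i hi, h'.1]
      · exact Or.inr (Or.inr ⟨n + 1, le_rfl, fun i hi => ih i (by omega), h'.1, h'.2.1⟩)
    · right; left; intro i hi
      rcases Nat.le_succ_iff.1 hi with hi | rfl
      exacts [ih i hi, G.val_succ_of_eq_one v (ih n le_rfl).1 (ih n le_rfl).2]
    · exact Or.inr (Or.inr ⟨j, by omega, ih⟩)

namespace IsRamified

variable {G v} {j : ℕ}

theorem one_lt_succ (h : G.IsRamified v j) :
    1 < v (G.x (j + 1)) ∧ v (G.x (j + 1)) ^ l * v (G.u j) = 1 := by
  have hl := G.two_le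
  have h1 := G.val_rel v j
  rw [h.2.1, one_pow] at h1
  have h2 : 1 < v (G.x (j + 1)) := by
    by_contra! h4
    have : v (G.x (j + 1) ^ l + G.x (j + 1)) ≤ 1 := by
      refine (v.map_add _ _).trans (max_le ?_ h4)
      rw [map_pow]; exact pow_le_one' h4 _
    exact absurd h1 ((mul_le_of_le_one_left' this).trans_lt h.2.2).ne
  rw [val_pow_add_self_of_one_lt v hl h2] at h1
  exact ⟨h2, h1⟩

theorem one_lt (h : G.IsRamified v j) {i : ℕ} (hi : j < i) : 1 < v (G.x i) :=
  G.one_lt_val v h.one_lt_succ.1 hi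

theorem val_succ (h : G.IsRamified v j) {i : ℕ} (hi : i + 1 < j) :
    v (G.x (i + 1)) = v (G.x i) ^ l := by
  rcases G.val_succ_of_lt_one v (h.1 i (by omega)) with h' | h'
  · exact h'.2
  · exact absurd h'.1 (h.1 _ hi).ne

theorem val_u (h : G.IsRamified v j) (hj : 1 ≤ j) : v (G.u j) = v (G.x (j - 1)) ^ l := by
  obtain ⟨i, rfl⟩ : ∃ i, j = i + 1 := ⟨j - 1, by omega⟩
  rcases G.val_succ_of_lt_one v (h.1 i (by omega)) with h' | h'
  · exact absurd h.2.1 h'.1.ne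
  · exact h'.2.2

theorem val_le_one (h : G.IsRamified v j) {i : ℕ} (hi : i ≤ j) : v (G.x i) ≤ 1 := by
  rcases hi.lt_or_eq with hi | rfl
  exacts [(h.1 i hi).le, h.2.1.le]

theorem val_anti (h : G.IsRamified v j) {i m : ℕ} (him : i + m ≤ j - 1) (hj : 1 ≤ j) :
    v (G.x (i + m)) ≤ v (G.x i) := by
  have hl := G.two_le
  induction m with
  | zero => exact le_rfl
  | succ m ih =>
    rw [← add_assoc, h.val_succ (by omega)]
    exact (pow_le_of_le_one zero_le (h.val_le_one (by omega)) (by omega)).trans (ih (by omega))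

theorem val_mul_eq_one (h : G.IsRamified v j) {i : ℕ} (hi : 1 ≤ i) (hij : i ≤ j) :
    v (G.x (j + i)) * v (G.x (j - i)) = 1 := by
  have hl := G.two_le
  induction i, hi using Nat.le_induction with
  | base =>
    have := h.one_lt_succ.2
    rw [h.val_u hij, ← mul_pow] at this
    exact eq_one_of_pow_eq_one₀ (by omega : l ≠ 0) this
  | succ i hi ih =>
    have h1 := ih (by omega)
    rw [← (G.val_succ_of_one_lt v (h.one_lt (i := j + i) (by omega))).2,
      show j - i = (j - (i + 1)) + 1 by omega,
      h.val_succ (i := j - (i + 1)) (by omega), ← mul_pow] at h1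
    exact eq_one_of_pow_eq_one₀ (by omega : l ≠ 0) h1

theorem val_prod_mul (h : G.IsRamified v j) {m : ℕ} (hm : j < m) :
    v (∏ i ∈ Finset.range m, G.u i) * v (G.x m) ^ l = 1 := by
  have hl := G.two_le
  induction m, hm using Nat.le_induction with
  | base =>
    rw [Finset.prod_range_succ, map_mul, map_prod, Finset.prod_eq_one, one_mul, mul_comm]
    · exact h.one_lt_succ.2
    · intro i hi
      exact G.val_u_of_lt_one v (h.1 i (Finset.mem_range.1 hi))
  | succ m hm ih =>
    have h1 := h.one_lt (i := m) (by omega)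
    rw [Finset.prod_range_succ, map_mul, (G.val_succ_of_one_lt v h1).2, G.val_u_of_one_lt v h1,
      mul_assoc, ← pow_succ, Nat.sub_add_cancel (by omega), ih]

theorem val_norm_sub (h : G.IsRamified v j) :
    v (G.x j ^ (l + 1) - (G.x j ^ (l + 1)) ^ l) ≤ v (G.u j) := by
  have hl := G.two_le
  have h1 : (G.x j ^ (l + 1)) ^ l = G.x j ^ (l + 1) * (G.x j ^ (l - 1)) ^ (l + 1) := by
    rw [← pow_mul, ← pow_mul, ← pow_add]
    congr 1
    obtain ⟨k, rfl⟩ : ∃ k, l = k + 2 := ⟨l - 2, by omega⟩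
    simp only [show k + 2 - 1 = k + 1 by omega]
    ring
  have h2 : G.x j ^ (l - 1) = G.u j - 1 := by rw [u]; ring
  have h3 : G.x j ^ (l + 1) - (G.x j ^ (l + 1)) ^ l
      = G.x j ^ (l + 1) * (1 + G.u j ^ (l - 1) - G.u j ^ l) * G.u j := by
    have : G.u j ^ l = G.u j ^ (l - 1) * G.u j := by
      rw [← pow_succ, Nat.sub_add_cancel (by omega)]
    rw [h1, h2, pow_succ (G.u j - 1), G.sub_pow, one_pow, this]
    ring
  rw [h3, map_mul]
  refine mul_le_of_le_one_left' ?_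
  rw [map_mul, map_pow, h.2.1, one_pow, one_mul]
  refine (v.map_sub _ _).trans (max_le ((v.map_add _ _).trans (max_le (by simp) ?_)) ?_)
  all_goals rw [map_pow]; exact pow_le_one' h.2.2.le _

/-- Near a ramified place the later generators are approximated by inverses of the earlier ones. -/
theorem val_sub_le_one (h : G.IsRamified v j) {i : ℕ} (hi : 1 ≤ i) (hij : i ≤ j) :
    v (G.x (j + i) - G.x j ^ (l + 1) * (G.x (j - i))⁻¹) ≤ 1 := by
  have hl := G.two_le
  set N := G.x j ^ (l + 1) with hN
  have hvN : v N = 1 := by rw [hN, map_pow, h.2.1, one_pow]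
  have key (X y : Ω) : (y - N * X) ^ l + (y - N * X)
      = (y ^ l + y) - N * (X ^ l + X) + (N - N ^ l) * X ^ l := by
    rw [G.sub_pow, mul_pow]; ring
  have bound {m : ℕ} (hm : m ≤ j - 1) : v ((N - N ^ l) * (G.x m)⁻¹ ^ l) ≤ 1 := by
    rw [map_mul, map_pow, map_inv₀, inv_pow, ← div_eq_mul_inv]
    refine div_le_one_of_le₀ (h.val_norm_sub.trans ?_) zero_le
    rw [h.val_u (by omega)]
    refine pow_le_pow_left' ?_ _
    have := h.val_anti (i := m) (m := j - 1 - m) (by omega) (by omega)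
    rwa [Nat.add_sub_cancel' hm] at this
  induction i, hi using Nat.le_induction with
  | base =>
    apply val_le_one_of_pow_add_self v hl
    rw [key, G.inv_pow_add_inv, pow_add_self_succ, Nat.sub_add_cancel hij]
    have : G.x j ^ l / G.u j - N * (G.x j * G.u j)⁻¹ = 0 := by
      have := G.x_ne_zero j
      have := G.u_ne_zero j
      rw [hN]; field_simp; ring
    rw [this, zero_add]
    exact bound le_rfl
  | succ i hi ih =>
    apply val_le_one_of_pow_add_self v hl
    have e1 : G.x (j + (i + 1)) ^ l + G.x (j + (i + 1)) =
        G.x (j + i) - G.x (j + i) / G.u (j + i) := by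
      rw [← add_assoc, pow_add_self_succ, pow_eq]
      have := G.u_ne_zero (j + i)
      field_simp
      rw [u]; ring
    have e2 : (G.x (j - (i + 1)))⁻¹ ^ l + (G.x (j - (i + 1)))⁻¹ =
        (G.x (j - i))⁻¹ - G.x (j - i) ^ (l - 2) / G.u (j - i) := by
      rw [G.inv_pow_add_inv, show j - (i + 1) + 1 = j - i by omega]
      have := G.u_ne_zero (j - i)
      have := G.x_ne_zero (j - i)
      have h5 : G.u (j - i) = G.x (j - i) ^ (l - 2) * G.x (j - i) + 1 := by
        rw [u, ← pow_succ]; congr 2; omega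
      field_simp
      rw [h5]; ring
    rw [key, e1, e2]
    have h6 := h.one_lt (i := j + i) (by omega)
    have b1 : v (G.x (j + i) / G.u (j + i)) ≤ 1 := by
      rw [map_div₀, G.val_u_of_one_lt v h6]
      refine div_le_one_of_le₀ ?_ zero_le
      exact le_self_pow h6.le (by omega)
    have b2 : v (G.x (j - i) ^ (l - 2) / G.u (j - i)) ≤ 1 := by
      rw [map_div₀, G.val_u_of_lt_one v (h.1 (j - i) (by omega)), div_one, map_pow]
      exact pow_le_one' (h.val_le_one (by omega)) _
    have e3 : G.x (j + i) - G.x (j + i) / G.u (j + i)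
        - N * ((G.x (j - i))⁻¹ - G.x (j - i) ^ (l - 2) / G.u (j - i))
        + (N - N ^ l) * (G.x (j - (i + 1)))⁻¹ ^ l =
        (G.x (j + i) - N * (G.x (j - i))⁻¹) - G.x (j + i) / G.u (j + i)
        + N * (G.x (j - i) ^ (l - 2) / G.u (j - i))
        + (N - N ^ l) * (G.x (j - (i + 1)))⁻¹ ^ l := by ring
    rw [e3]
    refine v.map_add_le (v.map_add_le (v.map_sub_le (ih (by omega)) b1) ?_) (bound (by omega))
    rw [map_mul, hvN, one_mul]; exact b2

end IsRamified

end Val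

end GSTower

namespace GSTower

variable {F Ω : Type*} [Field F] [Field Ω] [Algebra F Ω] {l : ℕ} (G : GSTower F Ω l)
variable {Γ : Type*} [LinearOrderedCommGroupWithZero Γ] (v : Valuation Ω Γ)

/-- The product of the first `k` denominators. -/
def uProd (k : ℕ) : Ω := ∏ i ∈ Finset.range k, G.u i

/-- A summand of the correction `G.corr n`, active at the places where `x j` is a unit. -/
def corrTerm (n j : ℕ) : Ω :=
  G.uProd j ^ l ^ (n + 2) * (G.x j ^ (l + 1) * (G.x (2 * j - n - 1))⁻¹)

/-- An approximation of `x (n + 1)` by an element of the field generated by `x 0, …, x n`. -/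
def corr (n : ℕ) : Ω := ∑ j ∈ (Finset.range (n + 1)).filter (fun j => n + 1 ≤ 2 * j), G.corrTerm n j

theorem sub_pow_pow (G : GSTower F Ω l) (a b : Ω) (m : ℕ) :
    (a - b) ^ l ^ m = a ^ l ^ m - b ^ l ^ m := by
  induction m with
  | zero => simp
  | succ m ih => rw [pow_succ, pow_mul, ih, G.sub_pow, pow_mul, pow_mul]

theorem val_anti_of_lt_one {i j : ℕ} (hij : i ≤ j) (h : ∀ m ≤ j, v (G.x m) < 1) :
    v (G.x j) ≤ v (G.x i) := by
  have hl := G.two_le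
  induction j, hij using Nat.le_induction with
  | base => exact le_rfl
  | succ j hj ih =>
    refine le_trans ?_ (ih fun m hm => h m (by omega))
    rcases G.val_succ_of_lt_one v (h j (by omega)) with h' | h'
    · rw [h'.2]; exact pow_le_of_le_one zero_le (h j (by omega)).le (by omega)
    · exact absurd h'.1 (h _ le_rfl).ne

theorem val_anti_of_one_lt {i j : ℕ} (hij : i ≤ j) (h : 1 < v (G.x i)) :
    v (G.x j) ≤ v (G.x i) := by
  have hl := G.two_le
  induction j, hij using Nat.le_induction with
  | base => exact le_rfl
  | succ j hj ih =>
    refine le_trans ?_ ih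
    have h1 := G.val_succ_of_one_lt v (G.one_lt_val v h hj)
    rw [← h1.2]
    exact le_self_pow h1.1.le (by omega)

theorem IsRamified.val_uProd_mul {v : Valuation Ω Γ} {G : GSTower F Ω l} {j m : ℕ}
    (h : G.IsRamified v j) (hm : j < m) :
    v (G.uProd m) * v (G.x m) ^ l = 1 := h.val_prod_mul hm

theorem val_uProd_le_one_of_forall {k : ℕ} (h : ∀ i < k, v (G.x i) ≤ 1) : v (G.uProd k) ≤ 1 := by
  rw [uProd, map_prod]
  exact Finset.prod_le_one' fun i hi => G.val_u_le_one v (h i (Finset.mem_range.1 hi))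

theorem val_uProd_le_one (h0 : v (G.x 0) ≤ 1) (k : ℕ) : v (G.uProd k) ≤ 1 := by
  rcases G.val_trichotomy v h0 k with h | h | ⟨j, -, h⟩
  · exact G.val_uProd_le_one_of_forall v fun i hi => (h i hi.le).le
  · exact G.val_uProd_le_one_of_forall v fun i hi => (h i hi.le).1.le
  · rcases lt_or_ge j k with hj | hj
    · rw [← h.val_uProd_mul hj]
      exact le_mul_of_one_le_right' (one_le_pow₀ (h.one_lt hj).le)
    · exact G.val_uProd_le_one_of_forall v fun i hi => h.val_le_one (by omega)

theorem val_corrTerm_le_one_of_zero {n j : ℕ} (hj : j ≤ n)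
    (h : ∀ i ≤ j, v (G.x i) < 1) : v (G.corrTerm n j) ≤ 1 := by
  rw [corrTerm, map_mul, map_pow]
  refine mul_le_one' (pow_le_one' (G.val_uProd_le_one v (h 0 (by omega)).le _) _) ?_
  rw [map_mul, map_inv₀, ← div_eq_mul_inv, map_pow]
  refine div_le_one_of_le₀ ?_ zero_le
  exact (pow_le_of_le_one zero_le (h j le_rfl).le (by omega)).trans
    (G.val_anti_of_lt_one v (by omega) h)

theorem val_corrTerm_le_one_of_unit {n j : ℕ} (hj : j ≤ n)
    (h : ∀ i ≤ n, v (G.x i) = 1) : v (G.corrTerm n j) ≤ 1 := by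
  rw [corrTerm, map_mul, map_pow]
  refine mul_le_one' (pow_le_one' (G.val_uProd_le_one v (h 0 (by omega)).le _) _) ?_
  rw [map_mul, map_inv₀, map_pow, h j hj, h _ (by omega)]
  simp

theorem two_pow_add_le (hl : 2 ≤ l) {n m : ℕ} (hm : m ≤ n) : l + 1 + l ^ m ≤ l * l ^ (n + 2) := by
  have h1 : l ^ m ≤ l ^ n := Nat.pow_le_pow_right (by omega) hm
  have h2 : 1 ≤ l ^ n := Nat.one_le_pow _ _ (by omega)
  have h3 : l * l ^ (n + 2) = l ^ n * (l * l * l) := by ring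
  have h4 : 2 * 2 ≤ l * l := Nat.mul_le_mul hl hl
  have h5 : 4 * l ≤ l * l * l := Nat.mul_le_mul_right l h4
  nlinarith

theorem IsRamified.val_corrTerm_le_one_of_lt {v : Valuation Ω Γ} {G : GSTower F Ω l} {j' n j : ℕ}
    (h : G.IsRamified v j') (hj : j ≤ n) (hjj : j' < j) : v (G.corrTerm n j) ≤ 1 := by
  have hl := G.two_le
  have h1 := h.one_lt hjj
  have h2 : v (G.x (2 * j - n - 1))⁻¹ ≤ v (G.x j) ^ l ^ (j - j' - 1) := by
    rcases le_or_gt j' (2 * j - n - 1) with hi | hi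
    · refine le_trans ?_ (one_le_pow₀ h1.le)
      rw [map_inv₀]
      refine inv_le_one_of_one_le₀ ?_
      rcases hi.eq_or_lt with hi | hi
      · rw [← hi, h.2.1]
      · exact (h.one_lt hi).le
    · have h3 := h.val_mul_eq_one (i := j' - (2 * j - n - 1)) (by omega) (by omega)
      rw [show j' - (j' - (2 * j - n - 1)) = 2 * j - n - 1 by omega] at h3
      have h4 : v (G.x (2 * j - n - 1))⁻¹ = v (G.x (j' + (j' - (2 * j - n - 1)))) := by
        rw [map_inv₀]; exact (eq_inv_of_mul_eq_one_left h3).symm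
      rw [h4]
      have h5 := G.val_pow_of_one_lt v (h.one_lt_succ.1) (j - j' - 1)
      rw [show j' + 1 + (j - j' - 1) = j by omega] at h5
      rw [h5]
      exact G.val_anti_of_one_lt v (by omega) h.one_lt_succ.1
  have h3 : v (G.uProd j) = (v (G.x j) ^ l)⁻¹ := eq_inv_of_mul_eq_one_left (h.val_uProd_mul hjj)
  rw [corrTerm, map_mul, map_pow, h3, inv_pow, inv_mul_le_iff₀ (pow_pos (pow_pos (G.val_x_pos v j) _) _),
    mul_one, map_mul, map_pow]
  refine (mul_le_mul_right h2 _).trans ?_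
  rw [← pow_add, ← pow_mul]
  exact pow_le_pow_right₀ h1.le (two_pow_add_le hl (by omega))

theorem IsRamified.val_uProd_sub_one {v : Valuation Ω Γ} {G : GSTower F Ω l} {j m : ℕ}
    (h : G.IsRamified v j) (hm : m ≤ j) : v (G.uProd m - 1) ≤ v (G.x 0) := by
  have hl := G.two_le
  induction m with
  | zero => simp [uProd]
  | succ m ih =>
    have e : G.uProd (m + 1) - 1 = (G.uProd m - 1) * G.u m + G.x m ^ (l - 1) := by
      rw [uProd, Finset.prod_range_succ, ← uProd]; rw [u]; ring
    rw [e]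
    refine v.map_add_le ?_ ?_
    · rw [map_mul, G.val_u_of_lt_one v (h.1 m (by omega)), mul_one]
      exact ih (by omega)
    · rw [map_pow]
      refine (pow_le_of_le_one zero_le (h.1 m (by omega)).le (by omega)).trans ?_
      exact G.val_anti_of_lt_one v (Nat.zero_le m) fun i hi => h.1 i (by omega)

theorem IsRamified.val_pow_zero {v : Valuation Ω Γ} {G : GSTower F Ω l} {j i : ℕ}
    (h : G.IsRamified v j) (hi : i < j) : v (G.x i) = v (G.x 0) ^ l ^ i := by
  induction i with
  | zero => simp
  | succ i ih => rw [h.val_succ hi, ih (by omega), pow_succ, pow_mul]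

theorem IsRamified.val_sub_corrTerm {v : Valuation Ω Γ} {G : GSTower F Ω l} {n j : ℕ}
    (h : G.IsRamified v j) (hj : j ≤ n) (hn : n + 1 ≤ 2 * j) :
    v (G.x (n + 1) - G.corrTerm n j) ≤ 1 := by
  have hl := G.two_le
  have h1 := h.val_sub_le_one (i := n + 1 - j) (by omega) (by omega)
  rw [show j + (n + 1 - j) = n + 1 by omega, show j - (n + 1 - j) = 2 * j - n - 1 by omega] at h1
  have e : G.x (n + 1) - G.corrTerm n j =
      (G.x (n + 1) - G.x j ^ (l + 1) * (G.x (2 * j - n - 1))⁻¹)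
      - (G.uProd j - 1) ^ l ^ (n + 2) * (G.x j ^ (l + 1) * (G.x (2 * j - n - 1))⁻¹) := by
    rw [G.sub_pow_pow, one_pow, corrTerm]; ring
  rw [e]
  refine v.map_sub_le h1 ?_
  rw [map_mul, map_mul, map_pow, map_pow, h.2.1, one_pow, one_mul, map_inv₀, ← div_eq_mul_inv]
  refine div_le_one_of_le₀ ?_ zero_le
  refine (pow_le_pow_left' (h.val_uProd_sub_one le_rfl) _).trans ?_
  rw [h.val_pow_zero (i := 2 * j - n - 1) (by omega)]
  have h2 : l ^ (2 * j - n - 1) ≤ l ^ (n + 2) := Nat.pow_le_pow_right (by omega) (by omega)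
  exact pow_le_pow_right_of_le_one' (h.val_le_one (i := 0) (by omega)) h2

theorem val_sub_corr {n : ℕ} (h0 : v (G.x 0) ≤ 1) :
    v (G.x (n + 1) - G.corr n) ^ (l * l ^ (n - n / 2)) * v (G.uProd (n / 2 + 1)) ≤ 1 := by
  have hl := G.two_le
  have hpi := G.val_uProd_le_one v h0 (n / 2 + 1)
  suffices h : v (G.x (n + 1) - G.corr n) ≤ 1 ∨
      ∃ j, j < n / 2 + 1 ∧ G.IsRamified v j ∧ v (G.corr n) ≤ 1 by
    rcases h with h | ⟨j, hj, h, hw⟩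
    · exact mul_le_one' (pow_le_one' h _) hpi
    · have h1 : v (G.x (n + 1) - G.corr n) ≤ v (G.x (n + 1)) :=
        v.map_sub_le le_rfl (hw.trans (h.one_lt (by omega)).le)
      have h2 := G.val_pow_of_one_lt v (h.one_lt hj) (n - n / 2)
      rw [show n / 2 + 1 + (n - n / 2) = n + 1 by omega] at h2
      refine (mul_le_mul_left (pow_le_pow_left' h1 _) _).trans ?_
      rw [mul_comm l, pow_mul, h2, mul_comm, h.val_uProd_mul hj]
  rcases G.val_trichotomy v h0 n with h | h | ⟨j, hj, h⟩
  · left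
    refine v.map_sub_le ?_ (v.map_sum_le fun j hj => ?_)
    · rcases G.val_succ_of_lt_one v (h n le_rfl) with h' | h'
      exacts [h'.1.le, h'.1.le]
    · simp only [Finset.mem_filter, Finset.mem_range] at hj
      exact G.val_corrTerm_le_one_of_zero v (by omega) fun i hi => h i (by omega)
  · left
    refine v.map_sub_le ?_ (v.map_sum_le fun j hj => ?_)
    · exact (G.val_succ_of_eq_one v (h n le_rfl).1 (h n le_rfl).2).1.le
    · simp only [Finset.mem_filter, Finset.mem_range] at hj
      exact G.val_corrTerm_le_one_of_unit v (by omega) fun i hi => (h i (by omega)).1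
  · have hterm : ∀ i ≤ n, i ≠ j → v (G.corrTerm n i) ≤ 1 := by
      intro i hi hij
      rcases lt_or_gt_of_ne hij with hij | hij
      · exact G.val_corrTerm_le_one_of_zero v hi fun m hm => h.1 m (by omega)
      · exact h.val_corrTerm_le_one_of_lt hi hij
    rcases le_or_gt (n + 1) (2 * j) with h2 | h2
    · left
      have hmem : j ∈ (Finset.range (n + 1)).filter (fun j => n + 1 ≤ 2 * j) := by
        simp; omega
      rw [corr, ← Finset.add_sum_erase _ _ hmem, ← sub_sub]
      refine v.map_sub_le (h.val_sub_corrTerm hj h2) (v.map_sum_le fun i hi => ?_)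
      simp only [Finset.mem_erase, Finset.mem_filter, Finset.mem_range] at hi
      exact hterm i (by omega) hi.1
    · right
      refine ⟨j, by omega, h, v.map_sum_le fun i hi => ?_⟩
      simp only [Finset.mem_filter, Finset.mem_range] at hi
      exact hterm i (by omega) (by omega)

end GSTower

theorem exists_valuationSubring_of_not_isIntegral {A Ω : Type*} [CommRing A] [Field Ω] [Algebra A Ω]
    {f : Ω} (hf : ¬ IsIntegral A f) :
    ∃ V : ValuationSubring Ω, (∀ a : A, algebraMap A Ω a ∈ V) ∧ f ∉ V := by
  obtain ⟨V, hV, hfV⟩ := Subring.exists_le_valuationSubring_of_isIntegrallyClosedIn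
    (R := (integralClosure A Ω).toSubring) (x := f) hf
  exact ⟨V, fun a => hV (Subalgebra.algebraMap_mem (integralClosure A Ω) a), hfV⟩

theorem ValuationSubring.mem_of_isIntegral {A Ω : Type*} [CommRing A] [Field Ω] [Algebra A Ω]
    (V : ValuationSubring Ω) (hV : ∀ a : A, algebraMap A Ω a ∈ V) {f : Ω} (hf : IsIntegral A f) :
    f ∈ V := by
  let g : A →+* V := (algebraMap A Ω).codRestrict V.toSubring hV
  have : IsIntegral V f := by
    obtain ⟨p, hp, hpe⟩ := hf
    refine ⟨p.map g, hp.map g, ?_⟩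
    rw [Polynomial.eval₂_map]; exact hpe
  obtain ⟨y, hy⟩ := IsIntegrallyClosed.isIntegral_iff.1 this
  exact hy ▸ y.2

namespace GSTower

variable {F Ω : Type*} [Field F] [Field Ω] [Algebra F Ω] {l : ℕ} (G : GSTower F Ω l)

/-- The valuation rings of `Ω` over `F` at which `x 0` is finite. -/
def finPlaces : Set (ValuationSubring Ω) :=
  {V | (∀ c : F, algebraMap F Ω c ∈ V) ∧ G.x 0 ∈ V}

/-- The valuation rings of `Ω` over `F` at which `x 0` is infinite. -/
def infPlaces : Set (ValuationSubring Ω) :=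
  {V | (∀ c : F, algebraMap F Ω c ∈ V) ∧ G.x 0 ∉ V}

theorem exists_infPlace : ∃ V, V ∈ G.infPlaces := by
  obtain ⟨V, hV, h⟩ := exists_valuationSubring_of_not_isIntegral (A := F) (f := G.x 0)
    fun h => G.transcendental h.isAlgebraic
  exact ⟨V, hV, h⟩

theorem one_lt_of_infPlaces {V : ValuationSubring Ω} (hV : V ∈ G.infPlaces) (i : ℕ) :
    1 < V.valuation (G.x i) := by
  refine G.one_lt_val _ (i := 0) ?_ (Nat.zero_le i)
  rw [← not_le, V.valuation_le_one_iff]; exact hV.2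

/-- The elements integral over the polynomials in `x 0`. -/
def ring : Subalgebra F Ω where
  carrier := {f | ∀ V ∈ G.finPlaces, f ∈ V}
  mul_mem' hf hg V hV := mul_mem (hf V hV) (hg V hV)
  add_mem' hf hg V hV := add_mem (hf V hV) (hg V hV)
  algebraMap_mem' c _ hV := hV.1 c

theorem mem_ring {f : Ω} : f ∈ G.ring ↔ ∀ V ∈ G.finPlaces, V.valuation f ≤ 1 := by
  simp only [ValuationSubring.valuation_le_one_iff]; rfl

/-- The `n`-th field of the tower. -/
def field : ℕ → IntermediateField F Ω
  | 0 => IntermediateField.adjoin F {G.x 0}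
  | n + 1 => (IntermediateField.adjoin (field n) {G.x (n + 1)}).restrictScalars F

theorem field_le_succ (n : ℕ) : G.field n ≤ G.field (n + 1) := fun f hf =>
  IntermediateField.algebraMap_mem (IntermediateField.adjoin (G.field n) {G.x (n + 1)}) ⟨f, hf⟩

theorem field_mono : Monotone G.field := monotone_nat_of_le_succ G.field_le_succ

theorem x_mem (n : ℕ) : G.x n ∈ G.field n := by
  cases n with
  | zero => exact IntermediateField.mem_adjoin_simple_self F _
  | succ n => exact IntermediateField.mem_adjoin_simple_self (G.field n) _

theorem x_mem_of_le {i n : ℕ} (h : i ≤ n) : G.x i ∈ G.field n := G.field_mono h (G.x_mem i)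

theorem u_mem_of_le {i n : ℕ} (h : i ≤ n) : G.u i ∈ G.field n :=
  add_mem (pow_mem (G.x_mem_of_le h) _) (one_mem _)

theorem exists_eq_sum_of_mem_succ {n : ℕ} {f : Ω} (hf : f ∈ G.field (n + 1)) :
    ∃ c : ℕ → Ω, (∀ i, c i ∈ G.field n) ∧ f = ∑ i ∈ Finset.range l, c i * G.x (n + 1) ^ i := by
  have hl := G.two_le
  let d : G.field n := ⟨G.x n ^ l / G.u n,
    div_mem (pow_mem (G.x_mem n) _) (G.u_mem_of_le le_rfl)⟩
  let M : Polynomial (G.field n) := Polynomial.X ^ l + (Polynomial.X - Polynomial.C d)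
  have hM : M.Monic := Polynomial.monic_X_pow_add (by
    rw [Polynomial.degree_X_sub_C]; exact_mod_cast hl)
  have hMd : M.natDegree = l := by
    rw [Polynomial.natDegree_add_eq_left_of_natDegree_lt, Polynomial.natDegree_X_pow]
    rw [Polynomial.natDegree_X_pow, Polynomial.natDegree_X_sub_C]; omega
  have hroot : Polynomial.aeval (G.x (n + 1)) M = 0 := by
    have h1 : algebraMap (G.field n) Ω d = G.x n ^ l / G.u n := rfl
    simp only [M, map_add, map_sub, map_pow, Polynomial.aeval_X, Polynomial.aeval_C, h1]
    rw [← G.pow_add_self_succ]; ring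
  have hint : IsIntegral (G.field n) (G.x (n + 1)) := ⟨M, hM, hroot⟩
  have hf' : f ∈ (IntermediateField.adjoin (G.field n) {G.x (n + 1)}).toSubalgebra := hf
  rw [IntermediateField.adjoin_simple_toSubalgebra_of_isAlgebraic hint.isAlgebraic,
    Algebra.adjoin_singleton_eq_range_aeval] at hf'
  obtain ⟨P, rfl⟩ := hf'
  refine ⟨fun i => ((P %ₘ M).coeff i : G.field n), fun i => SetLike.coe_mem _, ?_⟩
  have h2 : Polynomial.aeval (G.x (n + 1)) P = Polynomial.aeval (G.x (n + 1)) (P %ₘ M) := by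
    conv_lhs => rw [← Polynomial.modByMonic_add_div P M]
    rw [map_add, map_mul, hroot, zero_mul, add_zero]
  change Polynomial.aeval (G.x (n + 1)) P = _
  rw [h2, Polynomial.aeval_eq_sum_range' (n := l)]
  · rfl
  · refine (Polynomial.natDegree_modByMonic_lt _ hM fun h => ?_).trans_eq hMd
    rw [h, Polynomial.natDegree_one] at hMd; omega

/-- `g` reduces to `1` at every infinite place. -/
def IsPrincipalUnit (g : Ω) : Prop := ∀ V ∈ G.infPlaces, V.valuation (g - 1) < 1

/-- `f` has leading term `a * z ^ k` at every infinite place. -/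
def HasLead (z f : Ω) (k : ℤ) (a : F) : Prop :=
  ∃ g, G.IsPrincipalUnit g ∧ f = algebraMap F Ω a * z ^ k * g

variable {G}

theorem IsPrincipalUnit.val_eq_one {g : Ω} (hg : G.IsPrincipalUnit g) {V : ValuationSubring Ω}
    (hV : V ∈ G.infPlaces) : V.valuation g = 1 := by
  have := hg V hV
  rw [← map_one V.valuation] at this
  have := Valuation.map_eq_of_sub_lt V.valuation this
  rwa [map_one] at this

theorem IsPrincipalUnit.ne_zero {g : Ω} (hg : G.IsPrincipalUnit g) : g ≠ 0 := by
  obtain ⟨V, hV⟩ := G.exists_infPlace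
  rintro rfl
  simpa using hg.val_eq_one hV

theorem IsPrincipalUnit.one : G.IsPrincipalUnit 1 := fun _ _ => by simp

theorem IsPrincipalUnit.mul {g h : Ω} (hg : G.IsPrincipalUnit g) (hh : G.IsPrincipalUnit h) :
    G.IsPrincipalUnit (g * h) := fun V hV => by
  rw [show g * h - 1 = (g - 1) * h + (h - 1) by ring]
  refine V.valuation.map_add_lt ?_ (hh V hV)
  rw [map_mul, hh.val_eq_one hV, mul_one]; exact hg V hV

theorem IsPrincipalUnit.inv {g : Ω} (hg : G.IsPrincipalUnit g) : G.IsPrincipalUnit g⁻¹ :=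
  fun V hV => by
  have h0 := hg.ne_zero
  rw [show g⁻¹ - 1 = -((g - 1) * g⁻¹) by field_simp; ring, Valuation.map_neg, map_mul, map_inv₀,
    hg.val_eq_one hV, inv_one, mul_one]
  exact hg V hV

theorem IsPrincipalUnit.pow {g : Ω} (hg : G.IsPrincipalUnit g) (k : ℕ) :
    G.IsPrincipalUnit (g ^ k) := by
  induction k with
  | zero => simpa using IsPrincipalUnit.one
  | succ k ih => rw [pow_succ]; exact ih.mul hg

theorem IsPrincipalUnit.zpow {g : Ω} (hg : G.IsPrincipalUnit g) (k : ℤ) :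
    G.IsPrincipalUnit (g ^ k) := by
  obtain ⟨k, rfl | rfl⟩ := k.eq_nat_or_neg
  · rw [zpow_natCast]; exact hg.pow k
  · rw [zpow_neg, zpow_natCast]; exact (hg.pow k).inv

theorem val_algebraMap_le {V : ValuationSubring Ω} (hV : ∀ c : F, algebraMap F Ω c ∈ V) (c : F) :
    V.valuation (algebraMap F Ω c) ≤ 1 := by
  rw [V.valuation_le_one_iff]; exact hV c

theorem val_algebraMap {V : ValuationSubring Ω} (hV : ∀ c : F, algebraMap F Ω c ∈ V) {c : F}
    (hc : c ≠ 0) : V.valuation (algebraMap F Ω c) = 1 := by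
  refine le_antisymm (val_algebraMap_le hV c) ?_
  have := val_algebraMap_le hV c⁻¹
  rw [map_inv₀, map_inv₀] at this
  have h0 : 0 < V.valuation (algebraMap F Ω c) := by
    rw [zero_lt_iff, Valuation.ne_zero_iff]; simpa using hc
  exact (inv_le_one₀ h0).1 this

theorem HasLead.val_eq {z f : Ω} {k : ℤ} {a : F} (h : G.HasLead z f k a) (ha : a ≠ 0)
    {V : ValuationSubring Ω} (hV : V ∈ G.infPlaces) : V.valuation f = V.valuation z ^ k := by
  obtain ⟨g, hg, rfl⟩ := h
  rw [map_mul, map_mul, val_algebraMap hV.1 ha, hg.val_eq_one hV, map_zpow₀, one_mul, mul_one]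

theorem HasLead.div {z f f' : Ω} {k k' : ℤ} {a a' : F} (hz : z ≠ 0) (h : G.HasLead z f k a)
    (h' : G.HasLead z f' k' a') :
    G.HasLead z (f / f') (k - k') (a / a') := by
  obtain ⟨g, hg, rfl⟩ := h
  obtain ⟨g', hg', rfl⟩ := h'
  refine ⟨g * g'⁻¹, hg.mul hg'.inv, ?_⟩
  rw [map_div₀, zpow_sub₀ hz]
  simp only [div_eq_mul_inv, mul_inv]
  ring

theorem hasLead_sum {ι : Type*} {z : Ω} (hz : ∀ V ∈ G.infPlaces, 1 < V.valuation z)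
    (s : Finset ι) (hs : s.Nonempty) (f : ι → Ω) (e : ι → ℤ) (a : ι → F) (he : Set.InjOn e s)
    (ha : ∀ i ∈ s, a i ≠ 0) (h : ∀ i ∈ s, G.HasLead z (f i) (e i) (a i)) :
    ∃ i ∈ s, G.HasLead z (∑ j ∈ s, f j) (e i) (a i) := by
  classical
  obtain ⟨i, hi, hmax⟩ := s.exists_max_image e hs
  refine ⟨i, hi, ?_⟩
  obtain ⟨V₀, hV₀⟩ := G.exists_infPlace
  have hz0 : z ≠ 0 := by
    rintro rfl
    have := hz V₀ hV₀
    rw [map_zero] at this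
    exact absurd this (not_lt.2 zero_le)
  have ha0 : algebraMap F Ω (a i) ≠ 0 := by simpa using ha i hi
  have hne : algebraMap F Ω (a i) * z ^ e i ≠ 0 := mul_ne_zero ha0 (zpow_ne_zero _ hz0)
  obtain ⟨g, hg, hfg⟩ := h i hi
  refine ⟨g + (∑ j ∈ s.erase i, f j) / (algebraMap F Ω (a i) * z ^ e i), fun V hV => ?_, ?_⟩
  · rw [add_sub_right_comm]
    refine V.valuation.map_add_lt (hg V hV) ?_
    rw [map_div₀]
    have hv : V.valuation (algebraMap F Ω (a i) * z ^ e i) = V.valuation z ^ e i := by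
      rw [map_mul, val_algebraMap hV.1 (ha i hi), one_mul, map_zpow₀]
    have hpos : 0 < V.valuation z ^ e i := zpow_pos (zero_lt_one.trans (hz V hV)) _
    rw [hv, div_lt_one₀ hpos]
    refine V.valuation.map_sum_lt hpos.ne' fun j hj => ?_
    rw [Finset.mem_erase] at hj
    rw [(h j hj.2).val_eq (ha j hj.2) hV]
    exact zpow_lt_zpow_right₀ (hz V hV)
      (lt_of_le_of_ne (hmax j hj.2) fun h => hj.1 (he hj.2 hi h))
  · rw [mul_add, mul_div_cancel₀ _ hne, ← hfg, Finset.add_sum_erase _ _ hi]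

theorem exists_hasLead_aeval {r : Polynomial F} (hr : r ≠ 0) :
    ∃ k : ℤ, ∃ a : F, a ≠ 0 ∧ G.HasLead (G.x 0) (Polynomial.aeval (G.x 0) r) k a := by
  obtain ⟨i, hi, h⟩ := hasLead_sum (z := G.x 0) (fun V hV => G.one_lt_of_infPlaces hV 0) r.support
    (by simpa using hr) (fun i => algebraMap F Ω (r.coeff i) * G.x 0 ^ i) (fun i => (i : ℤ))
    (fun i => r.coeff i) (fun i _ j _ h => Nat.cast_injective h)
    (fun i hi => by simpa using hi) (fun i hi => ⟨1, .one, by simp⟩)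
  refine ⟨i, _, by simpa using hi, ?_⟩
  convert h using 1
  rw [Polynomial.aeval_def, Polynomial.eval₂_eq_sum, Polynomial.sum]

theorem exists_isPrincipalUnit_succ (n : ℕ) :
    ∃ h, G.IsPrincipalUnit h ∧ G.x n = G.x (n + 1) ^ l * h := by
  have hl := G.two_le
  refine ⟨G.x n / G.x (n + 1) ^ l, fun V hV => ?_,
    (mul_div_cancel₀ _ (pow_ne_zero _ (G.x_ne_zero _))).symm⟩
  have hy := G.one_lt_of_infPlaces hV (n + 1)
  have hx := G.one_lt_of_infPlaces hV n
  have e : G.x n / G.x (n + 1) ^ l - 1 = (G.x (n + 1) + G.x n / G.u n) / G.x (n + 1) ^ l := by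
    have h1 := G.pow_add_self_succ n
    have h2 : G.x n ^ l / G.u n = G.x n - G.x n / G.u n := by
      have := G.u_ne_zero n
      rw [pow_eq]; field_simp; rw [u]; ring
    have := G.x_ne_zero (n + 1)
    rw [h2] at h1
    rw [div_sub_one (pow_ne_zero _ this)]
    congr 1
    linear_combination -h1
  have hpos : 1 < V.valuation (G.x (n + 1)) ^ l := one_lt_pow₀ hy (by omega)
  rw [e, map_div₀, map_pow, div_lt_one₀ (zero_lt_one.trans hpos)]
  refine V.valuation.map_add_lt ?_ (lt_of_le_of_lt ?_ hpos)
  · conv_lhs => rw [← pow_one (V.valuation (G.x (n + 1)))]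
    exact pow_lt_pow_right₀ hy hl
  · rw [map_div₀, G.val_u_of_one_lt _ hx]
    exact div_le_one_of_le₀ (le_self_pow hx.le (by omega)) zero_le

theorem hasLead_succ_term {n i : ℕ} {f : Ω} {k : ℤ} {a : F} (h : G.HasLead (G.x n) f k a) :
    G.HasLead (G.x (n + 1)) (f * G.x (n + 1) ^ i) (l * k + i) a := by
  obtain ⟨g, hg, rfl⟩ := h
  obtain ⟨h, hh, hx⟩ := G.exists_isPrincipalUnit_succ n
  refine ⟨h ^ k * g, (hh.zpow k).mul hg, ?_⟩
  rw [hx, mul_zpow, zpow_add₀ (G.x_ne_zero _), zpow_mul, zpow_natCast, zpow_natCast]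
  ring

theorem exists_hasLead_sum {n : ℕ} (ih : ∀ f ∈ G.field n, f ≠ 0 →
      ∃ k : ℤ, ∃ a : F, a ≠ 0 ∧ G.HasLead (G.x n) f k a)
    {c : ℕ → Ω} (hc : ∀ i, c i ∈ G.field n) (hne : ∃ i < l, c i ≠ 0) :
    ∃ k : ℤ, ∃ a : F, a ≠ 0 ∧
      G.HasLead (G.x (n + 1)) (∑ i ∈ Finset.range l, c i * G.x (n + 1) ^ i) k a := by
  classical
  have hl := G.two_le
  have ih' : ∀ i, ∃ k : ℤ, ∃ a : F, c i ≠ 0 → a ≠ 0 ∧ G.HasLead (G.x n) (c i) k a := fun i => by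
    by_cases h : c i = 0
    · exact ⟨0, 0, fun h' => absurd h h'⟩
    · obtain ⟨k, a, h⟩ := ih _ (hc i) h
      exact ⟨k, a, fun _ => h⟩
  choose k a hka using ih'
  obtain ⟨i₀, hi₀, hci₀⟩ := hne
  have hsum : ∑ i ∈ Finset.range l, c i * G.x (n + 1) ^ i =
      ∑ i ∈ (Finset.range l).filter (fun i => c i ≠ 0), c i * G.x (n + 1) ^ i := by
    symm
    apply Finset.sum_filter_of_ne
    intro i _ h h0
    exact h (by rw [h0, zero_mul])
  rw [hsum]
  obtain ⟨i, hi, h⟩ := hasLead_sum (G := G) (z := G.x (n + 1))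
    (fun V hV => G.one_lt_of_infPlaces hV _)
    ((Finset.range l).filter (fun i => c i ≠ 0))
    ⟨i₀, by simp [hi₀, hci₀]⟩ (fun i => c i * G.x (n + 1) ^ i) (fun i => l * k i + i) a
    (fun i hi j hj h => by
      simp only [Finset.coe_filter, Finset.mem_range, Set.mem_ofPred_eq] at hi hj
      have h1 : ((l * k i + i : ℤ)) % l = (l * k j + j : ℤ) % l := congrArg (· % (l : ℤ)) h
      rw [Int.mul_add_emod_self_left, Int.mul_add_emod_self_left,
        Int.emod_eq_of_lt (by omega) (by omega), Int.emod_eq_of_lt (by omega) (by omega)] at h1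
      exact_mod_cast h1)
    (fun i hi => (hka i (Finset.mem_filter.1 hi).2).1)
    (fun i hi => hasLead_succ_term (hka i (Finset.mem_filter.1 hi).2).2)
  exact ⟨_, _, (hka i (Finset.mem_filter.1 hi).2).1, h⟩

theorem exists_hasLead (n : ℕ) : ∀ f ∈ G.field n, f ≠ 0 →
    ∃ k : ℤ, ∃ a : F, a ≠ 0 ∧ G.HasLead (G.x n) f k a := by
  induction n with
  | zero =>
    intro f hf hf0
    obtain ⟨r, s, rfl⟩ := (IntermediateField.mem_adjoin_simple_iff F _).1 hf
    have hr : r ≠ 0 := by rintro rfl; simp at hf0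
    have hs : s ≠ 0 := by rintro rfl; simp at hf0
    obtain ⟨k, a, ha, h⟩ := exists_hasLead_aeval (G := G) hr
    obtain ⟨k', a', ha', h'⟩ := exists_hasLead_aeval (G := G) hs
    exact ⟨_, _, div_ne_zero ha ha', h.div (G.x_ne_zero 0) h'⟩
  | succ n ih =>
    intro f hf hf0
    obtain ⟨c, hc, rfl⟩ := G.exists_eq_sum_of_mem_succ hf
    refine exists_hasLead_sum ih hc ?_
    by_contra! h
    exact hf0 (Finset.sum_eq_zero fun i hi => by rw [h i (Finset.mem_range.1 hi), zero_mul])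

/-- The powers of `x (n + 1)` below `l` are linearly independent over the `n`-th field. -/
theorem coeff_eq_zero {n : ℕ} {c : ℕ → Ω} (hc : ∀ i, c i ∈ G.field n)
    (h : ∑ i ∈ Finset.range l, c i * G.x (n + 1) ^ i = 0) : ∀ i < l, c i = 0 := by
  by_contra! hne
  obtain ⟨k, a, ha, hk⟩ := exists_hasLead_sum (exists_hasLead n) hc hne
  obtain ⟨V, hV⟩ := G.exists_infPlace
  have h1 := hk.val_eq ha hV
  rw [h, map_zero] at h1
  have hx := (zero_lt_one.trans (G.one_lt_of_infPlaces hV (n + 1))).ne'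
  exact absurd h1.symm (zpow_ne_zero _ hx)

/-- A regular function with a zero at an infinite place vanishes. -/
theorem eq_zero_of_mem_ring {n : ℕ} {f : Ω} (hf : f ∈ G.field n) (hO : f ∈ G.ring)
    {V : ValuationSubring Ω} (hV : V ∈ G.infPlaces) (hv : V.valuation f < 1) : f = 0 := by
  by_contra h0
  obtain ⟨k, a, ha, h⟩ := exists_hasLead n f hf h0
  have hk : k < 0 := by
    by_contra! hk
    rw [h.val_eq ha hV] at hv
    exact absurd hv (not_lt.2 (one_le_zpow₀ (G.one_lt_of_infPlaces hV n).le hk))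
  have hint : IsIntegral F f := by
    by_contra hni
    obtain ⟨W, hW, hfW⟩ := exists_valuationSubring_of_not_isIntegral hni
    refine hfW ?_
    by_cases hx : G.x 0 ∈ W
    · exact hO W ⟨hW, hx⟩
    · rw [← W.valuation_le_one_iff, h.val_eq ha (V := W) ⟨hW, hx⟩]
      exact (zpow_lt_one_of_neg₀ (G.one_lt_of_infPlaces (V := W) ⟨hW, hx⟩ n) hk).le
  have := V.mem_of_isIntegral hV.1 hint.isAlgebraic.inv.isIntegral
  rw [← V.valuation_le_one_iff, map_inv₀, inv_le_one₀] at this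
  · exact absurd hv (not_lt.2 this)
  · rw [zero_lt_iff, Valuation.ne_zero_iff]; exact h0

/-- Two elements of the same order at infinity differ by a scalar and a smaller element. -/
theorem exists_val_sub_lt {n : ℕ} {f g : Ω} (hf : f ∈ G.field n) (hg : g ∈ G.field n) (hg0 : g ≠ 0)
    {V : ValuationSubring Ω} (hV : V ∈ G.infPlaces) (h : V.valuation f = V.valuation g) :
    ∃ c : F, V.valuation (f - algebraMap F Ω c * g) < V.valuation g := by
  have hvg : 0 < V.valuation g := by rw [zero_lt_iff, Valuation.ne_zero_iff]; exact hg0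
  have hf0 : f ≠ 0 := by
    rintro rfl
    rw [map_zero] at h
    exact hvg.ne h
  obtain ⟨k, a, ha, hk⟩ := exists_hasLead n _ (div_mem hf hg) (div_ne_zero hf0 hg0)
  have hk0 : k = 0 := by
    have h1 := hk.val_eq ha hV
    rw [map_div₀, h, div_self hvg.ne'] at h1
    have hx := G.one_lt_of_infPlaces hV n
    rcases lt_trichotomy k 0 with h2 | h2 | h2
    · exact absurd h1.symm (zpow_lt_one_of_neg₀ hx h2).ne
    · exact h2
    · exact absurd h1.symm (one_lt_zpow₀ hx h2).ne'
  subst hk0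
  obtain ⟨p, hp, hpf⟩ := hk
  refine ⟨a, ?_⟩
  have e : f - algebraMap F Ω a * g = algebraMap F Ω a * (p - 1) * g := by
    rw [div_eq_iff hg0] at hpf
    rw [hpf]; simp; ring
  rw [e, map_mul, map_mul, val_algebraMap hV.1 ha, one_mul]
  exact mul_lt_of_lt_one_left hvg (hp V hV)

end GSTower

section LinearAlgebra

variable {F M N : Type*} [Field F] [AddCommGroup M] [Module F M] [AddCommGroup N] [Module F N]

theorem finrank_add_finrank_le_of_section (S W : Submodule F M) (U : Submodule F N) (f : M →ₗ[F] N)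
    [FiniteDimensional F W] (hSW : S ≤ W) (hS : ∀ s ∈ S, f s = 0)
    (hU : ∀ u ∈ U, ∃ w ∈ W, f w = u) :
    Module.finrank F U + Module.finrank F S ≤ Module.finrank F W := by
  let g : W →ₗ[F] N := f.domRestrict W
  rw [← LinearMap.finrank_range_add_finrank_ker g]
  refine add_le_add (Submodule.finrank_mono ?_) ?_
  · intro u hu
    obtain ⟨w, hw, rfl⟩ := hU u hu
    exact ⟨⟨w, hw⟩, rfl⟩
  · let k : S →ₗ[F] LinearMap.ker g :=
      (Submodule.inclusion hSW).codRestrict _ fun s => hS s s.2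
    refine LinearMap.finrank_le_finrank_of_injective (f := k) fun a b h => ?_
    have := congrArg (fun z : LinearMap.ker g => ((z : W) : M)) h
    exact Subtype.ext this

theorem finrank_add_finrank_le_of_comap (U C : Submodule F N) (S W : Submodule F M) (f : N →ₗ[F] M)
    [FiniteDimensional F U] [FiniteDimensional F W] [FiniteDimensional F C]
    (hSW : S ≤ W) (hU : ∀ u ∈ U, f u ∈ W) (hC : ∀ u ∈ U, f u ∈ S → u ∈ C) :
    Module.finrank F U + Module.finrank F S ≤ Module.finrank F W + Module.finrank F C := by
  have : FiniteDimensional F S := Submodule.finiteDimensional_of_le hSW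
  let fU : U →ₗ[F] W := f.restrict hU
  let g : (U × S) →ₗ[F] W := fU.coprod (Submodule.inclusion hSW)
  have h1 := LinearMap.finrank_range_add_finrank_ker g
  rw [Module.finrank_prod] at h1
  have hk : ∀ z : LinearMap.ker g, f (z.1.1 : N) = -(z.1.2 : M) := fun z => by
    have := congrArg (fun w : W => (w : M)) (LinearMap.mem_ker.1 z.2)
    exact eq_neg_of_add_eq_zero_left this
  let k : LinearMap.ker g →ₗ[F] C :=
    ((U.subtype ∘ₗ LinearMap.fst F U S) ∘ₗ (LinearMap.ker g).subtype).codRestrict C fun z =>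
      hC _ z.1.1.2 (by
        change f (z.1.1 : N) ∈ S
        rw [hk z]; exact neg_mem z.1.2.2)
  have h2 : Module.finrank F (LinearMap.ker g) ≤ Module.finrank F C := by
    refine LinearMap.finrank_le_finrank_of_injective (f := k) fun a b h => ?_
    have h3 : (a.1.1 : N) = b.1.1 := congrArg (fun z : C => (z : N)) h
    have h4 : (a.1.2 : M) = b.1.2 := by
      rw [← neg_inj, ← hk a, ← hk b, h3]
    exact Subtype.ext (Prod.ext (Subtype.ext h3) (Subtype.ext h4))
  have h3 := Submodule.finrank_le (LinearMap.range g)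
  omega

theorem finiteDimensional_and_finrank_le_succ {S S' : Submodule F M} [FiniteDimensional F S]
    (hSS : S ≤ S') (h : ∀ f ∈ S', ∀ g ∈ S', g ∉ S → ∃ c : F, f - c • g ∈ S) :
    FiniteDimensional F S' ∧ Module.finrank F S' ≤ Module.finrank F S + 1 := by
  by_cases hle : S' ≤ S
  · obtain rfl := le_antisymm hSS hle
    exact ⟨inferInstance, Nat.le_succ _⟩
  · obtain ⟨g, hg, hgS⟩ := SetLike.not_le_iff_exists.1 hle
    have hle : S' ≤ S ⊔ Submodule.span F {g} := fun f hf => by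
      obtain ⟨c, hc⟩ := h f hf g hg hgS
      rw [← sub_add_cancel f (c • g)]
      exact add_mem (Submodule.mem_sup_left hc)
        (Submodule.mem_sup_right (Submodule.smul_mem _ _ (Submodule.mem_span_singleton_self g)))
    refine ⟨Submodule.finiteDimensional_of_le hle, (Submodule.finrank_mono hle).trans ?_⟩
    refine (Submodule.finrank_add_le_finrank_add_finrank _ _).trans ?_
    gcongr
    exact (finrank_span_le_card ({g} : Set M)).trans (by simp)

end LinearAlgebra

namespace GSTower

variable {F Ω : Type*} [Field F] [Field Ω] [Algebra F Ω] {l : ℕ} {G : GSTower F Ω l}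

/-- Functions in the `n`-th field with a pole of order less than `k` at a fixed infinite place. -/
def valLT (V : G.infPlaces) (n k : ℕ) : Submodule F Ω where
  carrier := {f | f ∈ G.field n ∧ V.1.valuation f < V.1.valuation (G.x n) ^ k}
  add_mem' hf hg := ⟨add_mem hf.1 hg.1, V.1.valuation.map_add_lt hf.2 hg.2⟩
  zero_mem' := ⟨zero_mem _, by
    rw [map_zero]; exact pow_pos (zero_lt_one.trans (G.one_lt_of_infPlaces V.2 n)) _⟩
  smul_mem' c f hf := by
    refine ⟨(G.field n).smul_mem hf.1, ?_⟩
    rw [Algebra.smul_def, map_mul]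
    exact (mul_le_of_le_one_left' (val_algebraMap_le V.2.1 c)).trans_lt hf.2

variable (V : G.infPlaces) {n : ℕ}

theorem valLT_mono {k k' : ℕ} (h : k ≤ k') : valLT V n k ≤ valLT V n k' := fun _ hf =>
  ⟨hf.1, hf.2.trans_le (pow_le_pow_right₀ (G.one_lt_of_infPlaces V.2 n).le h)⟩

theorem exists_val_eq_zpow {f : Ω} (hf : f ∈ G.field n) (hf0 : f ≠ 0) :
    ∃ m : ℤ, V.1.valuation f = V.1.valuation (G.x n) ^ m := by
  obtain ⟨k, a, ha, h⟩ := exists_hasLead n f hf hf0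
  exact ⟨k, h.val_eq ha V.2⟩

theorem exists_mem_valLT {f : Ω} (hf : f ∈ G.field n) : ∃ k, f ∈ valLT V n k := by
  rcases eq_or_ne f 0 with rfl | hf0
  · exact ⟨0, zero_mem _⟩
  obtain ⟨m, hm⟩ := exists_val_eq_zpow V hf hf0
  refine ⟨(m + 1).toNat, hf, ?_⟩
  rw [hm, ← zpow_natCast]
  exact zpow_lt_zpow_right₀ (G.one_lt_of_infPlaces V.2 n) (by omega)

theorem val_eq_of_mem_succ {k : ℕ} {f : Ω} (hf : f ∈ valLT V n (k + 1)) (hf' : f ∉ valLT V n k) :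
    V.1.valuation f = V.1.valuation (G.x n) ^ k := by
  have ht := G.one_lt_of_infPlaces V.2 n
  have hf0 : f ≠ 0 := by rintro rfl; exact hf' (zero_mem _)
  obtain ⟨m, hm⟩ := exists_val_eq_zpow V hf.1 hf0
  have h1 := hf.2
  have h2 := not_lt.1 fun h => hf' ⟨hf.1, h⟩
  rw [hm, ← zpow_natCast] at h1 h2
  rw [zpow_lt_zpow_iff_right₀ ht] at h1
  rw [zpow_le_zpow_iff_right₀ ht] at h2
  rw [hm, ← zpow_natCast]
  congr 1
  push_cast at h1
  omega

theorem exists_sub_smul_mem {k : ℕ} {f g : Ω} (hf : f ∈ valLT V n (k + 1))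
    (hg : g ∈ valLT V n (k + 1)) (hg' : g ∉ valLT V n k) : ∃ c : F, f - c • g ∈ valLT V n k := by
  by_cases hf' : f ∈ valLT V n k
  · exact ⟨0, by simpa using hf'⟩
  have h1 := val_eq_of_mem_succ V hf hf'
  have h2 := val_eq_of_mem_succ V hg hg'
  obtain ⟨c, hc⟩ := exists_val_sub_lt hf.1 hg.1 (by rintro rfl; exact hg' (zero_mem _)) V.2
    (h1.trans h2.symm)
  rw [← Algebra.smul_def] at hc
  exact ⟨c, sub_mem hf.1 ((G.field n).smul_mem hg.1), hc.trans_eq h2⟩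

theorem finrank_inf_succ (S : Submodule F Ω) (k : ℕ)
    (_ : FiniteDimensional F (valLT V n k ⊓ S : Submodule F Ω)) :
    FiniteDimensional F (valLT V n (k + 1) ⊓ S : Submodule F Ω) ∧
      Module.finrank F (valLT V n (k + 1) ⊓ S : Submodule F Ω) ≤
        Module.finrank F (valLT V n k ⊓ S : Submodule F Ω) + 1 := by
  refine finiteDimensional_and_finrank_le_succ
    (inf_le_inf_right _ (valLT_mono V (Nat.le_succ k))) fun f hf g hg hg' => ?_
  obtain ⟨c, hc⟩ := exists_sub_smul_mem V hf.1 hg.1 fun h => hg' ⟨h, hg.2⟩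
  exact ⟨c, hc, sub_mem hf.2 (S.smul_mem c hg.2)⟩

/-- Regular functions in the `n`-th field with a pole of order less than `k` at infinity. -/
def poleLT (n k : ℕ) : Submodule F Ω := valLT V n k ⊓ Subalgebra.toSubmodule G.ring

theorem poleLT_zero (n : ℕ) : poleLT V n 0 = ⊥ := by
  rw [eq_bot_iff]
  rintro f ⟨⟨h1, h2⟩, h3⟩
  rw [pow_zero] at h2
  exact (Submodule.mem_bot F).2 (eq_zero_of_mem_ring h1 h3 V.2 h2)

instance finiteDimensional_poleLT (n k : ℕ) : FiniteDimensional F (poleLT V n k) := by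
  induction k with
  | zero => rw [poleLT_zero]; infer_instance
  | succ k ih => exact (finrank_inf_succ V (n := n) (Subalgebra.toSubmodule G.ring) k ih).1

theorem finiteDimensional_inf_of_le {S : Submodule F Ω} (hS : S ≤ Subalgebra.toSubmodule G.ring)
    (n k : ℕ) : FiniteDimensional F (valLT V n k ⊓ S : Submodule F Ω) :=
  Submodule.finiteDimensional_of_le (S₂ := poleLT V n k) (inf_le_inf_left (valLT V n k) hS)

theorem finrank_poleLT_succ (n k : ℕ) :
    Module.finrank F (poleLT V n (k + 1)) ≤ Module.finrank F (poleLT V n k) + 1 :=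
  (finrank_inf_succ V (n := n) (Subalgebra.toSubmodule G.ring) k
    (finiteDimensional_poleLT V n k)).2

theorem finrank_poleLT_add (n k m : ℕ) :
    Module.finrank F (poleLT V n (k + m)) ≤ Module.finrank F (poleLT V n k) + m := by
  induction m with
  | zero => exact le_rfl
  | succ m ih => exact (finrank_poleLT_succ V n (k + m)).trans (by omega)

/-- All but at most `g` integers occur as pole orders. -/
def HasGap (n g : ℕ) : Prop := ∀ k, k ≤ Module.finrank F (poleLT V n k) + g

theorem hasGap_of_frequently {g : ℕ}
    (h : ∀ k, ∃ m ≥ k, m ≤ Module.finrank F (poleLT V n m) + g) : HasGap V n g := by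
  intro k
  obtain ⟨m, hm, h⟩ := h k
  obtain ⟨d, rfl⟩ := Nat.exists_eq_add_of_le hm
  have := finrank_poleLT_add V n k d
  omega

end GSTower

namespace GSTower

variable {F Ω : Type*} [Field F] [Field Ω] [Algebra F Ω] {l : ℕ}

/-- The generator `x (n + 1)` with its correction subtracted. -/
def gen (G : GSTower F Ω l) (n : ℕ) : Ω := G.x (n + 1) - G.corr n

/-- The additive polynomial of the tower evaluated at the corrected generator. -/
def genT (G : GSTower F Ω l) (n : ℕ) : Ω := G.gen n ^ l + G.gen n

/-- Regular functions whose product with `genT` is regular. -/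
def regularMul (G : GSTower F Ω l) (n : ℕ) : Submodule F Ω where
  carrier := {h | h ∈ G.ring ∧ h * G.genT n ∈ G.ring}
  add_mem' hf hg := ⟨add_mem hf.1 hg.1, by rw [add_mul]; exact add_mem hf.2 hg.2⟩
  zero_mem' := ⟨zero_mem _, by rw [zero_mul]; exact zero_mem _⟩
  smul_mem' c f hf := ⟨G.ring.smul_mem hf.1 c, by
    rw [smul_mul_assoc]; exact G.ring.smul_mem hf.2 c⟩

/-- Functions whose finite poles are bounded by those of `genT ^ j`. -/
def poleBound (G : GSTower F Ω l) (n j : ℕ) : Submodule F Ω where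
  carrier := {f | ∀ W ∈ G.finPlaces, W.valuation f ≤ max 1 (W.valuation (G.genT n)) ^ j}
  add_mem' hf hg W hW := W.valuation.map_add_le (hf W hW) (hg W hW)
  zero_mem' W _ := by rw [map_zero]; exact zero_le
  smul_mem' c f hf W hW := by
    rw [Algebra.smul_def, map_mul]
    exact (mul_le_of_le_one_left' (val_algebraMap_le hW.1 c)).trans (hf W hW)

variable {G : GSTower F Ω l}

theorem uProd_mem {n k : ℕ} (hk : k ≤ n + 1) : G.uProd k ∈ G.field n :=
  prod_mem fun i hi => G.u_mem_of_le (by have := Finset.mem_range.1 hi; omega)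

theorem corr_mem (n : ℕ) : G.corr n ∈ G.field n := by
  refine sum_mem fun j hj => ?_
  simp only [Finset.mem_filter, Finset.mem_range] at hj
  exact mul_mem (pow_mem (uProd_mem (by omega)) _) (mul_mem
    (pow_mem (G.x_mem_of_le (by omega)) _) (inv_mem (G.x_mem_of_le (by omega))))

theorem genT_mem (n : ℕ) : G.genT n ∈ G.field n := by
  have e : G.genT n = G.x n ^ l / G.u n - (G.corr n ^ l + G.corr n) := by
    rw [← G.pow_add_self_succ, genT, gen, G.sub_pow]; ring
  rw [e]
  exact sub_mem (div_mem (pow_mem (G.x_mem n) _) (G.u_mem_of_le le_rfl))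
    (add_mem (pow_mem (corr_mem n) _) (corr_mem n))

theorem val_finPlaces {W : ValuationSubring Ω} (hW : W ∈ G.finPlaces) :
    W.valuation (G.x 0) ≤ 1 := (W.valuation_le_one_iff _).2 hW.2

theorem val_genT_pow_mul (n : ℕ) {W : ValuationSubring Ω} (hW : W ∈ G.finPlaces) :
    max 1 (W.valuation (G.genT n)) ^ l ^ (n - n / 2) * W.valuation (G.uProd (n / 2 + 1)) ≤ 1 := by
  rcases le_or_gt (W.valuation (G.gen n)) 1 with h | h
  · have h1 : W.valuation (G.genT n) ≤ 1 := by
      refine W.valuation.map_add_le ?_ h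
      rw [map_pow]; exact pow_le_one' h _
    rw [max_eq_left h1, one_pow, one_mul]
    exact G.val_uProd_le_one _ (val_finPlaces hW) _
  · rw [genT, val_pow_add_self_of_one_lt _ G.two_le h, max_eq_right (one_le_pow₀ h.le), ← pow_mul]
    exact G.val_sub_corr _ (val_finPlaces hW)

theorem mul_gen_pow_mem {n : ℕ} {h : Ω} (hh : h ∈ G.regularMul n) {j : ℕ} (hj : j ≤ l) :
    h * G.gen n ^ j ∈ G.ring := by
  rw [mem_ring]
  intro W hW
  have h1 := G.mem_ring.1 hh.1 W hW
  have h2 := G.mem_ring.1 hh.2 W hW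
  rcases le_or_gt (W.valuation (G.gen n)) 1 with h | h
  · rw [map_mul, map_pow]; exact mul_le_one' h1 (pow_le_one' h _)
  · rw [map_mul, genT, val_pow_add_self_of_one_lt _ G.two_le h] at h2
    rw [map_mul, map_pow]
    exact (mul_le_mul_right (pow_le_pow_right₀ h.le hj) _).trans h2

variable (V : G.infPlaces)

theorem val_eq_pow_infPlace {i n : ℕ} (h : i ≤ n) :
    V.1.valuation (G.x i) = V.1.valuation (G.x n) ^ l ^ (n - i) := by
  have := G.val_pow_of_one_lt V.1.valuation (G.one_lt_of_infPlaces V.2 i) (n - i)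
  rw [Nat.add_sub_cancel' h] at this
  exact this.symm

theorem val_uProd_infPlace {n k : ℕ} (hk : k ≤ n + 1) :
    V.1.valuation (G.uProd k) * V.1.valuation (G.x n) ^ l ^ (n + 1 - k) =
      V.1.valuation (G.x n) ^ l ^ (n + 1) := by
  have hl := G.two_le
  induction k with
  | zero => simp [uProd]
  | succ k ih =>
    rw [← ih (by omega), uProd, Finset.prod_range_succ, ← uProd, map_mul, mul_assoc,
      G.val_u_of_one_lt _ (G.one_lt_of_infPlaces V.2 k), val_eq_pow_infPlace V (show k ≤ n by omega),
      ← pow_mul, ← pow_add]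
    congr 2
    obtain ⟨m, rfl⟩ : ∃ m, l = m + 1 := ⟨l - 1, by omega⟩
    rw [show n + 1 - k = (n - k) + 1 by omega, show n + 1 - (k + 1) = n - k by omega, pow_succ,
      Nat.add_sub_cancel]
    ring

theorem val_uProd_half (n : ℕ) :
    V.1.valuation (G.uProd (n / 2 + 1)) =
      V.1.valuation (G.x n) ^ (l ^ (n - n / 2) * (l ^ (n / 2 + 1) - 1)) := by
  have hl := G.two_le
  have h := val_uProd_infPlace V (n := n) (k := n / 2 + 1) (by omega)
  have ht := zero_lt_one.trans (G.one_lt_of_infPlaces V.2 n)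
  rw [show n + 1 - (n / 2 + 1) = n - n / 2 by omega] at h
  refine mul_right_cancel₀ (pow_ne_zero (l ^ (n - n / 2)) ht.ne') ?_
  rw [h, ← pow_add]
  congr 1
  have h1 : 1 ≤ l ^ (n / 2 + 1) := Nat.one_le_pow _ _ (by omega)
  obtain ⟨m, hm⟩ := Nat.exists_eq_add_of_le h1
  rw [hm, Nat.add_sub_cancel_left]
  calc l ^ (n + 1) = l ^ (n - n / 2) * l ^ (n / 2 + 1) := by rw [← pow_add]; congr 1; omega
    _ = _ := by rw [hm]; ring

theorem mul_mem_poleLT {n R j : ℕ} (hj : j ≤ l ^ (n - n / 2)) {f : Ω}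
    (hf : f ∈ valLT V n R ⊓ G.poleBound n j) :
    G.uProd (n / 2 + 1) * f ∈ poleLT V n (R + l ^ (n - n / 2) * (l ^ (n / 2 + 1) - 1)) := by
  have ht := zero_lt_one.trans (G.one_lt_of_infPlaces V.2 n)
  refine ⟨⟨mul_mem (uProd_mem (by omega)) hf.1.1, ?_⟩, G.mem_ring.2 fun W hW => ?_⟩
  · rw [map_mul, val_uProd_half, pow_add _ R, mul_comm]
    exact mul_lt_mul_of_pos_right hf.1.2 (pow_pos ht _)
  · refine le_trans ?_ (val_genT_pow_mul n hW)
    rw [map_mul, mul_comm]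
    refine mul_le_mul_left ((hf.2 W hW).trans ?_) _
    exact pow_le_pow_right₀ (le_max_left _ _) hj

theorem finiteDimensional_poleBound {n R j : ℕ} (hj : j ≤ l ^ (n - n / 2)) :
    FiniteDimensional F (valLT V n R ⊓ G.poleBound n j : Submodule F Ω) ∧
    Module.finrank F (valLT V n R ⊓ G.poleBound n j : Submodule F Ω) ≤
      Module.finrank F (poleLT V n (R + l ^ (n - n / 2) * (l ^ (n / 2 + 1) - 1))) := by
  let f : (valLT V n R ⊓ G.poleBound n j : Submodule F Ω) →ₗ[F]
      poleLT V n (R + l ^ (n - n / 2) * (l ^ (n / 2 + 1) - 1)) :=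
    (LinearMap.mulLeft F (G.uProd (n / 2 + 1))).restrict fun x hx => mul_mem_poleLT V hj hx
  have hf : Function.Injective f := fun a b h => by
    have h1 : G.uProd (n / 2 + 1) * (a : Ω) = G.uProd (n / 2 + 1) * b := congrArg Subtype.val h
    refine Subtype.ext (mul_left_cancel₀ ?_ h1)
    exact Finset.prod_ne_zero_iff.2 fun i _ => G.u_ne_zero i
  exact ⟨Module.Finite.of_injective f hf, LinearMap.finrank_le_finrank_of_injective hf⟩

theorem regularMul_le (n : ℕ) : G.regularMul n ≤ Subalgebra.toSubmodule G.ring := fun _ h => h.1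

theorem finrank_poleBound_succ {n k R j : ℕ} (hj : j + 1 ≤ l ^ (n - n / 2))
    (hR : ∀ f ∈ poleLT V n k, f * G.genT n ^ (j + 1) ∈ valLT V n R) :
    Module.finrank F (poleLT V n k) +
      Module.finrank F (valLT V n R ⊓ G.poleBound n j : Submodule F Ω) ≤
    Module.finrank F (valLT V n R ⊓ G.poleBound n (j + 1) : Submodule F Ω) +
      Module.finrank F (valLT V n k ⊓ G.regularMul n : Submodule F Ω) := by
  have := (finiteDimensional_poleBound V (R := R) hj).1
  have := finiteDimensional_inf_of_le V (regularMul_le (G := G) n) n k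
  refine finrank_add_finrank_le_of_comap _ _ _ _ (LinearMap.mulRight F (G.genT n ^ (j + 1)))
    (inf_le_inf_left _ fun f hf W hW => (hf W hW).trans
      (pow_le_pow_right₀ (le_max_left _ _) (Nat.le_succ j)))
    (fun f hf => ⟨hR f hf, fun W hW => ?_⟩)
    (fun f hf h => ⟨hf.1, hf.2, G.mem_ring.2 fun W hW => ?_⟩)
  · rw [LinearMap.mulRight_apply, map_mul, map_pow]
    exact (mul_le_of_le_one_left' (G.mem_ring.1 hf.2 W hW)).trans
      (pow_le_pow_left' (le_max_right _ _) _)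
  · have h1 := G.mem_ring.1 hf.2 W hW
    rcases le_or_gt (W.valuation (G.genT n)) 1 with h2 | h2
    · rw [map_mul]; exact mul_le_one' h1 h2
    · have h3 := h.2 W hW
      rw [LinearMap.mulRight_apply, max_eq_right h2.le, pow_succ', ← mul_assoc, map_mul, map_pow] at h3
      have h4 : 0 < W.valuation (G.genT n) ^ j := pow_pos (zero_lt_one.trans h2) _
      exact le_of_mul_le_mul_right (h3.trans_eq (one_mul _).symm) h4

/-- The ideal of multipliers making `genT` regular has small colength. -/
theorem finrank_poleLT_le_regularMul (n k : ℕ) :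
    Module.finrank F (poleLT V n k) ≤
      Module.finrank F (valLT V n k ⊓ G.regularMul n : Submodule F Ω) + (l ^ (n / 2 + 1) - 1) := by
  have hl := G.two_le
  set Q := l ^ (n - n / 2) with hQ
  have hQ0 : 0 < Q := Nat.pow_pos (by omega)
  obtain ⟨e, he⟩ := exists_mem_valLT V (genT_mem (G := G) n)
  have ht := G.one_lt_of_infPlaces V.2 n
  set R := k + e * Q with hRdef
  have hR : ∀ j, j ≤ Q → ∀ f ∈ poleLT V n k, f * G.genT n ^ j ∈ valLT V n R := by
    intro j hj f hf
    refine ⟨mul_mem hf.1.1 (pow_mem he.1 _), ?_⟩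
    have h1 : V.1.valuation (G.genT n) ^ j ≤ V.1.valuation (G.x n) ^ (e * Q) := by
      refine (pow_le_pow_left' he.2.le j).trans ?_
      rw [← pow_mul]
      exact pow_le_pow_right₀ ht.le (Nat.mul_le_mul_left e hj)
    rw [map_mul, map_pow, hRdef, pow_add]
    exact (mul_le_mul_right h1 _).trans_lt
      (mul_lt_mul_of_pos_right hf.1.2 (pow_pos (zero_lt_one.trans ht) _))
  have main : ∀ j, j ≤ Q → j * Module.finrank F (poleLT V n k) + Module.finrank F (poleLT V n R) ≤
      Module.finrank F (valLT V n R ⊓ G.poleBound n j : Submodule F Ω) +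
        j * Module.finrank F (valLT V n k ⊓ G.regularMul n : Submodule F Ω) := by
    intro j hj
    induction j with
    | zero =>
      have h0 : Subalgebra.toSubmodule G.ring = G.poleBound n 0 := by
        ext f
        change f ∈ G.ring ↔ ∀ W ∈ G.finPlaces, _
        simp only [mem_ring, pow_zero]
      simp only [zero_mul, zero_add, add_zero]
      rw [poleLT, h0]
    | succ j ih =>
      have h1 := ih (by omega)
      have h2 := finrank_poleBound_succ V (n := n) (k := k) (R := R) hj (hR (j + 1) hj)
      rw [add_mul, add_mul]
      omega
  have h1 := main Q le_rfl
  have h2 := (finiteDimensional_poleBound V (n := n) (R := R) (j := Q) le_rfl).2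
  have h3 := finrank_poleLT_add V n R (Q * (l ^ (n / 2 + 1) - 1))
  have h4 : Q * Module.finrank F (poleLT V n k) ≤
      Q * (Module.finrank F (valLT V n k ⊓ G.regularMul n : Submodule F Ω) +
        (l ^ (n / 2 + 1) - 1)) := by
    rw [mul_add]
    rw [← hQ] at h2
    omega
  exact Nat.le_of_mul_le_mul_left h4 hQ0

end GSTower

theorem exists_forall_succ_eq {a : ℕ → ℕ} {C : ℕ} (h1 : ∀ k, a (k + 1) ≤ a k + 1)
    (h2 : ∀ k, k ≤ a k + C) : ∃ k₀, ∀ k ≥ k₀, a (k + 1) = a k + 1 := by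
  let c : ℕ → ℕ := fun k => a k + C - k
  have hc : Antitone c := antitone_nat_of_succ_le fun k => by
    have := h1 k; have := h2 k; simp only [c]; omega
  refine ⟨Function.argmin c, fun k hk => ?_⟩
  have h3 : c (Function.argmin c) ≤ c (k + 1) := Function.argmin_le c (k + 1)
  have h4 : c k ≤ c (Function.argmin c) := hc hk
  have h5 : c (k + 1) ≤ c k := hc (Nat.le_succ k)
  have := h1 k
  have := h2 k
  have := h2 (k + 1)
  have h6 : c (k + 1) = c k := by omega
  simp only [c] at h6
  omega

namespace GSTower

variable {F Ω : Type*} [Field F] [Field Ω] [Algebra F Ω] {l : ℕ} {G : GSTower F Ω l}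
variable (V : G.infPlaces) {n : ℕ}

theorem exists_regularMul_eventually {g : ℕ} (hg : HasGap V n g) :
    ∃ k₀, ∀ k ≥ k₀, ∃ h ∈ G.regularMul n, h ∈ valLT V n (k + 1) ∧ h ∉ valLT V n k := by
  obtain ⟨k₀, hk₀⟩ := exists_forall_succ_eq
    (a := fun k => Module.finrank F (valLT V n k ⊓ G.regularMul n : Submodule F Ω))
    (C := (l ^ (n / 2 + 1) - 1) + g)
    (fun k => (finrank_inf_succ V _ k
      (finiteDimensional_inf_of_le V (regularMul_le (G := G) n) n k)).2)
    (fun k => by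
      have := finrank_poleLT_le_regularMul V n k
      have := hg k
      omega)
  refine ⟨k₀, fun k hk => ?_⟩
  by_contra! h
  have h1 : Module.finrank F (valLT V n (k + 1) ⊓ G.regularMul n : Submodule F Ω) ≤
      Module.finrank F (valLT V n k ⊓ G.regularMul n : Submodule F Ω) := by
    have := finiteDimensional_inf_of_le V (regularMul_le (G := G) n) n k
    exact Submodule.finrank_mono fun f hf => ⟨h f hf.2 hf.1, hf.2⟩
  have h2 := hk₀ k hk
  omega

/-- Every element of the `n`-th field is congruent to a multiplier of `genT`. -/
def IsApprox (n B : ℕ) : Prop :=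
  ∀ f ∈ G.field n, ∃ h ∈ G.regularMul n, h ∈ G.field n ∧ f - h ∈ valLT V n B

theorem exists_isApprox {g : ℕ} (hg : HasGap V n g) : ∃ k₀, ∀ B ≥ k₀, IsApprox V n B := by
  obtain ⟨k₀, hk₀⟩ := exists_regularMul_eventually V hg
  refine ⟨k₀, fun B hB f hf => ?_⟩
  obtain ⟨m, hm⟩ := exists_mem_valLT V hf
  clear hf
  induction m generalizing f with
  | zero => exact ⟨0, zero_mem _, zero_mem _, by
      rw [sub_zero]; exact valLT_mono V (Nat.zero_le _) hm⟩
  | succ m ih =>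
    rcases le_or_gt (m + 1) B with h | h
    · exact ⟨0, zero_mem _, zero_mem _, by rw [sub_zero]; exact valLT_mono V h hm⟩
    · obtain ⟨h₀, h1, h2, h3⟩ := hk₀ m (by omega)
      obtain ⟨c, hc⟩ := exists_sub_smul_mem V hm h2 h3
      obtain ⟨h', h4, h5, h6⟩ := ih _ hc
      refine ⟨c • h₀ + h', add_mem (Submodule.smul_mem _ _ h1) h4,
        add_mem ((G.field n).smul_mem h2.1) h5, ?_⟩
      rwa [← sub_sub]

open Polynomial

theorem exists_polynomial_approx {B : ℕ} (hB : IsApprox V n B) (j : ℕ) (hj : j ≤ l)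
    (Q : (G.field n)[X]) (hQ : ∀ m ≥ j, Q.coeff m = 0) :
    ∃ P : (G.field n)[X], (∀ m ≥ j, P.coeff m = 0) ∧ aeval (G.x (n + 1)) P ∈ G.ring ∧
      ∀ i, (((Q - P).coeff i : G.field n) : Ω) ∈ valLT V n B := by
  induction j generalizing Q with
  | zero =>
    refine ⟨0, fun _ _ => coeff_zero _, by rw [map_zero]; exact zero_mem _, fun i => ?_⟩
    rw [sub_zero, hQ i (Nat.zero_le i)]
    exact zero_mem _
  | succ j ih =>
    obtain ⟨h, h1, h2, h3⟩ := hB (Q.coeff j : G.field n) (SetLike.coe_mem _)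
    let w : G.field n := ⟨G.corr n, corr_mem n⟩
    let h' : G.field n := ⟨h, h2⟩
    let P₀ : (G.field n)[X] := C h' * (X - C w) ^ j
    have hmon : ((X - C w) ^ j : (G.field n)[X]).Monic := (monic_X_sub_C w).pow j
    have hdeg : ((X - C w) ^ j : (G.field n)[X]).natDegree = j := by
      rw [natDegree_pow, natDegree_X_sub_C, mul_one]
    have hP₀j : P₀.coeff j = h' := by
      have := hmon.coeff_natDegree
      rw [hdeg] at this
      rw [coeff_C_mul, this, mul_one]
    have hP₀ : ∀ m > j, P₀.coeff m = 0 := fun m hm => by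
      rw [coeff_C_mul, coeff_eq_zero_of_natDegree_lt (by omega), mul_zero]
    obtain ⟨P', hP', hr, ha⟩ := ih (by omega) (Q - P₀ - C (Q.coeff j - h') * X ^ j) fun m hm => by
      rw [coeff_sub, coeff_sub, coeff_C_mul_X_pow]
      rcases hm.eq_or_lt with rfl | hm
      · rw [if_pos rfl, hP₀j, sub_self]
      · rw [if_neg hm.ne', hQ m hm, hP₀ m hm]; simp
    refine ⟨P' + P₀, fun m hm => ?_, ?_, fun i => ?_⟩
    · rw [coeff_add, hP' m (by omega), hP₀ m (by omega), add_zero]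
    · rw [map_add]
      refine add_mem hr ?_
      have : aeval (G.x (n + 1)) P₀ = h * G.gen n ^ j := by
        simp only [P₀, map_mul, map_pow, map_sub, aeval_X, aeval_C]; rfl
      rw [this]
      exact mul_gen_pow_mem h1 (by omega)
    · have e : Q - (P' + P₀) = (Q - P₀ - C (Q.coeff j - h') * X ^ j - P') +
          C (Q.coeff j - h') * X ^ j := by ring
      rw [e, coeff_add]
      refine (valLT V n B).add_mem (ha i) ?_
      rw [coeff_C_mul_X_pow]
      split_ifs
      · exact h3
      · exact zero_mem _

/-- Polynomials of degree below `j` with bounded coefficients and regular value at `x (n + 1)`. -/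
def polyLT (n B j : ℕ) : Submodule F (G.field n)[X] where
  carrier := {P | (∀ m ≥ j, P.coeff m = 0) ∧ (∀ i, ((P.coeff i : G.field n) : Ω) ∈ valLT V n B) ∧
    aeval (G.x (n + 1)) P ∈ G.ring}
  add_mem' hP hQ := ⟨fun m hm => by rw [coeff_add, hP.1 m hm, hQ.1 m hm, add_zero],
    fun i => by rw [coeff_add]; exact (valLT V n B).add_mem (hP.2.1 i) (hQ.2.1 i),
    by rw [map_add]; exact add_mem hP.2.2 hQ.2.2⟩
  zero_mem' := ⟨fun _ _ => coeff_zero _, fun i => by rw [coeff_zero]; exact zero_mem (valLT V n B),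
    by rw [map_zero]; exact zero_mem _⟩
  smul_mem' c P hP := ⟨fun m hm => by rw [coeff_smul, hP.1 m hm, smul_zero],
    fun i => by rw [coeff_smul]; exact (valLT V n B).smul_mem c (hP.2.1 i),
    by
      have : aeval (G.x (n + 1)) (c • P) = c • aeval (G.x (n + 1)) P :=
        map_smul ((aeval (G.x (n + 1)) : (G.field n)[X] →ₐ[G.field n] Ω).restrictScalars F) c P
      rw [this]; exact G.ring.smul_mem hP.2.2 c⟩

theorem aeval_eq_sum {P : (G.field n)[X]} (hP : ∀ m ≥ l, P.coeff m = 0) :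
    aeval (G.x (n + 1)) P = ∑ i ∈ Finset.range l, (P.coeff i : Ω) * G.x (n + 1) ^ i := by
  have hl := G.two_le
  rw [aeval_eq_sum_range' (n := l)]
  · rfl
  · have : P.natDegree ≤ l - 1 := natDegree_le_iff_coeff_eq_zero.2 fun N hN => hP N (by omega)
    omega

theorem val_coeff_mul_lt {B i : ℕ} (hi : i < l) {c : Ω} (hc : c ∈ valLT V n B) :
    V.1.valuation (c * G.x (n + 1) ^ i) < V.1.valuation (G.x (n + 1)) ^ (l * B) := by
  have hs := G.one_lt_of_infPlaces V.2 (n + 1)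
  rcases eq_or_ne c 0 with rfl | h0
  · rw [zero_mul, map_zero]; exact pow_pos (zero_lt_one.trans hs) _
  obtain ⟨m, hm⟩ := exists_val_eq_zpow V hc.1 h0
  have ht := G.one_lt_of_infPlaces V.2 n
  have h1 := hc.2
  rw [hm, ← zpow_natCast, zpow_lt_zpow_iff_right₀ ht] at h1
  rw [map_mul, hm, map_pow, ← (G.val_succ_of_one_lt _ ht).2, ← zpow_natCast, ← zpow_natCast,
    ← zpow_natCast, ← zpow_mul, ← zpow_add₀ (zero_lt_one.trans hs).ne']
  refine zpow_lt_zpow_right₀ hs ?_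
  push_cast
  have h2 : (l : ℤ) * (m + 1) ≤ l * B := by gcongr; omega
  have h3 : (i : ℤ) < l := by exact_mod_cast hi
  linarith

theorem polyLT_finrank (n B : ℕ) : FiniteDimensional F (polyLT V n B l) ∧
    Module.finrank F (polyLT V n B l) ≤ Module.finrank F (poleLT V (n + 1) (l * B)) := by
  let φ := ((aeval (G.x (n + 1)) : (G.field n)[X] →ₐ[G.field n] Ω).restrictScalars F).toLinearMap
  have hφ : ∀ P, φ P = aeval (G.x (n + 1)) P := fun P => rfl
  have hmem : ∀ P ∈ polyLT V n B l, φ P ∈ poleLT V (n + 1) (l * B) := by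
    intro P hP
    refine ⟨⟨?_, ?_⟩, hP.2.2⟩
    · rw [hφ, aeval_eq_sum hP.1]
      exact sum_mem fun i _ => mul_mem (G.field_le_succ n (hP.2.1 i).1) (pow_mem (G.x_mem _) _)
    · rw [hφ, aeval_eq_sum hP.1]
      refine V.1.valuation.map_sum_lt ?_ fun i hi => ?_
      · exact pow_ne_zero _ (zero_lt_one.trans (G.one_lt_of_infPlaces V.2 (n + 1))).ne'
      · exact val_coeff_mul_lt V (Finset.mem_range.1 hi) (hP.2.1 i)
  let f : polyLT V n B l →ₗ[F] poleLT V (n + 1) (l * B) := φ.restrict hmem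
  have hf : Function.Injective f := by
    refine (injective_iff_map_eq_zero f).2 fun P hP => ?_
    have h1 : aeval (G.x (n + 1)) (P : (G.field n)[X]) = 0 := congrArg Subtype.val hP
    rw [aeval_eq_sum P.2.1] at h1
    have h2 := coeff_eq_zero (fun i => SetLike.coe_mem _) h1
    refine Subtype.ext (Polynomial.ext fun i => ?_)
    rcases lt_or_ge i l with hi | hi
    · exact Subtype.ext (h2 i hi)
    · exact P.2.1 i hi
  exact ⟨Module.Finite.of_injective f hf, LinearMap.finrank_le_finrank_of_injective hf⟩

theorem polyLT_mono {B j j' : ℕ} (h : j ≤ j') : polyLT V n B j ≤ polyLT V n B j' :=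
  fun _ hP => ⟨fun m hm => hP.1 m (h.trans hm), hP.2⟩

theorem finiteDimensional_polyLT {B j : ℕ} (h : j ≤ l) : FiniteDimensional F (polyLT V n B j) :=
  have := (polyLT_finrank V n B).1
  Submodule.finiteDimensional_of_le (polyLT_mono V h)

/-- The coefficient functional as a linear map to the ambient field. -/
noncomputable def coeffLinear (G : GSTower F Ω l) (n j : ℕ) : (G.field n)[X] →ₗ[F] Ω :=
  (G.field n).val.toLinearMap ∘ₗ ((lcoeff (G.field n) j).restrictScalars F)

theorem finrank_polyLT_one (n B : ℕ) :
    Module.finrank F (poleLT V n B) ≤ Module.finrank F (polyLT V n B 1) := by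
  have hl := G.two_le
  have := finiteDimensional_polyLT V (n := n) (B := B) (j := 1) (by omega)
  have h := finrank_add_finrank_le_of_section ⊥ (polyLT V n B 1) (poleLT V n B)
    (G.coeffLinear n 0) bot_le (fun s hs => by rw [(Submodule.mem_bot F).1 hs, map_zero])
    fun u hu => ⟨C ⟨u, hu.1.1⟩, ⟨fun m hm => coeff_C_of_ne_zero (by omega), fun i => ?_, ?_⟩, ?_⟩
  · simpa using h
  · rw [coeff_C]
    split_ifs
    · exact hu.1
    · exact zero_mem (valLT V n B)
  · rw [aeval_C]; exact hu.2
  · change ((coeff (C (⟨u, hu.1.1⟩ : G.field n)) 0 : G.field n) : Ω) = u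
    rw [coeff_C_zero]

theorem finrank_polyLT_succ {B j : ℕ} (hB : IsApprox V n B) (hj : j < l) :
    Module.finrank F (valLT V n B ⊓ G.regularMul n : Submodule F Ω) +
      Module.finrank F (polyLT V n B j) ≤ Module.finrank F (polyLT V n B (j + 1)) := by
  have := finiteDimensional_polyLT V (n := n) (B := B) (j := j + 1) hj
  refine finrank_add_finrank_le_of_section (polyLT V n B j) (polyLT V n B (j + 1)) _
    (G.coeffLinear n j) (polyLT_mono V (Nat.le_succ j)) (fun P hP => ?_) fun u hu => ?_
  · change ((P.coeff j : G.field n) : Ω) = 0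
    rw [hP.1 j le_rfl]; rfl
  · let w : G.field n := ⟨G.corr n, corr_mem n⟩
    let u' : G.field n := ⟨u, hu.1.1⟩
    let P₀ : (G.field n)[X] := C u' * (X - C w) ^ j
    have hmon : ((X - C w) ^ j : (G.field n)[X]).Monic := (monic_X_sub_C w).pow j
    have hdeg : ((X - C w) ^ j : (G.field n)[X]).natDegree = j := by
      rw [natDegree_pow, natDegree_X_sub_C, mul_one]
    have hP₀j : P₀.coeff j = u' := by
      have := hmon.coeff_natDegree
      rw [hdeg] at this
      rw [coeff_C_mul, this, mul_one]
    have hP₀ : ∀ m > j, P₀.coeff m = 0 := fun m hm => by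
      rw [coeff_C_mul, coeff_eq_zero_of_natDegree_lt (by omega), mul_zero]
    obtain ⟨P, hP, hr, ha⟩ := exists_polynomial_approx V hB j hj.le (P₀ - C u' * X ^ j) fun m hm => by
      rw [coeff_sub, coeff_C_mul_X_pow]
      rcases hm.eq_or_lt with rfl | hm
      · rw [if_pos rfl, hP₀j, sub_self]
      · rw [if_neg hm.ne', hP₀ m hm, sub_zero]
    have hcj : (P₀ - P).coeff j = u' := by rw [coeff_sub, hP j le_rfl, hP₀j, sub_zero]
    refine ⟨P₀ - P, ⟨fun m hm => ?_, fun i => ?_, ?_⟩, ?_⟩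
    · rw [coeff_sub, hP₀ m (by omega), hP m (by omega), sub_zero]
    · rw [show P₀ - P = (P₀ - C u' * X ^ j - P) + C u' * X ^ j by ring, coeff_add]
      refine (valLT V n B).add_mem (ha i) ?_
      rw [coeff_C_mul_X_pow]
      split_ifs
      · exact hu.1
      · exact zero_mem _
    · rw [map_sub]
      refine sub_mem ?_ hr
      have : aeval (G.x (n + 1)) P₀ = u * G.gen n ^ j := by
        simp only [P₀, map_mul, map_pow, map_sub, aeval_X, aeval_C]; rfl
      rw [this]
      exact mul_gen_pow_mem hu.2 hj.le
    · change (((P₀ - P).coeff j : G.field n) : Ω) = u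
      rw [hcj]

theorem HasGap.succ {g : ℕ} (hg : HasGap V n g) :
    HasGap V (n + 1) (l * g + (l - 1) * (l ^ (n / 2 + 1) - 1)) := by
  have hl := G.two_le
  obtain ⟨k₀, hk₀⟩ := exists_isApprox V hg
  refine hasGap_of_frequently V fun k => ⟨l * max k k₀, ?_, ?_⟩
  · exact (le_max_left k k₀).trans (Nat.le_mul_of_pos_left _ (by omega))
  · set B := max k k₀
    have h1 := hg B
    have h2 := finrank_poleLT_le_regularMul V n B
    set a := Module.finrank F (valLT V n B ⊓ G.regularMul n : Submodule F Ω)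
    have h3 : ∀ j, j + 1 ≤ l → Module.finrank F (poleLT V n B) + j * a ≤
        Module.finrank F (polyLT V n B (j + 1)) := by
      intro j hj
      induction j with
      | zero => simpa using finrank_polyLT_one V n B
      | succ j ih =>
        have h4 := finrank_polyLT_succ V (hk₀ B (le_max_right _ _)) (j := j + 1) (by omega)
        have h5 := ih (by omega)
        rw [add_mul]
        omega
    have h4 := h3 (l - 1) (by omega)
    rw [Nat.sub_add_cancel (by omega)] at h4
    have h5 := (polyLT_finrank V n B).2
    set r := l ^ (n / 2 + 1) - 1
    obtain ⟨m, hm⟩ : ∃ m, l = m + 1 := ⟨l - 1, by omega⟩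
    have h6 : l * B ≤ Module.finrank F (poleLT V n B) + (l - 1) * a + (l * g + (l - 1) * r) := by
      have h7 : m * B ≤ m * (a + r + g) := Nat.mul_le_mul_left m (by omega)
      simp only [hm, Nat.add_sub_cancel]
      nlinarith
    omega

theorem hasGap_zero : HasGap V 0 0 := by
  intro k
  induction k with
  | zero => exact Nat.zero_le _
  | succ k ih =>
    have hx := G.one_lt_of_infPlaces V.2 0
    have h1 : G.x 0 ^ k ∈ poleLT V 0 (k + 1) :=
      ⟨⟨pow_mem (G.x_mem 0) k, by rw [map_pow]; exact pow_lt_pow_right₀ hx (Nat.lt_succ_self k)⟩,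
        G.ring.pow_mem (fun W hW => hW.2) k⟩
    have h2 : G.x 0 ^ k ∉ poleLT V 0 k := fun h => by
      have := h.1.2
      rw [map_pow] at this
      exact this.false
    have h3 : poleLT V 0 k < poleLT V 0 (k + 1) :=
      SetLike.lt_iff_le_and_exists.2 ⟨fun f hf => ⟨valLT_mono V (Nat.le_succ k) hf.1, hf.2⟩,
        _, h1, h2⟩
    have := Submodule.finrank_lt_finrank_of_lt h3
    omega

theorem exists_hasGap (n : ℕ) : ∃ g, HasGap V n g ∧
    g + l ^ ((n + 2) / 2) + l ^ ((n + 1) / 2) ≤ l ^ (n + 1) + 1 := by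
  have hl := G.two_le
  induction n with
  | zero => exact ⟨0, hasGap_zero V, by simp⟩
  | succ n ih =>
    obtain ⟨g, hg, h⟩ := ih
    refine ⟨_, hg.succ, ?_⟩
    rw [show (n + 1 + 2) / 2 = (n + 1) / 2 + 1 by omega, show (n + 1 + 1) / 2 = n / 2 + 1 by omega]
    rw [show (n + 2) / 2 = n / 2 + 1 by omega] at h
    obtain ⟨r, hr⟩ : ∃ r, l ^ (n / 2 + 1) = r + 1 :=
      ⟨l ^ (n / 2 + 1) - 1, by have : 0 < l ^ (n / 2 + 1) := by positivity
                               omega⟩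
    obtain ⟨m, rfl⟩ : ∃ m, l = m + 1 := ⟨l - 1, by omega⟩
    rw [hr] at h ⊢
    simp only [Nat.add_sub_cancel]
    rw [pow_succ _ (n + 1), pow_succ _ ((n + 1) / 2)]
    nlinarith

theorem hasGap (n : ℕ) : HasGap V n (l ^ (n + 1)) := by
  obtain ⟨g, hg, h⟩ := exists_hasGap V n
  have h1 : 0 < l ^ ((n + 2) / 2) := pow_pos (by have := G.two_le; omega) _
  exact fun k => (hg k).trans (by omega)

end GSTower

theorem add_le_of_reflection {a b : ℕ → ℕ} (ha0 : a 0 = 0) (hb0 : b 0 = 0)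
    (ha1 : ∀ k, a (k + 1) ≤ a k + 1) (hb1 : ∀ k, b (k + 1) ≤ b k + 1)
    (hb : ∀ k, b k ≤ b (k + 1)) {s : ℕ}
    (h : ∀ i j, i + j = s → a (i + 1) ≤ a i ∨ b (j + 1) ≤ b j) : a (s + 1) + b (s + 1) ≤ s + 1 := by
  have key : ∀ k ≤ s + 1, a k + b (s + 1) ≤ k + b (s + 1 - k) := by
    intro k hk
    induction k with
    | zero => simp [ha0]
    | succ k ih =>
      have h1 := ih (by omega)
      have h2 := h k (s - k) (by omega)
      have h3 := ha1 k
      have h4 := hb1 (s - k)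
      have h5 := hb (s - k)
      rw [show s - k + 1 = s + 1 - k by omega] at h2 h4 h5
      rw [show s + 1 - (k + 1) = s - k by omega]
      omega
  have := key (s + 1) le_rfl
  rw [Nat.sub_self, hb0] at this
  omega

/-- A filtration of an algebra by the pole order at a place of degree one. -/
structure PoleFiltration (F O : Type*) [Field F] [CommRing O] [Algebra F O] where
  /-- The elements of pole order below `k`. -/
  L : ℕ → Submodule F O
  zero : L 0 = ⊥
  mono : Monotone L
  exists_mem : ∀ f, ∃ k, f ∈ L k
  exists_sub_smul_mem : ∀ {k f h}, f ∈ L (k + 1) → h ∈ L (k + 1) → h ∉ L k →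
    ∃ c : F, f - c • h ∈ L k
  mul_mem : ∀ {i j f h}, f ∈ L (i + 1) → h ∈ L (j + 1) → f * h ∈ L (i + j + 1)
  mul_notMem : ∀ {i j f h}, f ∈ L (i + 1) → h ∈ L (j + 1) → f ∉ L i → h ∉ L j → f * h ∉ L (i + j)

namespace PoleFiltration

open Module

variable {F O : Type*} [Field F] [CommRing O] [Algebra F O] (𝓛 : PoleFiltration F O)

theorem finrank_inf_succ (S : Submodule F O) (k : ℕ) [FiniteDimensional F (𝓛.L k ⊓ S : Submodule F O)] :
    FiniteDimensional F (𝓛.L (k + 1) ⊓ S : Submodule F O) ∧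
      finrank F (𝓛.L (k + 1) ⊓ S : Submodule F O) ≤ finrank F (𝓛.L k ⊓ S : Submodule F O) + 1 := by
  refine finiteDimensional_and_finrank_le_succ
    (inf_le_inf_right _ (𝓛.mono (Nat.le_succ k))) fun f hf h hh hh' => ?_
  obtain ⟨c, hc⟩ := 𝓛.exists_sub_smul_mem hf.1 hh.1 fun h' => hh' ⟨h', hh.2⟩
  exact ⟨c, hc, S.sub_mem hf.2 (S.smul_mem c hh.2)⟩

instance finiteDimensional_inf (S : Submodule F O) (k : ℕ) :
    FiniteDimensional F (𝓛.L k ⊓ S : Submodule F O) := by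
  induction k with
  | zero => rw [𝓛.zero, bot_inf_eq]; infer_instance
  | succ k ih => exact (𝓛.finrank_inf_succ S k).1

/-- The dimension of the part of a subspace of pole order below `k`. -/
noncomputable def dim (S : Submodule F O) (k : ℕ) : ℕ := finrank F (𝓛.L k ⊓ S : Submodule F O)

theorem dim_zero (S : Submodule F O) : 𝓛.dim S 0 = 0 := by
  rw [dim, 𝓛.zero, bot_inf_eq, finrank_bot]

theorem dim_succ_le (S : Submodule F O) (k : ℕ) : 𝓛.dim S (k + 1) ≤ 𝓛.dim S k + 1 :=
  (𝓛.finrank_inf_succ S k).2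

theorem dim_le_succ (S : Submodule F O) (k : ℕ) : 𝓛.dim S k ≤ 𝓛.dim S (k + 1) :=
  Submodule.finrank_mono (inf_le_inf_right _ (𝓛.mono (Nat.le_succ k)))

theorem dim_add_le (S : Submodule F O) (k m : ℕ) : 𝓛.dim S (k + m) ≤ 𝓛.dim S k + m := by
  induction m with
  | zero => exact le_rfl
  | succ m ih => exact (𝓛.dim_succ_le S (k + m)).trans (by omega)

theorem dim_mono {S T : Submodule F O} (h : S ≤ T) (k : ℕ) : 𝓛.dim S k ≤ 𝓛.dim T k :=
  Submodule.finrank_mono (inf_le_inf_left _ h)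

theorem exists_notMem_of_dim_lt {S : Submodule F O} {k : ℕ} (h : 𝓛.dim S k < 𝓛.dim S (k + 1)) :
    ∃ f ∈ S, f ∈ 𝓛.L (k + 1) ∧ f ∉ 𝓛.L k := by
  by_contra! h'
  exact h.not_ge (Submodule.finrank_mono fun f hf => ⟨h' f hf.2 hf.1, hf.2⟩)

theorem dim_lt_of_notMem {S : Submodule F O} {k : ℕ} {f : O} (hS : f ∈ S) (hf : f ∈ 𝓛.L (k + 1))
    (hf' : f ∉ 𝓛.L k) : 𝓛.dim S k < 𝓛.dim S (k + 1) := by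
  have h : (𝓛.L k ⊓ S : Submodule F O) < 𝓛.L (k + 1) ⊓ S :=
    lt_of_le_not_ge (inf_le_inf_right _ (𝓛.mono (Nat.le_succ k))) fun h => hf' (h ⟨hf, hS⟩).1
  exact Submodule.finrank_lt_finrank_of_lt h

theorem dim_add_dim_le {S : Submodule F O} (hS : ∀ f ∈ S, ∀ h, f * h ∈ S) {s : ℕ}
    (hs : 𝓛.dim S (s + 1) ≤ 𝓛.dim S s) : 𝓛.dim S (s + 1) + 𝓛.dim ⊤ (s + 1) ≤ s + 1 := by
  refine add_le_of_reflection (𝓛.dim_zero S) (𝓛.dim_zero ⊤) (𝓛.dim_succ_le S) (𝓛.dim_succ_le ⊤)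
    (𝓛.dim_le_succ ⊤) fun i j hij => ?_
  by_contra! h
  obtain ⟨f, h1, h2, h3⟩ := 𝓛.exists_notMem_of_dim_lt h.1
  obtain ⟨f', -, h5, h6⟩ := 𝓛.exists_notMem_of_dim_lt h.2
  refine hs.not_gt (𝓛.dim_lt_of_notMem (hS f h1 f') ?_ ?_)
  · rw [← hij]; exact 𝓛.mul_mem h2 h5
  · rw [← hij]; exact 𝓛.mul_notMem h2 h5 h3 h6

variable {ι : Type*} (φ : ι → O →ₐ[F] PowerSeries F)

/-- The elements vanishing to order at least `e i` at the `i`-th point. -/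
def vanishing (e : ι → ℕ) : Submodule F O where
  carrier := {f | ∀ i, PowerSeries.X ^ e i ∣ φ i f}
  add_mem' hf hg i := by rw [map_add]; exact dvd_add (hf i) (hg i)
  zero_mem' i := by rw [map_zero]; exact dvd_zero _
  smul_mem' c f hf i := by rw [map_smul, PowerSeries.smul_eq_C_mul]; exact (hf i).mul_left _

variable {φ}

theorem vanishing_zero : vanishing φ 0 = ⊤ :=
  eq_top_iff.2 fun f _ i => by rw [Pi.zero_apply, pow_zero]; exact one_dvd _

theorem mul_mem_vanishing {e : ι → ℕ} {f : O} (hf : f ∈ vanishing φ e) (h : O) :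
    f * h ∈ vanishing φ e := fun i => by rw [map_mul]; exact (hf i).mul_right _

theorem X_pow_succ_dvd {f : PowerSeries F} {k : ℕ} (hf : PowerSeries.X ^ k ∣ f)
    (h : PowerSeries.coeff k f = 0) : PowerSeries.X ^ (k + 1) ∣ f := by
  rw [PowerSeries.X_pow_dvd_iff] at hf ⊢
  intro m hm
  rcases Nat.lt_succ_iff_lt_or_eq.1 hm with h' | rfl
  · exact hf m h'
  · exact h

theorem coeff_add_mul {f g : PowerSeries F} {j k : ℕ} (hf : PowerSeries.X ^ j ∣ f)
    (hg : PowerSeries.X ^ k ∣ g) :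
    PowerSeries.coeff (j + k) (f * g) = PowerSeries.coeff j f * PowerSeries.coeff k g := by
  obtain ⟨u, rfl⟩ := hf
  obtain ⟨v, rfl⟩ := hg
  rw [show PowerSeries.X ^ j * u * (PowerSeries.X ^ k * v) = PowerSeries.X ^ (j + k) * (u * v) by ring]
  simp [PowerSeries.coeff_X_pow_mul']

section Single

variable [DecidableEq ι]

theorem vanishing_add_single_le (e : ι → ℕ) (i : ι) :
    vanishing φ (e + Pi.single i 1) ≤ vanishing φ e := fun _ hf j =>
  (pow_dvd_pow _ (by simp)).trans (hf j)

theorem mem_vanishing_add_single {e : ι → ℕ} {i : ι} {f : O} (hf : f ∈ vanishing φ e)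
    (h : PowerSeries.coeff (e i) (φ i f) = 0) : f ∈ vanishing φ (e + Pi.single i 1) := fun j => by
  rcases eq_or_ne j i with rfl | hj
  · rw [Pi.add_apply, Pi.single_eq_same]; exact X_pow_succ_dvd (hf j) h
  · rw [Pi.add_apply, Pi.single_eq_of_ne hj]; exact hf j

theorem dim_vanishing_le (e : ι → ℕ) (i : ι) (k : ℕ) :
    𝓛.dim (vanishing φ e) k ≤ 𝓛.dim (vanishing φ (e + Pi.single i 1)) k + 1 := by
  refine (finiteDimensional_and_finrank_le_succ
    (inf_le_inf_left _ (vanishing_add_single_le e i)) fun f hf h hh hh' => ?_).2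
  have h0 : PowerSeries.coeff (e i) (φ i h) ≠ 0 := fun h0 =>
    hh' ⟨hh.1, mem_vanishing_add_single hh.2 h0⟩
  refine ⟨PowerSeries.coeff (e i) (φ i f) / PowerSeries.coeff (e i) (φ i h),
    sub_mem hf.1 (Submodule.smul_mem _ _ hh.1), mem_vanishing_add_single
      (sub_mem hf.2 (Submodule.smul_mem _ _ hh.2)) ?_⟩
  rw [map_sub, map_smul, map_sub, map_smul, smul_eq_mul, div_mul_cancel₀ _ h0, sub_self]

end Single

/-- The elements of pole order below `m` vanishing to order exactly `e i` at the `i`-th point. -/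
def exact (φ : ι → O →ₐ[F] PowerSeries F) (e : ι → ℕ) (m : ℕ) : Set O :=
  {f | f ∈ 𝓛.L m ∧ f ∈ vanishing φ e ∧ ∀ i, PowerSeries.coeff (e i) (φ i f) ≠ 0}

theorem mul_mem_exact {e e' : ι → ℕ} {m : ℕ} {f h : O} (hf : f ∈ 𝓛.exact φ e m)
    (hh : h ∈ 𝓛.exact φ e' m) : f * h ∈ 𝓛.exact φ (e + e') (2 * m) := by
  refine ⟨?_, fun i => ?_, fun i => ?_⟩
  · rcases m with - | m
    · have := hf.1
      rw [𝓛.zero, Submodule.mem_bot] at this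
      rw [this, zero_mul]; exact zero_mem _
    · exact 𝓛.mono (by omega) (𝓛.mul_mem hf.1 hh.1)
  · rw [map_mul, Pi.add_apply, pow_add]
    exact mul_dvd_mul (hf.2.1 i) (hh.2.1 i)
  · rw [map_mul, Pi.add_apply, coeff_add_mul (hf.2.1 i) (hh.2.1 i)]
    exact mul_ne_zero (hf.2.2 i) (hh.2.2 i)

theorem eq_of_mem_exact {e e' : ι → ℕ} {m : ℕ} {f : O} (hf : f ∈ 𝓛.exact φ e m)
    (hf' : f ∈ 𝓛.exact φ e' m) : e = e' := by
  have key : ∀ {e e' : ι → ℕ}, f ∈ 𝓛.exact φ e m → f ∈ 𝓛.exact φ e' m → ∀ i, e i ≤ e' i := by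
    intro e e' hf hf' i
    by_contra! h
    exact hf'.2.2 i (PowerSeries.X_pow_dvd_iff.1 (hf.2.1 i) _ h)
  exact funext fun i => le_antisymm (key hf hf' i) (key hf' hf i)

variable [Fintype ι]

theorem exists_eq_add_single [DecidableEq ι] {e : ι → ℕ} {d : ℕ} (h : ∑ i, e i = d + 1) :
    ∃ (e' : ι → ℕ) (i : ι), e = e' + Pi.single i 1 ∧ ∑ i, e' i = d := by
  obtain ⟨i, -, hi⟩ : ∃ i ∈ Finset.univ, e i ≠ 0 := Finset.exists_ne_zero_of_sum_ne_zero (by omega)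
  have h1 : e = (e - Pi.single i 1) + Pi.single i 1 := by
    ext j
    rcases eq_or_ne j i with rfl | hj
    · simp; omega
    · simp [hj]
  refine ⟨_, i, h1, ?_⟩
  rw [h1] at h
  simp only [Pi.add_apply, Finset.sum_add_distrib, Finset.sum_pi_single', Finset.mem_univ,
    if_true] at h
  simpa using h

theorem dim_top_le (e : ι → ℕ) (k : ℕ) :
    𝓛.dim ⊤ k ≤ 𝓛.dim (vanishing φ e) k + ∑ i, e i := by
  classical
  obtain ⟨d, hd⟩ : ∃ d, ∑ i, e i = d := ⟨_, rfl⟩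
  rw [hd]
  induction d generalizing e with
  | zero =>
    have : e = 0 := funext fun i => by
      simpa using (Finset.sum_eq_zero_iff.1 hd) i (Finset.mem_univ i)
    rw [this, vanishing_zero, add_zero]
  | succ d ih =>
    obtain ⟨e', i, rfl, h⟩ := exists_eq_add_single hd
    have := ih e' h
    have := 𝓛.dim_vanishing_le (φ := φ) e' i k
    omega

theorem exists_mem_vanishing [DecidableEq ι] (hX : ∀ i, ∃ t, φ i t = PowerSeries.X)
    (hsep : ∀ i j, i ≠ j →
      ∃ f, PowerSeries.constantCoeff (φ i f) ≠ PowerSeries.constantCoeff (φ j f))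
    (e : ι → ℕ) (i : ι) :
    ∃ f ∈ vanishing φ e, f ∉ vanishing φ (e + Pi.single i 1) := by
  obtain ⟨t, ht⟩ := hX i
  have h1 : ∀ j, ∃ f, (j ≠ i → PowerSeries.constantCoeff (φ j f) = 0) ∧
      PowerSeries.constantCoeff (φ i f) ≠ 0 := by
    intro j
    rcases eq_or_ne j i with rfl | hj
    · exact ⟨1, fun h => (h rfl).elim, by simp⟩
    · obtain ⟨f, hf⟩ := hsep i j hj.symm
      refine ⟨f - algebraMap F O (PowerSeries.constantCoeff (φ j f)), fun _ => ?_, ?_⟩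
      · rw [map_sub, AlgHom.commutes, map_sub]; simp
      · rw [map_sub, AlgHom.commutes, map_sub]
        simpa [PowerSeries.algebraMap_apply, sub_eq_zero] using hf
  choose f hf0 hf1 using h1
  refine ⟨t ^ e i * ∏ j, f j ^ e j, fun j => ?_, fun h => ?_⟩
  · rw [map_mul, map_pow, map_prod]
    rcases eq_or_ne j i with rfl | hj
    · rw [ht]; exact dvd_mul_right _ _
    · refine Dvd.dvd.mul_left (Dvd.dvd.trans ?_ (Finset.dvd_prod_of_mem _ (Finset.mem_univ j))) _
      rw [map_pow]
      exact pow_dvd_pow_of_dvd (PowerSeries.X_dvd_iff.2 (hf0 j hj)) _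
  · have h2 := h i
    rw [map_mul, map_pow, ht, Pi.add_apply, Pi.single_eq_same, PowerSeries.X_pow_dvd_iff] at h2
    have h3 := h2 (e i) (Nat.lt_succ_self _)
    rw [PowerSeries.coeff_X_pow_mul', if_pos le_rfl, Nat.sub_self,
      PowerSeries.coeff_zero_eq_constantCoeff, map_prod, map_prod, Finset.prod_eq_zero_iff] at h3
    obtain ⟨j, -, hj⟩ := h3
    rw [map_pow, map_pow] at hj
    exact pow_ne_zero _ (hf1 j) hj


theorem eventually_dim_vanishing (hX : ∀ i, ∃ t, φ i t = PowerSeries.X)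
    (hsep : ∀ i j, i ≠ j →
      ∃ f, PowerSeries.constantCoeff (φ i f) ≠ PowerSeries.constantCoeff (φ j f)) (e : ι → ℕ) :
    ∃ k₀, ∀ k ≥ k₀, 𝓛.dim (vanishing φ e) k + ∑ i, e i ≤ 𝓛.dim ⊤ k := by
  classical
  obtain ⟨d, hd⟩ : ∃ d, ∑ i, e i = d := ⟨_, rfl⟩
  rw [hd]
  induction d generalizing e with
  | zero => exact ⟨0, fun k _ => 𝓛.dim_mono le_top k⟩
  | succ d ih =>
    obtain ⟨e', i, rfl, h⟩ := exists_eq_add_single hd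
    obtain ⟨k₀, hk₀⟩ := ih e' h
    obtain ⟨f, hf, hf'⟩ := exists_mem_vanishing hX hsep e' i
    obtain ⟨k₁, hk₁⟩ := 𝓛.exists_mem f
    refine ⟨max k₀ k₁, fun k hk => ?_⟩
    have h1 := hk₀ k ((le_max_left _ _).trans hk)
    have h2 : (𝓛.L k ⊓ vanishing φ (e' + Pi.single i 1) : Submodule F O) < 𝓛.L k ⊓ vanishing φ e' :=
      lt_of_le_not_ge (inf_le_inf_left _ (vanishing_add_single_le e' i)) fun h =>
        hf' (h ⟨𝓛.mono ((le_max_right _ _).trans hk) hk₁, hf⟩).2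
    have h3 : 𝓛.dim (vanishing φ (e' + Pi.single i 1)) k < 𝓛.dim (vanishing φ e') k :=
      Submodule.finrank_lt_finrank_of_lt h2
    omega

theorem exists_dim_vanishing_eq (hX : ∀ i, ∃ t, φ i t = PowerSeries.X)
    (hsep : ∀ i j, i ≠ j →
      ∃ f, PowerSeries.constantCoeff (φ i f) ≠ PowerSeries.constantCoeff (φ j f))
    {γ : ℕ} (hγ : ∀ k, k ≤ 𝓛.dim ⊤ k + γ) :
    ∃ g ≤ γ, ∀ (e : ι → ℕ) (k : ℕ), 2 * g + ∑ i, e i ≤ k →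
      𝓛.dim (vanishing φ e) k + g + ∑ i, e i = k := by
  obtain ⟨k₀, hk₀⟩ := exists_forall_succ_eq (𝓛.dim_succ_le ⊤) hγ
  have h0 : ∀ k, 𝓛.dim (⊤ : Submodule F O) k ≤ k := fun k => by
    have := 𝓛.dim_add_le ⊤ 0 k
    rw [𝓛.dim_zero] at this
    simpa using this
  have h1 : ∀ m, 𝓛.dim ⊤ (k₀ + m) = 𝓛.dim ⊤ k₀ + m := fun m => by
    induction m with
    | zero => rfl
    | succ m ih => rw [← add_assoc, hk₀ _ (Nat.le_add_right _ _), ih, add_assoc]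
  obtain ⟨g, hg⟩ : ∃ g, 𝓛.dim ⊤ k₀ + g = k₀ := Nat.exists_eq_add_of_le (h0 k₀) |>.imp fun _ => Eq.symm
  have h2 : ∀ k, k ≤ 𝓛.dim ⊤ k + g := fun k => by
    have h3 := h1 k
    have h4 := 𝓛.dim_add_le ⊤ k k₀
    rw [add_comm k] at h4
    omega
  refine ⟨g, by have := hγ k₀; omega, fun e => ?_⟩
  have h3 : ∀ s ≥ 2 * g + ∑ i, e i,
      𝓛.dim (vanishing φ e) (s + 1) = 𝓛.dim (vanishing φ e) s + 1 := by
    intro s hs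
    refine le_antisymm (𝓛.dim_succ_le _ s) ?_
    by_contra! h
    have h4 := 𝓛.dim_add_dim_le (fun f hf h => mul_mem_vanishing hf h) (Nat.lt_succ_iff.1 h)
    have h5 := 𝓛.dim_top_le (φ := φ) e (s + 1)
    have h6 := h2 (s + 1)
    omega
  intro k hk
  have h4 : ∀ m, 𝓛.dim (vanishing φ e) (k + m) = 𝓛.dim (vanishing φ e) k + m := fun m => by
    induction m with
    | zero => rfl
    | succ m ih => rw [← add_assoc, h3 _ (by omega), ih, add_assoc]
  obtain ⟨k₁, hk₁⟩ := 𝓛.eventually_dim_vanishing hX hsep e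
  have h5 := hk₁ (k + (k₀ + k₁)) (by omega)
  have h6 := 𝓛.dim_top_le (φ := φ) e (k + (k₀ + k₁))
  have h7 := h1 (k + k₁)
  have h8 := h4 (k₀ + k₁)
  rw [show k₀ + (k + k₁) = k + (k₀ + k₁) by omega] at h7
  omega

theorem _root_.LinearMap.natCard_preimage {V W : Type*} [AddCommGroup V] [Module F V]
    [AddCommGroup W] [Module F W] (f : V →ₗ[F] W) (hf : Function.Surjective f) (T : Set W) :
    Nat.card (f ⁻¹' T) = Nat.card (LinearMap.ker f) * Nat.card T := by
  obtain ⟨σ, hσ⟩ := f.exists_rightInverse_of_surjective (LinearMap.range_eq_top.2 hf)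
  have hσ' : ∀ w, f (σ w) = w := fun w => LinearMap.congr_fun hσ w
  rw [← Nat.card_prod]
  exact Nat.card_congr
    { toFun := fun v => (⟨v.1 - σ (f v.1), by simp [hσ']⟩, ⟨f v.1, v.2⟩)
      invFun := fun p => ⟨p.1.1 + σ p.2.1, by
        have : f p.1.1 = 0 := p.1.2
        simp [hσ', this]⟩
      left_inv := fun v => by simp
      right_inv := fun p => by
        have : f p.1.1 = 0 := p.1.2
        ext <;> simp [hσ', this] }

theorem natCard_forall_ne_zero [Fintype F] :
    Nat.card {w : ι → F | ∀ i, w i ≠ 0} = (Fintype.card F - 1) ^ Fintype.card ι := by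
  classical
  have e : {w : ι → F | ∀ i, w i ≠ 0} ≃ (ι → {a : F // a ≠ 0}) :=
    Equiv.subtypePiEquivPi (p := fun _ (a : F) => a ≠ 0)
  rw [Nat.card_congr e, Nat.card_pi]
  simp [Fintype.card_subtype_compl]

theorem ncard_exact [Fintype F] {g : ℕ} (hg : ∀ (e : ι → ℕ) (k : ℕ), 2 * g + ∑ i, e i ≤ k →
      𝓛.dim (vanishing φ e) k + g + ∑ i, e i = k)
    (e : ι → ℕ) {k : ℕ} (hk : 2 * g + ∑ i, e i + Fintype.card ι ≤ k) :
    (𝓛.exact φ e k).ncard = Fintype.card F ^ (k - g - ∑ i, e i - Fintype.card ι) *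
      (Fintype.card F - 1) ^ Fintype.card ι := by
  let V : Submodule F O := 𝓛.L k ⊓ vanishing φ e
  let ψ : V →ₗ[F] (ι → F) := LinearMap.pi fun i =>
    (PowerSeries.coeff (e i)) ∘ₗ (φ i).toLinearMap ∘ₗ V.subtype

  have hker : (LinearMap.ker ψ).map V.subtype = 𝓛.L k ⊓ vanishing φ (e + 1) := by
    ext f
    constructor
    · rintro ⟨v, hv, rfl⟩
      refine ⟨v.2.1, fun i => X_pow_succ_dvd (v.2.2 i) ?_⟩
      have := congrFun (LinearMap.mem_ker.1 hv) i
      exact this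
    · rintro ⟨h1, h2⟩
      have h3 : f ∈ vanishing φ e := fun i => (pow_dvd_pow _ (Nat.le_succ _)).trans (h2 i)
      exact ⟨⟨f, h1, h3⟩, LinearMap.mem_ker.2 (funext fun i =>
        PowerSeries.X_pow_dvd_iff.1 (h2 i) _ (Nat.lt_succ_self _)), rfl⟩
  have hkd : finrank F (LinearMap.ker ψ) = 𝓛.dim (vanishing φ (e + 1)) k := by
    rw [dim, ← hker]
    exact (Submodule.finrank_map_subtype_eq V (LinearMap.ker ψ)).symm
  have hs : ∑ i, (e + 1) i = ∑ i, e i + Fintype.card ι := by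
    simp [Finset.sum_add_distrib]
  have h1 := hg e k (by omega)
  have h2 := hg (e + 1) k (by omega)
  have h3 := LinearMap.finrank_range_add_finrank_ker ψ
  rw [hkd] at h3
  have h4 : finrank F V = 𝓛.dim (vanishing φ e) k := rfl
  have hsurj : Function.Surjective ψ := by
    rw [← LinearMap.range_eq_top]
    refine Submodule.eq_top_of_finrank_eq ?_
    rw [finrank_fintype_fun_eq_card]
    omega
  have h5 := LinearMap.natCard_preimage ψ hsurj {w | ∀ i, w i ≠ 0}
  rw [natCard_forall_ne_zero, natCard_eq_pow_finrank (K := F) (V := LinearMap.ker ψ), hkd,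
    Nat.card_eq_fintype_card (α := F),
    show 𝓛.dim (vanishing φ (e + 1)) k = k - g - ∑ i, e i - Fintype.card ι by omega] at h5
  rw [← h5, ← Nat.card_coe_set_eq]
  exact Nat.card_congr
    { toFun := fun f => ⟨⟨f.1, f.2.1, f.2.2.1⟩, f.2.2.2⟩
      invFun := fun v => ⟨v.1.1, v.1.2.1, v.1.2.2, v.2⟩
      left_inv := fun _ => rfl
      right_inv := fun _ => rfl }

theorem finite_L [Finite F] (k : ℕ) : (𝓛.L k : Set O).Finite := by
  have h := 𝓛.finiteDimensional_inf ⊤ k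
  rw [inf_top_eq] at h
  have : Finite (𝓛.L k) := Module.finite_of_finite F
  exact Set.toFinite _

theorem card_piAntidiag_univ [DecidableEq ι] (d : ℕ) :
    (Finset.piAntidiag (Finset.univ : Finset ι) d).card = (Fintype.card ι).multichoose d := by
  rw [← Finset.map_sym_eq_piAntidiag, Finset.card_map, Finset.sym_univ, Finset.card_univ,
    Sym.card_sym_eq_multichoose]

/-- The elements of pole order below `m` with `d` zeros at the given points. -/
def zeros (φ : ι → O →ₐ[F] PowerSeries F) (d m : ℕ) : Set O :=
  {f | ∃ e : ι → ℕ, ∑ i, e i = d ∧ f ∈ 𝓛.exact φ e m}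

theorem ncard_zeros [Fintype F] {d m c : ℕ}
    (hc : ∀ e : ι → ℕ, ∑ i, e i = d → (𝓛.exact φ e m).ncard = c) :
    (𝓛.zeros φ d m).ncard = (Fintype.card ι).multichoose d * c := by
  classical
  have h1 : 𝓛.zeros φ d m = ⋃ e ∈ (Finset.piAntidiag (Finset.univ : Finset ι) d : Set (ι → ℕ)),
      𝓛.exact φ e m := by
    ext f
    simp [zeros]
  have h2 : ∀ e ∈ Finset.piAntidiag (Finset.univ : Finset ι) d, (𝓛.exact φ e m).ncard = c :=
    fun e he => hc e (Finset.mem_piAntidiag.1 he).1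
  rw [h1, (Finset.finite_toSet _).ncard_biUnion
    (fun e _ => (𝓛.finite_L m).subset fun f hf => hf.1)
    (fun e _ e' _ h => Set.disjoint_left.2 fun f hf hf' => h (𝓛.eq_of_mem_exact hf hf')),
    finsum_mem_coe_finset, Finset.sum_congr rfl h2, Finset.sum_const, smul_eq_mul,
    card_piAntidiag_univ]

theorem exists_sum_product [Fintype F] (hX : ∀ i, ∃ t, φ i t = PowerSeries.X)
    (hsep : ∀ i j, i ≠ j →
      ∃ f, PowerSeries.constantCoeff (φ i f) ≠ PowerSeries.constantCoeff (φ j f))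
    {γ : ℕ} (hγ : ∀ k, k ≤ 𝓛.dim ⊤ k + γ) :
    ∃ g ≤ γ, ∀ d m : ℕ, 2 * g + d + Fintype.card ι ≤ m → ∃ A : Set O, A.Finite ∧
      A.ncard = (Fintype.card ι).multichoose d * (Fintype.card F ^ (m - g - d - Fintype.card ι) *
        (Fintype.card F - 1) ^ Fintype.card ι) ∧
      (A + A).ncard ≤ Fintype.card F ^ (m - g) ∧
      (A * A).ncard ≤ (Fintype.card ι).multichoose (2 * d) *
        (Fintype.card F ^ (2 * m - g - 2 * d - Fintype.card ι) *
          (Fintype.card F - 1) ^ Fintype.card ι) := by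
  obtain ⟨g, hg, h⟩ := 𝓛.exists_dim_vanishing_eq hX hsep hγ
  refine ⟨g, hg, fun d m hm => ⟨𝓛.zeros φ d m, (𝓛.finite_L m).subset fun f ⟨_, _, hf⟩ => hf.1, ?_, ?_,
    ?_⟩⟩
  · refine 𝓛.ncard_zeros fun e he => ?_
    rw [𝓛.ncard_exact h e (by omega), he]
  · have h1 : 𝓛.zeros φ d m + 𝓛.zeros φ d m ⊆ 𝓛.L m := by
      rintro _ ⟨f, ⟨_, _, hf⟩, f', ⟨_, _, hf'⟩, rfl⟩
      exact add_mem hf.1 hf'.1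
    refine (Set.ncard_le_ncard h1 (𝓛.finite_L m)).trans ?_
    have h2 := h 0 m (by simp; omega)
    rw [vanishing_zero, dim, inf_top_eq] at h2
    have h3 := 𝓛.finiteDimensional_inf ⊤ m
    rw [inf_top_eq] at h3
    rw [← Nat.card_coe_set_eq]
    refine (natCard_eq_pow_finrank (K := F) (V := 𝓛.L m)).le.trans ?_
    rw [Nat.card_eq_fintype_card]
    refine Nat.pow_le_pow_right Fintype.card_pos ?_
    simp at h2
    omega
  · have h1 : 𝓛.zeros φ d m * 𝓛.zeros φ d m ⊆ 𝓛.zeros φ (2 * d) (2 * m) := by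
      rintro _ ⟨f, ⟨e, he, hf⟩, f', ⟨e', he', hf'⟩, rfl⟩
      exact ⟨e + e', by simp [Finset.sum_add_distrib, he, he', two_mul], 𝓛.mul_mem_exact hf hf'⟩
    refine (Set.ncard_le_ncard h1 ((𝓛.finite_L _).subset fun f ⟨_, _, hf⟩ => hf.1)).trans ?_
    refine (𝓛.ncard_zeros fun e he => ?_).le
    rw [𝓛.ncard_exact h e (by omega), he]

end PoleFiltration

theorem one_lt_valuation_of_pow_add_self {Ω Γ : Type*} [Field Ω]
    [LinearOrderedCommGroupWithZero Γ] (v : Valuation Ω Γ) {l : ℕ} (hl : 2 ≤ l) {y z : Ω}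
    (hy : 1 < v y) (h : z ^ l + z = y ^ l / (y ^ (l - 1) + 1)) : 1 < v z := by
  by_contra! hz
  have h1 : v (z ^ l + z) ≤ 1 :=
    (v.map_add _ _).trans (max_le (by rw [map_pow]; exact pow_le_one' hz l) hz)
  have h2 : v (y ^ (l - 1) + 1) = v y ^ (l - 1) := by
    rw [v.map_add_eq_of_lt_left, map_pow]
    rw [map_pow, map_one]
    exact one_lt_pow₀ hy (by omega)
  rw [h, map_div₀, h2, map_pow] at h1
  have h3 : v y ^ l = v y * v y ^ (l - 1) := by
    rw [← pow_succ', Nat.sub_add_cancel (by omega)]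
  rw [h3, mul_div_cancel_right₀ _ (pow_ne_zero _ (zero_lt_one.trans hy).ne')] at h1
  exact h1.not_gt hy

namespace GSTower

universe w

theorem nonempty {F : Type w} [Field F] {l : ℕ} (hl : 2 ≤ l)
    (hF : ∀ (Ω : Type w) [Field Ω] [Algebra F Ω] (a b : Ω), (a + b) ^ l = a ^ l + b ^ l) :
    Nonempty (GSTower F (AlgebraicClosure (RatFunc F)) l) := by
  let Ω := AlgebraicClosure (RatFunc F)
  have hroot : ∀ y : Ω, ∃ z : Ω, z ^ l + z = y ^ l / (y ^ (l - 1) + 1) := by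
    intro y
    let P : Polynomial Ω := Polynomial.X ^ l + (Polynomial.X -
      Polynomial.C (y ^ l / (y ^ (l - 1) + 1)))
    have hP : P.natDegree = l := by
      rw [Polynomial.natDegree_add_eq_left_of_natDegree_lt] <;> rw [Polynomial.natDegree_X_pow]
      rw [Polynomial.natDegree_X_sub_C]; omega
    obtain ⟨z, hz⟩ := IsAlgClosed.exists_root P fun h => by
      have : P.natDegree = 0 := Polynomial.natDegree_eq_of_degree_eq_some h
      omega
    refine ⟨z, ?_⟩
    simp only [P, Polynomial.IsRoot.def, Polynomial.eval_add, Polynomial.eval_pow,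
      Polynomial.eval_X, Polynomial.eval_sub, Polynomial.eval_C] at hz
    linear_combination hz
  choose next hnext using hroot
  let x₀ : Ω := algebraMap (RatFunc F) Ω RatFunc.X
  have htr : Transcendental F x₀ :=
    (transcendental_algebraMap_iff (algebraMap (RatFunc F) Ω).injective).2 RatFunc.transcendental_X
  let x : ℕ → Ω := fun i => next^[i] x₀
  have hx : ∀ i, x (i + 1) ^ l + x (i + 1) = x i ^ l / (x i ^ (l - 1) + 1) := fun i => by
    simp only [x, Function.iterate_succ', Function.comp]
    exact hnext _
  obtain ⟨V, -, hV⟩ := exists_valuationSubring_of_not_isIntegral (A := F) (f := x₀)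
    fun h => htr h.isAlgebraic
  have hv : ∀ i, 1 < V.valuation (x i) := fun i => by
    induction i with
    | zero => rw [← not_le, V.valuation_le_one_iff]; exact hV
    | succ i ih => exact one_lt_valuation_of_pow_add_self _ hl ih (hx i)
  refine ⟨⟨x, htr, hl, hF Ω, fun i => ?_⟩⟩
  rw [hx, div_mul_cancel₀]
  intro h
  have h1 : x i ^ (l - 1) = -1 := eq_neg_of_add_eq_zero_left h
  have h2 := one_lt_pow₀ (hv i) (show l - 1 ≠ 0 by omega)
  rw [← map_pow, h1, Valuation.map_neg, map_one] at h2
  exact h2.false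

end GSTower

namespace GarciaStichtenoth

section Points

variable {F : Type*} [Field F]

/-- The first `n + 1` coordinates of a rational point of the tower. -/
structure IsPoint (l n : ℕ) (c : ℕ → F) : Prop where
  ne_zero : ∀ i ≤ n, c i ^ l + c i ≠ 0
  rel : ∀ i < n, (c (i + 1) ^ l + c (i + 1)) * (c i ^ (l - 1) + 1) = c i ^ l

variable {l : ℕ}

theorem card_le_of_pow_eq (hl : 2 ≤ l) (a : F) :
    Nat.card {x : F | x ^ l = a * x} ≤ l := by
  classical
  let P : Polynomial F := Polynomial.X ^ l - Polynomial.C a * Polynomial.X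
  have hP : P.natDegree = l := by
    refine Polynomial.natDegree_sub_eq_left_of_natDegree_lt ?_ |>.trans (Polynomial.natDegree_X_pow l)
    rw [Polynomial.natDegree_X_pow]
    exact (Polynomial.natDegree_C_mul_le _ _).trans_lt (by rw [Polynomial.natDegree_X]; omega)
  have h0 : P ≠ 0 := fun h => by rw [h, Polynomial.natDegree_zero] at hP; omega
  have h1 : {x : F | x ^ l = a * x} = (P.roots.toFinset : Set F) := by
    ext x
    simp [P, h0, sub_eq_zero]
  rw [h1, Nat.card_coe_set_eq, Set.ncard_coe_finset]
  exact (Multiset.toFinset_card_le _).trans ((Polynomial.card_roots' P).trans hP.le)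

/-- The additive polynomial `X ^ l + X`. -/
def traceHom (l : ℕ) (hl : 2 ≤ l) (hadd : ∀ a b : F, (a + b) ^ l = a ^ l + b ^ l) : F →+ F where
  toFun a := a ^ l + a
  map_zero' := by rw [zero_pow (by omega), add_zero]
  map_add' a b := by rw [hadd]; ring

variable [Fintype F]

theorem pow_pow_eq (hq : Fintype.card F = l ^ 2) (a : F) : (a ^ l) ^ l = a := by
  rw [← pow_mul, ← sq, ← hq, FiniteField.pow_card]

theorem card_ker_and_range (hl : 2 ≤ l) (hq : Fintype.card F = l ^ 2)
    (hadd : ∀ a b : F, (a + b) ^ l = a ^ l + b ^ l) :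
    Nat.card (traceHom l hl hadd).ker = l ∧
      ∀ a : F, a ^ l = a → ∃ b, b ^ l + b = a := by
  have h1 : Nat.card (traceHom l hl hadd).ker ≤ l := by
    refine le_trans (le_of_eq ?_) (card_le_of_pow_eq hl (-1 : F))
    refine Nat.card_congr (Equiv.setCongr ?_)
    ext a
    simp [traceHom, AddMonoidHom.mem_ker, add_eq_zero_iff_eq_neg]
  have h2 : ((traceHom l hl hadd).range : Set F) ⊆ {x : F | x ^ l = 1 * x} := by
    rintro _ ⟨a, rfl⟩
    change (a ^ l + a) ^ l = 1 * (a ^ l + a)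
    rw [hadd, pow_pow_eq hq]; ring
  have h3 := card_le_of_pow_eq hl (1 : F)
  have h4 : Nat.card (traceHom l hl hadd).range * Nat.card (traceHom l hl hadd).ker = l * l := by
    rw [← AddSubgroup.index_ker, AddSubgroup.index_mul_card, Nat.card_eq_fintype_card, hq, sq]
  have h5 : Nat.card (traceHom l hl hadd).range ≤ Nat.card {x : F | x ^ l = 1 * x} :=
    Nat.card_mono (Set.toFinite _) h2
  have h6 : Nat.card (traceHom l hl hadd).ker = l := by nlinarith
  refine ⟨h6, fun a ha => ?_⟩
  rw [h6] at h4
  have h7 : Nat.card (traceHom l hl hadd).range = l := Nat.eq_of_mul_eq_mul_right (by omega) h4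
  have h8 := Set.eq_of_subset_of_ncard_le h2 (by
    rw [← Nat.card_coe_set_eq, ← Nat.card_coe_set_eq]; exact h3.trans h7.ge)
  have h9 : a ∈ ((traceHom l hl hadd).range : Set F) := by rw [h8]; simpa using ha
  exact h9

theorem exists_points (hl : 2 ≤ l) (hq : Fintype.card F = l ^ 2)
    (hadd : ∀ a b : F, (a + b) ^ l = a ^ l + b ^ l) (n : ℕ) :
    ∃ S : Finset (ℕ → F), S.card = (l - 1) * l ^ (n + 1) ∧ (∀ c ∈ S, IsPoint l n c) ∧
      ∀ c ∈ S, ∀ c' ∈ S, (∀ i ≤ n, c i = c' i) → c = c' := by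
  classical
  obtain ⟨hker, hrange⟩ := card_ker_and_range hl hq hadd
  set K : Finset F := Finset.univ.filter fun a => a ^ l + a = 0 with hK
  have hKcard : K.card = l := by
    rw [← hker, ← Nat.card_eq_finsetCard]
    exact Nat.card_congr (Equiv.subtypeEquivRight fun a => by
      rw [hK, Finset.mem_filter, and_iff_right (Finset.mem_univ a), AddMonoidHom.mem_ker]; rfl)
  induction n with
  | zero =>
    refine ⟨(Finset.univ.filter fun a : F => a ^ l + a ≠ 0).image fun a _ => a, ?_, ?_, ?_⟩
    · rw [Finset.card_image_of_injective _ fun a b h => congrFun h 0]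
      have := Finset.card_filter_add_card_filter_not (s := (Finset.univ : Finset F)) (p := fun a => a ^ l + a = 0)
      rw [← hK, hKcard, Finset.card_univ, hq] at this
      rw [zero_add, pow_one, Nat.sub_mul, one_mul, ← sq]
      simp only [ne_eq]
      omega
    · simp only [Finset.mem_image, Finset.mem_filter, Finset.mem_univ, true_and]
      rintro _ ⟨a, ha, rfl⟩
      exact ⟨fun _ _ => ha, fun _ h => (Nat.not_lt_zero _ h).elim⟩
    · simp only [Finset.mem_image, Finset.mem_filter, Finset.mem_univ, true_and]
      rintro _ ⟨a, ha, rfl⟩ _ ⟨b, hb, rfl⟩ h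
      funext
      exact h 0 le_rfl
  | succ n ih =>
    obtain ⟨S, hS, hp, hinj⟩ := ih
    have hr : ∀ c : ℕ → F, ∃ b, c ∈ S → (b ^ l + b) * (c n ^ (l - 1) + 1) = c n ^ l ∧ b ^ l + b ≠ 0 := by
      intro c
      by_cases hc : c ∈ S
      · have h1 := (hp c hc).ne_zero n le_rfl
        have h2 : c n ^ l + c n = c n * (c n ^ (l - 1) + 1) := by
          rw [mul_add, mul_one, ← pow_succ', Nat.sub_add_cancel (by omega)]
        rw [h2] at h1
        have h3 : c n ^ l / (c n ^ (l - 1) + 1) = c n ^ l * c n / (c n ^ l + c n) := by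
          rw [h2, mul_comm (c n ^ l), mul_div_mul_left _ _ (left_ne_zero_of_mul h1)]
        obtain ⟨b, hb⟩ := hrange (c n ^ l / (c n ^ (l - 1) + 1)) (by
          rw [h3, div_pow, mul_pow, hadd, pow_pow_eq hq, add_comm (c n), mul_comm (c n)])
        refine ⟨b, fun _ => ⟨?_, ?_⟩⟩
        · rw [hb, div_mul_cancel₀ _ (right_ne_zero_of_mul h1)]
        · rw [hb]
          exact div_ne_zero (pow_ne_zero _ (left_ne_zero_of_mul h1)) (right_ne_zero_of_mul h1)
      · exact ⟨0, fun h => (hc h).elim⟩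
    choose r hr using hr
    have key : ∀ p ∈ S ×ˢ K, ∀ p' ∈ S ×ˢ K, (∀ i ≤ n + 1,
        Function.update p.1 (n + 1) (r p.1 + p.2) i =
          Function.update p'.1 (n + 1) (r p'.1 + p'.2) i) → p = p' := by
      intro p hp' p' hp'' h
      rw [Finset.mem_product] at hp' hp''
      have h1 : p.1 = p'.1 := hinj _ hp'.1 _ hp''.1 fun i hi => by
        have := h i (by omega)
        rwa [Function.update_of_ne (by omega), Function.update_of_ne (by omega)] at this
      have h2 := h (n + 1) le_rfl
      rw [Function.update_self, Function.update_self, h1] at h2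
      exact Prod.ext h1 (add_left_cancel h2)
    refine ⟨(S ×ˢ K).image fun p => Function.update p.1 (n + 1) (r p.1 + p.2), ?_, ?_, ?_⟩
    · rw [Finset.card_image_of_injOn fun p hp p' hp' h => key p hp p' hp' fun i _ => congrFun h i,
        Finset.card_product, hS, hKcard, pow_succ _ (n + 1), mul_assoc]
    · intro c hc
      obtain ⟨p, hp', rfl⟩ := Finset.mem_image.1 hc
      rw [Finset.mem_product] at hp'
      have hpt := hp p.1 hp'.1
      have h1 := hr p.1 hp'.1
      have h2 : (r p.1 + p.2) ^ l + (r p.1 + p.2) = r p.1 ^ l + r p.1 := by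
        have : p.2 ^ l + p.2 = 0 := by simpa [hK] using hp'.2
        rw [hadd]; linear_combination this
      refine ⟨fun i hi => ?_, fun i hi => ?_⟩
      · rcases Nat.le_succ_iff.1 hi with h | rfl
        · rw [Function.update_of_ne (by omega)]; exact hpt.ne_zero i h
        · rw [Function.update_self, h2]; exact h1.2
      · rw [Function.update_of_ne (a := i) (by omega)]
        rcases Nat.lt_succ_iff_lt_or_eq.1 hi with h | rfl
        · rw [Function.update_of_ne (by omega)]; exact hpt.rel i h
        · rw [Function.update_self, h2]; exact h1.1
    · intro c hc c' hc' h
      obtain ⟨p, hp', rfl⟩ := Finset.mem_image.1 hc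
      obtain ⟨p', hp'', rfl⟩ := Finset.mem_image.1 hc'
      rw [key p hp' p' hp'' h]

end Points

end GarciaStichtenoth

namespace PowerSeries

variable {F : Type*} [Field F]

theorem exists_pow_add_self_eq {l : ℕ} (hl : 2 ≤ l) (hl0 : (l : F) = 0) (w : PowerSeries F) {a : F}
    (ha : a ^ l + a = constantCoeff w) :
    ∃ s : PowerSeries F, constantCoeff s = a ∧ s ^ l + s = w := by
  let P : Polynomial (PowerSeries F) := Polynomial.X ^ l + (Polynomial.X - Polynomial.C w)
  have hP : P.Monic := Polynomial.monic_X_pow_add (by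
    rw [Polynomial.degree_X_sub_C]; exact_mod_cast hl)
  have hl1 : (l : PowerSeries F) = 0 := by
    rw [← map_natCast (C (R := F)), hl0, map_zero]
  obtain ⟨s, hs, hs'⟩ := HenselianRing.is_henselian (I := Ideal.span {(X : PowerSeries F)}) P hP
    (C a) (by
      rw [Ideal.mem_span_singleton, X_dvd_iff]
      simp [P, ← ha]) (by
      simp [P, Polynomial.derivative_X_pow, hl1])
  refine ⟨s, ?_, ?_⟩
  · rw [Ideal.mem_span_singleton, X_dvd_iff, map_sub, constantCoeff_C, sub_eq_zero] at hs'
    exact hs'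
  · simp only [P, Polynomial.IsRoot.def, Polynomial.eval_add, Polynomial.eval_pow,
      Polynomial.eval_X, Polynomial.eval_sub, Polynomial.eval_C] at hs
    linear_combination hs

theorem transcendental_C_add_X (a : F) : Transcendental F (C a + X : PowerSeries F) := by
  have h1 : Transcendental F (X : PowerSeries F) := by
    rw [← Polynomial.coe_X]
    exact (transcendental_algebraMap_iff (R := F) (A := PowerSeries F) (S := Polynomial F)
      (Polynomial.coe_injective F)).2 (Polynomial.transcendental_X F)
  intro h
  refine h1 ?_
  have h2 : (X : PowerSeries F) = (C a + X) - algebraMap F (PowerSeries F) a := by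
    simp
  rw [h2]
  exact h.sub (isAlgebraic_algebraMap a)

end PowerSeries

namespace GSTower

open PowerSeries GarciaStichtenoth

variable {F Ω : Type*} [Field F] [Field Ω] [Algebra F Ω] {l : ℕ} (G : GSTower F Ω l)

/-- The polynomial equation of `x (n + 1)` over the `n`-th field. -/
noncomputable def stepPoly (n : ℕ) : Polynomial (G.field n) :=
  Polynomial.X ^ l + (Polynomial.X - Polynomial.C ⟨G.x n ^ l / G.u n,
    div_mem (pow_mem (G.x_mem n) _) (G.u_mem_of_le le_rfl)⟩)

theorem stepPoly_monic (n : ℕ) : (G.stepPoly n).Monic :=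
  Polynomial.monic_X_pow_add (by
    rw [Polynomial.degree_X_sub_C]; exact_mod_cast G.two_le)

theorem natDegree_stepPoly (n : ℕ) : (G.stepPoly n).natDegree = l := by
  have := G.two_le
  rw [stepPoly, Polynomial.natDegree_add_eq_left_of_natDegree_lt, Polynomial.natDegree_X_pow]
  rw [Polynomial.natDegree_X_pow, Polynomial.natDegree_X_sub_C]; omega

theorem aeval_stepPoly (n : ℕ) : Polynomial.aeval (G.x (n + 1)) (G.stepPoly n) = 0 := by
  simp only [stepPoly, map_add, map_sub, map_pow, Polynomial.aeval_X, Polynomial.aeval_C]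
  change _ + (_ - G.x n ^ l / G.u n) = 0
  rw [← G.pow_add_self_succ]; ring

theorem minpoly_eq (n : ℕ) : minpoly (G.field n) (G.x (n + 1)) = G.stepPoly n := by
  refine (minpoly.unique _ _ (G.stepPoly_monic n) (G.aeval_stepPoly n) fun Q hQ h => ?_).symm
  by_contra! hdeg
  have h1 : Q.natDegree < l :=
    (Polynomial.natDegree_lt_natDegree hQ.ne_zero hdeg).trans_eq (G.natDegree_stepPoly n)
  rw [Polynomial.aeval_eq_sum_range' h1] at h
  have := coeff_eq_zero (G := G) (c := fun i => (Q.coeff i : G.field n)) (fun i => SetLike.coe_mem _) h _ h1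
  rw [Polynomial.coeff_natDegree, hQ.leadingCoeff] at this
  exact one_ne_zero this

theorem exists_algHom_field {n : ℕ} {c : ℕ → F} (hl0 : (l : F) = 0) (hc : IsPoint l n c) (k : ℕ) (hk : k ≤ n) :
    ∃ ψ : G.field k →ₐ[F] FractionRing (PowerSeries F),
      ψ ⟨G.x 0, G.x_mem_of_le (Nat.zero_le k)⟩ = algebraMap (PowerSeries F) _ (C (c 0) + X) ∧
      ∀ i (hi : i ≤ k), ∃ s : PowerSeries F, constantCoeff s = c i ∧
        ψ ⟨G.x i, G.x_mem_of_le hi⟩ = algebraMap (PowerSeries F) _ s := by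
  have hl := G.two_le
  induction k with
  | zero =>
    have ht : Transcendental F (algebraMap (PowerSeries F) (FractionRing (PowerSeries F))
        (C (c 0) + X)) :=
      (transcendental_algebraMap_iff (IsFractionRing.injective _ _)).2 (transcendental_C_add_X _)
    let e := RatFunc.algEquivOfTranscendental (G.x 0) G.transcendental
    let e' := RatFunc.algEquivOfTranscendental _ ht
    let ψ : G.field 0 →ₐ[F] FractionRing (PowerSeries F) :=
      (IntermediateField.val _).comp (e'.toAlgHom.comp e.symm.toAlgHom)
    have h0 : ψ ⟨G.x 0, G.x_mem_of_le le_rfl⟩ = algebraMap (PowerSeries F) _ (C (c 0) + X) := by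
      have h1 : (⟨G.x 0, G.x_mem_of_le le_rfl⟩ : G.field 0) = e RatFunc.X :=
        Subtype.ext (RatFunc.algEquivOfTranscendental_X _ G.transcendental).symm
      have h2 : e.symm (⟨G.x 0, G.x_mem_of_le le_rfl⟩ : G.field 0) = RatFunc.X := by
        rw [h1]; exact e.symm_apply_apply _
      change (IntermediateField.val _) (e' (e.symm (⟨G.x 0, G.x_mem_of_le le_rfl⟩ : G.field 0))) = _
      rw [h2]
      exact RatFunc.algEquivOfTranscendental_X _ ht
    refine ⟨ψ, h0, fun i hi => ?_⟩
    obtain rfl : i = 0 := by omega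
    exact ⟨_, by simp, h0⟩
  | succ k ih =>
    obtain ⟨ψ, h0, hψ⟩ := ih (by omega)
    obtain ⟨s, hs, hs'⟩ := hψ k le_rfl
    have hck : c k ^ (l - 1) + 1 ≠ 0 := fun h => hc.ne_zero k (by omega) (by
      have : c k ^ l + c k = c k * (c k ^ (l - 1) + 1) := by
        rw [mul_add, mul_one, ← pow_succ', Nat.sub_add_cancel (by omega)]
      rw [this, h, mul_zero])
    have hu : constantCoeff (s ^ (l - 1) + 1) ≠ 0 := by
      rwa [map_add, map_pow, map_one, hs]
    have hinv : (s ^ (l - 1) + 1) * (s ^ (l - 1) + 1)⁻¹ = 1 := PowerSeries.mul_inv_cancel _ hu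
    obtain ⟨s', hs1, hs2⟩ := exists_pow_add_self_eq hl hl0 (s ^ l * (s ^ (l - 1) + 1)⁻¹)
      (a := c (k + 1)) (by
        rw [map_mul, map_pow, constantCoeff_inv, map_add, map_pow, map_one, hs,
          ← hc.rel k (by omega), mul_assoc, mul_inv_cancel₀ hck, mul_one])
    algebraize [ψ.toRingHom]
    have hint : IsIntegral (G.field k) (G.x (k + 1)) :=
      ⟨_, G.stepPoly_monic k, G.aeval_stepPoly k⟩
    have hmem : algebraMap (PowerSeries F) (FractionRing (PowerSeries F)) s' ∈
        (minpoly (G.field k) (G.x (k + 1))).aroots (FractionRing (PowerSeries F)) := by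
      rw [G.minpoly_eq, Polynomial.aroots, Polynomial.mem_roots ((G.stepPoly_monic k).map _).ne_zero,
        Polynomial.IsRoot, Polynomial.eval_map]
      simp only [stepPoly, Polynomial.eval₂_add, Polynomial.eval₂_sub, Polynomial.eval₂_pow,
        Polynomial.eval₂_X, Polynomial.eval₂_C]
      have h1 : ψ ⟨G.x k ^ l / G.u k, div_mem (pow_mem (G.x_mem k) _) (G.u_mem_of_le le_rfl)⟩ =
          algebraMap (PowerSeries F) _ (s ^ l * (s ^ (l - 1) + 1)⁻¹) := by
        have h2 : (⟨G.x k ^ l / G.u k, div_mem (pow_mem (G.x_mem k) _) (G.u_mem_of_le le_rfl)⟩ :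
            G.field k) * (⟨G.x k, G.x_mem_of_le le_rfl⟩ ^ (l - 1) + 1) =
            ⟨G.x k, G.x_mem_of_le le_rfl⟩ ^ l :=
          Subtype.ext (div_mul_cancel₀ _ (G.u_ne_zero k))
        have h3 := congrArg ψ h2
        rw [map_mul, map_add, map_pow, map_pow, map_one, hs'] at h3
        have h4 := congrArg (algebraMap (PowerSeries F) (FractionRing (PowerSeries F))) hinv
        rw [map_mul, map_add, map_pow, map_one] at h4
        rw [map_mul, map_pow]
        linear_combination (algebraMap (PowerSeries F) (FractionRing (PowerSeries F))
          (s ^ (l - 1) + 1)⁻¹) * h3 - ψ ⟨G.x k ^ l / G.u k,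
            div_mem (pow_mem (G.x_mem k) _) (G.u_mem_of_le le_rfl)⟩ * h4
      change _ + (_ - ψ _) = 0
      rw [h1, ← hs2, map_add, map_pow]; ring
    let χ := (IntermediateField.algHomAdjoinIntegralEquiv (G.field k) hint).symm ⟨_, hmem⟩
    have hχ : χ (IntermediateField.AdjoinSimple.gen _ _) = algebraMap (PowerSeries F) _ s' :=
      IntermediateField.algHomAdjoinIntegralEquiv_symm_apply_gen _ hint _
    have hχ' : ∀ f : G.field k, χ (algebraMap _ _ f) = ψ f := fun f => χ.commutes f
    let ψ' : G.field (k + 1) →ₐ[F] FractionRing (PowerSeries F) :=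
      { χ.toRingHom with
        commutes' := fun r => by
          refine Eq.trans ?_ (ψ.commutes r)
          exact hχ' (algebraMap F (G.field k) r) }
    refine ⟨ψ', ?_, fun i hi => ?_⟩
    · rw [← h0]; exact hχ' ⟨G.x 0, _⟩
    · rcases Nat.le_succ_iff.1 hi with h | rfl
      · obtain ⟨t, ht, ht'⟩ := hψ i h
        refine ⟨t, ht, ?_⟩
        rw [← ht']; exact hχ' ⟨G.x i, _⟩
      · exact ⟨s', hs1, hχ⟩

/-- The regular functions in the `n`-th field. -/
def coordRing (n : ℕ) : Subalgebra F Ω := G.ring ⊓ (G.field n).toSubalgebra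

open Polynomial in
theorem exists_monic_of_mem_ring {f : Ω} (hf : f ∈ G.ring) :
    ∃ P : F[X][X], P.Monic ∧ P.eval₂ (aeval (G.x 0) : F[X] →ₐ[F] Ω).toRingHom f = 0 := by
  algebraize [(aeval (G.x 0) : F[X] →ₐ[F] Ω).toRingHom]
  by_contra h
  obtain ⟨V, hV, hfV⟩ := exists_valuationSubring_of_not_isIntegral (A := F[X]) (f := f) h
  refine hfV (hf V ⟨fun c => ?_, ?_⟩)
  · have := hV (Polynomial.C c)
    change aeval (G.x 0) (Polynomial.C c) ∈ V at this
    rwa [aeval_C] at this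
  · have := hV Polynomial.X
    change aeval (G.x 0) Polynomial.X ∈ V at this
    rwa [aeval_X] at this

theorem exists_algebraMap_eq {n : ℕ} {a : F} (ψ : G.field n →ₐ[F] FractionRing (PowerSeries F))
    (h0 : ψ ⟨G.x 0, G.x_mem_of_le (Nat.zero_le n)⟩ = algebraMap (PowerSeries F) _ (C a + X))
    (f : G.field n) (hf : (f : Ω) ∈ G.ring) :
    ∃ s : PowerSeries F, algebraMap (PowerSeries F) _ s = ψ f := by
  obtain ⟨P, hP, hPf⟩ := G.exists_monic_of_mem_ring hf
  let x : G.field n := ⟨G.x 0, G.x_mem_of_le (Nat.zero_le n)⟩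
  have h1 : P.eval₂ (Polynomial.aeval x : Polynomial F →ₐ[F] G.field n).toRingHom f = 0 := by
    refine Subtype.ext ?_
    have h2 : ((G.field n).val.toRingHom.comp
        (Polynomial.aeval x : Polynomial F →ₐ[F] G.field n).toRingHom) =
        (Polynomial.aeval (G.x 0) : Polynomial F →ₐ[F] Ω).toRingHom :=
      RingHom.ext fun p => (Polynomial.aeval_algHom_apply (G.field n).val x p).symm
    have h3 := Polynomial.hom_eval₂ P
      (Polynomial.aeval x : Polynomial F →ₐ[F] G.field n).toRingHom (G.field n).val.toRingHom f
    rw [h2] at h3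
    exact h3.trans hPf
  have h2 : ψ.toRingHom.comp (Polynomial.aeval x : Polynomial F →ₐ[F] G.field n).toRingHom =
      (algebraMap (PowerSeries F) (FractionRing (PowerSeries F))).comp
        (Polynomial.aeval (C a + X) : Polynomial F →ₐ[F] PowerSeries F).toRingHom :=
    RingHom.ext fun p => by
      refine (Polynomial.aeval_algHom_apply ψ x p).symm.trans ?_
      rw [h0]
      exact Polynomial.aeval_algebraMap_apply _ _ p
  have h3 := Polynomial.hom_eval₂ P
    (Polynomial.aeval x : Polynomial F →ₐ[F] G.field n).toRingHom ψ.toRingHom f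
  rw [h1, h2, map_zero, ← Polynomial.eval₂_map] at h3
  exact IsIntegrallyClosed.isIntegral_iff.1 ⟨_, hP.map _, h3.symm⟩

theorem exists_evaluation {n : ℕ} {c : ℕ → F} (hl0 : (l : F) = 0) (hc : IsPoint l n c) :
    ∃ φ : G.coordRing n →ₐ[F] PowerSeries F, Function.Injective φ ∧
      (∃ t, φ t = X) ∧ ∀ j (_ : j ≤ n) (h : G.uProd j * G.x j ∈ G.coordRing n),
        constantCoeff (φ ⟨_, h⟩) = (∏ i ∈ Finset.range j, (c i ^ (l - 1) + 1)) * c j := by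
  obtain ⟨ψ, h0, hψ⟩ := G.exists_algHom_field hl0 hc n le_rfl
  let ι := IsScalarTower.toAlgHom F (PowerSeries F) (FractionRing (PowerSeries F))
  have hι : Function.Injective ι := IsFractionRing.injective _ _
  let e := AlgEquiv.ofInjective ι hι
  let ψ' : G.coordRing n →ₐ[F] FractionRing (PowerSeries F) :=
    ψ.comp (Subalgebra.inclusion inf_le_right)
  let φ : G.coordRing n →ₐ[F] PowerSeries F := e.symm.toAlgHom.comp
    (ψ'.codRestrict ι.range fun f => G.exists_algebraMap_eq ψ h0 ⟨f, f.2.2⟩ f.2.1)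
  have hφ : ∀ f : G.coordRing n, ι (φ f) = ψ ⟨f, f.2.2⟩ := fun f =>
    congrArg Subtype.val (e.apply_symm_apply _)
  have hφ' : ∀ (f : G.coordRing n) s, ψ ⟨f, f.2.2⟩ = algebraMap (PowerSeries F) _ s → φ f = s :=
    fun f s h => hι ((hφ f).trans h)
  refine ⟨φ, fun f g h => ?_, ?_, fun j hj h => ?_⟩
  · have h1 := congrArg ι h
    rw [hφ, hφ] at h1
    exact Subtype.ext (Subtype.mk.inj (ψ.toRingHom.injective h1))
  · have h1 : G.x 0 ∈ G.coordRing n := ⟨fun V hV => hV.2, G.x_mem_of_le (Nat.zero_le n)⟩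
    refine ⟨⟨G.x 0, h1⟩ - algebraMap F _ (c 0), ?_⟩
    rw [map_sub, AlgHom.commutes, hφ' _ _ h0, PowerSeries.algebraMap_apply]
    simp
  · choose s hs hs' using hψ
    rw [hφ' _ ((∏ i ∈ (Finset.range j).attach,
      (s i.1 ((Finset.mem_range.1 i.2).le.trans hj) ^ (l - 1) + 1)) * s j hj)]
    · rw [map_mul, hs, map_prod, ← Finset.prod_attach (Finset.range j)]
      simp only [map_add, map_pow, map_one, hs]
    · have h2 : (⟨G.uProd j * G.x j, h.2⟩ : G.field n) = (∏ i ∈ (Finset.range j).attach,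
          ((⟨G.x i.1, G.x_mem_of_le ((Finset.mem_range.1 i.2).le.trans hj)⟩ : G.field n) ^ (l - 1)
            + 1)) * ⟨G.x j, G.x_mem_of_le hj⟩ := by
        refine (G.field n).val.injective ?_
        rw [map_mul, map_prod]
        change G.uProd j * G.x j = _ * G.x j
        rw [uProd, ← Finset.prod_attach]
        rfl
      refine (congrArg ψ h2).trans ?_
      rw [map_mul, map_prod, map_mul, map_prod]
      refine congrArg₂ (· * ·) (Finset.prod_congr rfl fun i _ => ?_) (hs' j hj)
      rw [map_add, map_add, map_pow, map_pow, map_one, map_one]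
      exact congrArg (· ^ (l - 1) + (1 : FractionRing (PowerSeries F))) (hs' _ _)

end GSTower

namespace GSTower

open GarciaStichtenoth

variable {F Ω : Type*} [Field F] [Field Ω] [Algebra F Ω] {l : ℕ} (G : GSTower F Ω l)

theorem uProd_mul_x_mem {j n : ℕ} (hj : j ≤ n) : G.uProd j * G.x j ∈ G.coordRing n := by
  have hl := G.two_le
  refine ⟨G.mem_ring.2 fun V hV => ?_,
    mul_mem (G.uProd_mem (by omega)) (G.x_mem_of_le hj)⟩
  have h0 : V.valuation (G.x 0) ≤ 1 := (V.valuation_le_one_iff _).2 hV.2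
  rw [map_mul]
  have hu := G.val_uProd_le_one V.valuation h0 j
  rcases G.val_trichotomy V.valuation h0 j with h | h | ⟨i, hi, h⟩
  · exact mul_le_one' hu (h j le_rfl).le
  · exact mul_le_one' hu (h j le_rfl).1.le
  · rcases hi.lt_or_eq with hi | rfl
    · rw [← h.val_uProd_mul hi]
      gcongr
      exact le_self_pow₀ (h.one_lt hi).le (by omega)
    · exact mul_le_one' hu (h.val_le_one le_rfl)

theorem val_le_of_mem_succ (V : G.infPlaces) {n k : ℕ} {f : Ω} (hf : f ∈ valLT V n (k + 1)) :
    V.1.valuation f ≤ V.1.valuation (G.x n) ^ k := by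
  by_cases h : f ∈ valLT V n k
  · exact h.2.le
  · exact (val_eq_of_mem_succ V hf h).le

/-- The regular functions in the `n`-th field filtered by the pole order at infinity. -/
def poleFiltration (V : G.infPlaces) (n : ℕ) : PoleFiltration F (G.coordRing n) where
  L k := (valLT V n k).comap (G.coordRing n).val.toLinearMap
  zero := by
    rw [eq_bot_iff]
    intro f hf
    have : (f : Ω) ∈ poleLT V n 0 := ⟨hf, f.2.1⟩
    rw [poleLT_zero] at this
    exact (Submodule.mem_bot F).2 (Subtype.ext ((Submodule.mem_bot F).1 this))
  mono _ _ h := Submodule.comap_mono (valLT_mono V h)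
  exists_mem f := exists_mem_valLT V f.2.2
  exists_sub_smul_mem hf hh hh' := exists_sub_smul_mem V hf hh hh'
  mul_mem {i j f h} hf hh := by
    refine ⟨(f * h).2.2, ?_⟩
    change V.1.valuation ((f : Ω) * h) < _
    rw [map_mul]
    refine (mul_le_mul' (G.val_le_of_mem_succ V hf) (G.val_le_of_mem_succ V hh)).trans_lt ?_
    rw [← pow_add]
    exact pow_lt_pow_right₀ (G.one_lt_of_infPlaces V.2 n) (Nat.lt_succ_self _)
  mul_notMem {i j f h} hf hh hf' hh' hm := by
    refine hm.2.not_ge ?_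
    change _ ≤ V.1.valuation ((f : Ω) * h)
    rw [map_mul, pow_add]
    exact mul_le_mul' (val_eq_of_mem_succ V hf hf').ge (val_eq_of_mem_succ V hh hh').ge

theorem dim_poleFiltration (V : G.infPlaces) (n k : ℕ) :
    (G.poleFiltration V n).dim ⊤ k = Module.finrank F (poleLT V n k) := by
  have h : ((G.poleFiltration V n).L k).map (G.coordRing n).val.toLinearMap = poleLT V n k := by
    ext f
    constructor
    · rintro ⟨f, hf, rfl⟩
      exact ⟨hf, f.2.1⟩
    · rintro ⟨hf, hf'⟩
      exact ⟨⟨f, hf', hf.1⟩, hf, rfl⟩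
  rw [PoleFiltration.dim, inf_top_eq, ← h]
  exact (Submodule.equivMapOfInjective (G.coordRing n).val.toLinearMap
    Subtype.val_injective _).finrank_eq

end GSTower

theorem exists_laurentSeries_sum_product {F : Type} [Field F] [Fintype F] {l : ℕ} (hl : 2 ≤ l)
    (hq : Fintype.card F = l ^ 2) (hl0 : (l : F) = 0)
    (hadd : ∀ (Ω : Type) [Field Ω] [Algebra F Ω] (a b : Ω), (a + b) ^ l = a ^ l + b ^ l) (n : ℕ) :
    ∃ g ≤ l ^ (n + 1), ∀ N d m : ℕ, N = (l - 1) * l ^ (n + 1) → 2 * g + d + N ≤ m →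
      ∃ A : Set (LaurentSeries F), A.Finite ∧
        A.ncard = N.multichoose d * (l ^ 2) ^ (m - g - d - N) * (l ^ 2 - 1) ^ N ∧
        (A + A).ncard ≤ (l ^ 2) ^ (m - g) ∧
        (A * A).ncard ≤ N.multichoose (2 * d) * (l ^ 2) ^ (2 * m - g - 2 * d - N) *
          (l ^ 2 - 1) ^ N := by
  classical
  obtain ⟨G⟩ := GSTower.nonempty hl hadd
  obtain ⟨V, hV⟩ := G.exists_infPlace
  obtain ⟨S, hS, hpt, hinj⟩ := GarciaStichtenoth.exists_points hl hq
    (fun a b => hadd F a b) n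
  choose φ hφ hX hu using fun c : S => G.exists_evaluation hl0 (hpt c c.2)
  have hsep : ∀ c c' : S, c ≠ c' → ∃ f, PowerSeries.constantCoeff (φ c f) ≠
      PowerSeries.constantCoeff (φ c' f) := by
    intro c c' hcc
    have hex : ∃ j, j ≤ n ∧ c.1 j ≠ c'.1 j := by
      by_contra! h
      exact hcc (Subtype.ext (hinj _ c.2 _ c'.2 h))
    obtain ⟨hj, hj'⟩ := Nat.find_spec hex
    set j := Nat.find hex
    have hlt : ∀ i ∈ Finset.range j, c'.1 i ^ (l - 1) + 1 = c.1 i ^ (l - 1) + 1 := fun i hi => by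
      have h1 := Nat.find_min hex (Finset.mem_range.1 hi)
      have hi := Finset.mem_range.1 hi
      by_contra h2
      exact h1 ⟨by omega, fun h3 => h2 (by rw [h3])⟩
    refine ⟨⟨_, G.uProd_mul_x_mem hj⟩, ?_⟩
    rw [hu _ _ hj, hu _ _ hj, Finset.prod_congr rfl hlt]
    refine fun h => hj' (mul_left_cancel₀ (Finset.prod_ne_zero_iff.2 fun i hi h0 => ?_) h)
    have hi := Finset.mem_range.1 hi
    refine (hpt c c.2).ne_zero i (by omega) ?_
    have : c.1 i ^ l + c.1 i = c.1 i * (c.1 i ^ (l - 1) + 1) := by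
      rw [mul_add, mul_one, ← pow_succ', Nat.sub_add_cancel (by omega)]
    rw [this, h0, mul_zero]
  obtain ⟨g, hg, h⟩ := (G.poleFiltration ⟨V, hV⟩ n).exists_sum_product hX hsep
    (γ := l ^ (n + 1)) fun k => by
      rw [G.dim_poleFiltration]
      exact GSTower.hasGap ⟨V, hV⟩ n k
  rw [Fintype.card_coe, hS, hq] at h
  refine ⟨g, hg, ?_⟩
  rintro N d m rfl hm
  obtain ⟨A, hA, h1, h2, h3⟩ := h d m hm
  have hne : 0 < S.card := by
    rw [hS]; exact Nat.mul_pos (by omega) (pow_pos (by omega) _)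
  obtain ⟨c, hc⟩ := Finset.card_pos.1 hne
  let θ : G.coordRing n →+* LaurentSeries F :=
    (HahnSeries.ofPowerSeries ℤ F).comp (φ ⟨c, hc⟩).toRingHom
  have hθ : Function.Injective θ := HahnSeries.ofPowerSeries_injective.comp (hφ _)
  refine ⟨θ '' A, hA.image _, ?_, ?_, ?_⟩
  · rw [Set.ncard_image_of_injective _ hθ, h1, mul_assoc]
  · rw [← Set.image_add, Set.ncard_image_of_injective _ hθ]
    exact h2
  · rw [← Set.image_mul, Set.ncard_image_of_injective _ hθ, mul_assoc]
    exact h3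

theorem Fq_nonneg {q : ℕ} (hq : 2 ≤ q) {x y : ℝ} (hx : 0 < x) (hy : 0 < y) : 0 ≤ Fq q x y := by
  have hq' : (1 : ℝ) < q := by exact_mod_cast hq
  have h1 : Real.logb q x ≤ Real.logb q (x + y) :=
    Real.logb_le_logb_of_le hq' hx (by linarith)
  have h2 : Real.logb q y ≤ Real.logb q (x + y) :=
    Real.logb_le_logb_of_le hq' hy (by linarith)
  have := mul_le_mul_of_nonneg_left h1 hx.le
  have := mul_le_mul_of_nonneg_left h2 hy.le
  unfold Fq
  linarith

theorem two_mul_Fq_sub_le {q : ℕ} (hq : 2 ≤ q) {x y : ℝ} (hx : 0 < x) (hy : 0 < y) :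
    (2 * Fq q x y - Fq q (2 * x) y) * Real.log q ≤ (x + y) / 2 := by
  have hq' : (1 : ℝ) < q := by exact_mod_cast hq
  have hlq : Real.log q ≠ 0 := (Real.log_pos hq').ne'
  have h1 := Real.log_le_sub_one_of_pos (x := (2 * (x + y)) / (2 * x + y)) (by positivity)
  have h2 := Real.log_le_sub_one_of_pos (x := (x + y) / (2 * y)) (by positivity)
  have h3 := mul_le_mul_of_nonneg_left h1 (show 0 ≤ 2 * x + y by positivity)
  have h4 := mul_le_mul_of_nonneg_left h2 hy.le
  rw [Real.log_div (by positivity) (by positivity), Real.log_mul (by positivity) (by positivity)] at h3 h4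
  have h5 : (2 * x + y) * (2 * (x + y) / (2 * x + y) - 1) = y := by field_simp; ring
  have h6 : y * ((x + y) / (2 * y) - 1) = (x + y) / 2 - y := by field_simp
  rw [h5] at h3
  rw [h6] at h4
  have h7 : (2 * Fq q x y - Fq q (2 * x) y) * Real.log q =
      2 * ((x + y) * Real.log (x + y) - x * Real.log x - y * Real.log y) -
      ((2 * x + y) * Real.log (2 * x + y) - (2 * x) * (Real.log 2 + Real.log x) - y * Real.log y) := by
    rw [← Real.log_mul (by norm_num) hx.ne']
    unfold Fq Real.logb
    field_simp
  rw [h7]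
  linarith

/-- The choice of the normalised pole order. -/
theorem exists_pole_order {l q : ℕ} (hl : 2 ≤ l) (hq : q = l ^ 2) {a b α β y lam : ℝ}
    (ha2 : a < 2) (hb2 : b < 2) (hβ : 0 < β) (hy : y = l - 1)
    (hlam : lam = y * Real.logb q (1 - (q : ℝ)⁻¹)) (hα : l + 1 < α)
    (ha : a > (α + β - 1) / (Fq q β y + α + 2 * lam - 2))
    (hb : b > 1 + (2 * Real.logb q 2 + Fq q (2 * β) y - Fq q β y + α - 1 + lam) /
      (Fq q β y + α + 2 * lam - 2)) :
    ∃ r : ℝ, l + 1 ≤ r ∧ 0 < Fq q β y + r - 1 + lam ∧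
      r + β - 1 < a * (Fq q β y + r - 1 + lam) ∧
      Fq q (2 * β) y + 2 * r - 1 + lam < b * (Fq q β y + r - 1 + lam) := by
  have hl' : (2 : ℝ) ≤ l := by exact_mod_cast hl
  have hy1 : 1 ≤ y := by linarith
  have hqr : (q : ℝ) = (y + 1) ^ 2 := by rw [hq, hy]; push_cast; ring
  have hq2 : 2 ≤ q := by rw [hq]; nlinarith
  have hq4 : (4 : ℝ) ≤ q := by rw [hqr]; nlinarith
  have hln2 := Real.log_two_gt_d9
  have hlq : 2 * Real.log 2 ≤ Real.log q := by
    have h4 : Real.log 4 = 2 * Real.log 2 := by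
      rw [show (4 : ℝ) = 2 ^ 2 by norm_num, Real.log_pow]; norm_num
    rw [← h4]
    exact Real.log_le_log (by norm_num) hq4
  have hlq0 : 0 < Real.log q := by linarith
  have hneg : -lam ≤ 1 / 4 := by
    have h0 : 0 < 1 - (q : ℝ)⁻¹ := sub_pos.2 (inv_lt_one_of_one_lt₀ (by linarith))
    have h1 := Real.one_sub_inv_le_log_of_pos h0
    have h2 : 1 - (1 - (q : ℝ)⁻¹)⁻¹ = - (1 / (q - 1)) := by
      have : (q : ℝ) - 1 ≠ 0 := by linarith
      have : (q : ℝ) ≠ 0 := by linarith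
      field_simp
      ring
    rw [h2] at h1
    have h3 : y / (q - 1) ≤ 1 / 3 := by
      rw [hqr, div_le_div_iff₀ (by nlinarith) (by norm_num)]; nlinarith
    rw [hlam, Real.logb, ← mul_div_assoc, ← neg_div, div_le_iff₀ hlq0]
    have h4 := mul_le_mul_of_nonneg_left h1 (by linarith : 0 ≤ y)
    have h5 : y * -(1 / ((q : ℝ) - 1)) = - (y / (q - 1)) := by ring
    linarith
  have hF1 := Fq_nonneg hq2 hβ (by linarith : 0 < y)
  have hF := two_mul_Fq_sub_le hq2 hβ (by linarith : 0 < y)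
  set F₁ := Fq q β y
  set F₂ := Fq q (2 * β) y
  have hL : Real.logb q 2 * Real.log q = Real.log 2 := by
    rw [Real.logb]; field_simp
  have hL0 : 0 < Real.logb q 2 := Real.logb_pos (by linarith) (by norm_num)
  set L := Real.logb q 2
  set D := F₁ + α + 2 * lam - 2 with hD
  have hD0 : 0 < D := by linarith
  have ha' : α + β - 1 < a * D := by rwa [gt_iff_lt, div_lt_iff₀ hD0] at ha
  have hb' : D + (2 * L + F₂ - F₁ + α - 1 + lam) < b * D := by
    rw [gt_iff_lt, ← lt_sub_iff_add_lt', div_lt_iff₀ hD0] at hb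
    linarith
  have hlam0 : lam ≤ 0 := by
    rw [hlam]
    refine mul_nonpos_of_nonneg_of_nonpos (by linarith) (Real.logb_nonpos (by linarith) ?_ ?_)
    · exact sub_nonneg.2 (inv_le_one_of_one_le₀ (by linarith))
    · have : 0 ≤ (q : ℝ)⁻¹ := by positivity
      linarith
  by_cases hcase : l + 1 ≤ α - 1 + lam
  · refine ⟨α - 1 + lam, hcase, ?_, ?_, ?_⟩
    · linarith
    · have : F₁ + (α - 1 + lam) - 1 + lam = D := by rw [hD]; ring
      rw [this]; linarith
    · have : F₁ + (α - 1 + lam) - 1 + lam = D := by rw [hD]; ring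
      rw [this]; linarith
  · push Not at hcase
    have hDl : (β + y + 1) / 2 < D := by
      have := mul_lt_mul_of_pos_right ha2 hD0
      linarith
    have key : (2 - b) * (1 - lam) ≤ 2 * L := by
      have h1 : (2 - b) * D < 2 * F₁ - F₂ := by linarith
      have h2 : (1 - lam) * (2 * F₁ - F₂) ≤ 2 * L * D := by
        have h3 : (1 - lam) * ((2 * F₁ - F₂) * Real.log q) ≤ 2 * (L * Real.log q) * D := by
          rw [hL]
          calc (1 - lam) * ((2 * F₁ - F₂) * Real.log q) ≤ (1 - lam) * ((β + y) / 2) := by gcongr; linarith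
            _ ≤ 2 * Real.log 2 * ((β + y) / 2) := by gcongr; linarith
            _ ≤ 2 * Real.log 2 * D := by gcongr; linarith
        refine le_of_mul_le_mul_right ?_ hlq0
        linarith
      refine le_of_mul_le_mul_right ?_ hD0
      have h3 := mul_le_mul_of_nonneg_left h1.le (show 0 ≤ 1 - lam by linarith)
      linarith
    refine ⟨l + 1, le_rfl, ?_, ?_, ?_⟩
    · linarith
    · have h1 : 0 < a := by
        by_contra! h
        have := mul_nonpos_of_nonpos_of_nonneg h hD0.le
        linarith
      have : a * D ≤ a * (F₁ + (l + 1) - 1 + lam) := by gcongr; linarith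
      linarith
    · have h1 : (2 - b) * (l + 2 - α - lam) ≤ (2 - b) * (1 - lam) :=
        mul_le_mul_of_nonneg_left (by linarith) (by linarith)
      have h2 : b * (F₁ + (l + 1) - 1 + lam) = b * D + b * (l + 2 - α - lam) := by rw [hD]; ring
      rw [h2]
      linarith

theorem log_factorial_le {n : ℕ} (hn : n ≠ 0) :
    Real.log n.factorial ≤ n * Real.log n - n + Real.log n + 1 := by
  obtain ⟨k, rfl⟩ := Nat.exists_eq_succ_of_ne_zero hn
  have h := Stirling.log_stirlingSeq'_antitone (Nat.zero_le k)
  simp only [Function.comp, Nat.succ_eq_add_one, zero_add] at h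
  rw [Stirling.log_stirlingSeq_formula, Stirling.stirlingSeq_one,
    Real.log_div (Real.exp_ne_zero 1) (by positivity), Real.log_exp, Real.log_sqrt (by norm_num),
    Real.log_div (by positivity) (Real.exp_ne_zero 1), Real.log_exp,
    Real.log_mul (by norm_num) (by positivity)] at h
  have h0 : 0 ≤ Real.log ((k + 1 : ℕ) : ℝ) := Real.log_natCast_nonneg _
  rw [Nat.succ_eq_add_one]
  linarith

theorem multichoose_mul_factorial (N d : ℕ) :
    N.multichoose d * ((N + d) * (N.factorial * d.factorial)) = (N + d).factorial * N := by
  cases N with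
  | zero => cases d <;> simp
  | succ N =>
    rw [Nat.multichoose_eq, show N + 1 + d - 1 = N + d by omega,
      show N + 1 + d = N + d + 1 by omega]
    have h1 := Nat.add_one_mul_choose_eq (N + d) N
    have h2 := Nat.add_choose_mul_factorial_mul_factorial (N + 1) d
    rw [show N + 1 + d = N + d + 1 by omega] at h2
    have h3 : (N + d).choose d = (N + d).choose N := Nat.choose_symm_of_eq_add (by omega)
    have h4 : (N + d + 1).choose d = (N + d + 1).choose (N + 1) :=
      Nat.choose_symm_of_eq_add (by omega)
    rw [h3, ← h2, h4]
    linear_combination ((N + 1).factorial * d.factorial) * h1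

theorem le_log_multichoose {N d : ℕ} (hN : N ≠ 0) (hd : d ≠ 0) :
    (N + d) * Real.log (N + d) - N * Real.log N - d * Real.log d - 2 - 2 * Real.log (N + d) ≤
      Real.log (N.multichoose d) := by
  have h := congrArg (fun k : ℕ => Real.log k) (multichoose_mul_factorial N d)
  have hmc : N.multichoose d ≠ 0 := by
    intro h0
    have := multichoose_mul_factorial N d
    rw [h0, zero_mul] at this
    exact mul_ne_zero (Nat.factorial_ne_zero _) hN this.symm
  have hN' : (N : ℝ) ≠ 0 := by exact_mod_cast hN
  have hNd : ((N : ℝ) + d) ≠ 0 := by positivity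
  push_cast at h
  have hf : ∀ n : ℕ, (n.factorial : ℝ) ≠ 0 := fun n => by exact_mod_cast Nat.factorial_ne_zero n
  rw [Real.log_mul (by exact_mod_cast hmc) (mul_ne_zero hNd (mul_ne_zero (hf _) (hf _))),
    Real.log_mul hNd (mul_ne_zero (hf _) (hf _)), Real.log_mul (hf _) (hf _),
    Real.log_mul (hf _) hN'] at h
  have h1 := log_factorial_le hN
  have h2 := log_factorial_le hd
  have h3 := Stirling.le_log_factorial_stirling (n := N + d) (by omega)
  push_cast at h3
  have h4 : 0 ≤ Real.log ((N : ℝ) + d) := by exact_mod_cast Real.log_natCast_nonneg (N + d)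
  have h5 : 0 ≤ Real.log (2 * Real.pi) := Real.log_nonneg (by linarith [Real.pi_gt_three])
  have h6 : Real.log d ≤ Real.log ((N : ℝ) + d) :=
    Real.log_le_log (by positivity) (by linarith [(Nat.cast_nonneg N : (0 : ℝ) ≤ N)])
  linarith

theorem multichoose_mul_le_one {x : ℝ} (hx : 0 ≤ x) (hx1 : x ≤ 1) (N d : ℕ) :
    N.multichoose d * (x ^ d * (1 - x) ^ N) ≤ 1 := by
  have h1 : N.multichoose d ≤ (d + N).choose d := by
    rw [Nat.multichoose_eq]
    exact Nat.choose_le_choose _ (by omega)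
  have h2 : (x + (1 - x)) ^ (d + N) = 1 := by simp
  rw [add_pow] at h2
  have h3 := Finset.single_le_sum (f := fun k => x ^ k * (1 - x) ^ (d + N - k) * ((d + N).choose k : ℝ))
    (fun k _ => by
      have := sub_nonneg.2 hx1
      positivity) (Finset.mem_range.2 (show d < d + N + 1 by omega))
  rw [h2] at h3
  refine le_trans ?_ h3
  simp only [Nat.add_sub_cancel_left]
  rw [mul_comm]
  have := sub_nonneg.2 hx1
  gcongr

theorem log_multichoose_le {q : ℕ} (hq : 2 ≤ q) {x y t : ℝ} (hx : 0 < x) (hy : 0 < y) {N d : ℕ}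
    (hN : N = y * t) (hN0 : N ≠ 0) (hd : d ≤ x * t) :
    Real.logb q (N.multichoose d) ≤ t * Fq q x y := by
  have hq' : (1 : ℝ) < q := by exact_mod_cast hq
  have hmc : (N.multichoose d : ℝ) ≠ 0 := by
    rw [Nat.multichoose_eq]
    exact_mod_cast (Nat.choose_pos (by omega)).ne'
  have h := multichoose_mul_le_one (x := x / (x + y)) (by positivity)
    (div_le_one_of_le₀ (by linarith) (by positivity)) N d
  have h1 : 1 - x / (x + y) = y / (x + y) := by field_simp; ring
  rw [h1] at h
  have h2 := Real.logb_le_logb_of_le hq' (by positivity) h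
  rw [Real.logb_one, Real.logb_mul hmc (by positivity), Real.logb_mul (by positivity) (by positivity),
    Real.logb_pow, Real.logb_pow, Real.logb_div (by positivity) (by positivity),
    Real.logb_div (by positivity) (by positivity), hN] at h2
  have h3 : Real.logb q x ≤ Real.logb q (x + y) := Real.logb_le_logb_of_le hq' hx (by linarith)
  have h4 := mul_le_mul_of_nonneg_right hd (sub_nonneg.2 h3)
  unfold Fq
  linarith

theorem Fq_mul {q : ℕ} {x y t : ℝ} (hx : 0 < x) (hy : 0 < y) (ht : 0 < t) :
    t * Fq q x y = Fq q (t * x) (t * y) := by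
  unfold Fq
  rw [← mul_add, Real.logb_mul ht.ne' hx.ne', Real.logb_mul ht.ne' hy.ne',
    Real.logb_mul ht.ne' (by positivity)]
  ring

theorem le_logb_multichoose {q : ℕ} (hq : 2 ≤ q) {N d : ℕ} (hN : N ≠ 0) (hd : d ≠ 0) :
    Fq q d N - (2 + 2 * Real.log (N + d)) / Real.log q ≤ Real.logb q (N.multichoose d) := by
  have hq' : (1 : ℝ) < q := by exact_mod_cast hq
  have hlq := Real.log_pos hq'
  have h := div_le_div_of_nonneg_right (le_log_multichoose hN hd) hlq.le
  refine le_of_eq_of_le ?_ h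
  unfold Fq Real.logb
  rw [add_comm (d : ℝ)]
  field_simp
  ring

open Filter Topology in
theorem tendsto_Fq_floor (q : ℕ) {β y : ℝ} (hβ : 0 < β) {c : ℝ} (hc : c ≠ 0) (s : ℝ) :
    Tendsto (fun t : ℝ => Fq q (⌊β * t⌋₊ / t) y - (2 + 2 * Real.log (c * t)) / (s * t)) atTop
      (𝓝 (Fq q β y)) := by
  have h1 : Tendsto (fun t : ℝ => Fq q (⌊β * t⌋₊ / t) y) atTop (𝓝 (Fq q β y)) := by
    have hc : Continuous fun x => Fq q x y := by
      have h : ∀ x, Fq q x y = ((x + y) * Real.log (x + y) - x * Real.log x) / Real.log q -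
          y * Real.logb q y := fun x => by
        unfold Fq Real.logb; ring
      simp only [h]
      have h2 := Real.continuous_mul_log
      have h3 : Continuous fun x : ℝ => (x + y) * Real.log (x + y) :=
        h2.comp (continuous_id.add continuous_const)
      exact ((h3.sub h2).div_const _).sub continuous_const
    exact (hc.tendsto β).comp (tendsto_nat_floor_mul_div_atTop hβ.le)
  have h2 : Tendsto (fun t : ℝ => (2 + 2 * Real.log (c * t)) / (s * t)) atTop (𝓝 0) := by
    have h3 : Tendsto (fun t : ℝ => Real.log t / t) atTop (𝓝 0) := by
      simpa using Real.tendsto_pow_log_div_mul_add_atTop 1 0 1 one_ne_zero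
    have h4 := ((tendsto_inv_atTop_zero.const_mul (2 + 2 * Real.log c)).add
      (h3.const_mul 2)).div_const s
    rw [mul_zero, mul_zero, add_zero, zero_div] at h4
    refine h4.congr' ?_
    filter_upwards [eventually_ne_atTop 0] with t ht
    rw [Real.log_mul hc ht]
    field_simp
    ring
  simpa using h1.sub h2

theorem natCast_le_rpow_of_logb_le {q : ℕ} (hq : 2 ≤ q) {A B : ℕ} (hA : A ≠ 0) {a : ℝ}
    (h : Real.logb q B ≤ a * Real.logb q A) : (B : ℝ) ≤ (A : ℝ) ^ a := by
  have hq' : (1 : ℝ) < q := by exact_mod_cast hq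
  have hA' : (0 : ℝ) < A := by exact_mod_cast Nat.pos_of_ne_zero hA
  rcases Nat.eq_zero_or_pos B with rfl | hB
  · rw [Nat.cast_zero]; positivity
  · rw [← Real.logb_rpow_eq_mul_logb_of_pos hA'] at h
    exact (Real.logb_le_logb hq' (by exact_mod_cast hB) (by positivity)).1 h

theorem logb_mul_pow_mul_pow {q : ℕ} (hq : 2 ≤ q) {c : ℕ} (hc : c ≠ 0) (s N : ℕ) :
    Real.logb q ((c * q ^ s * (q - 1) ^ N : ℕ) : ℝ) =
      Real.logb q c + s + N * (1 + Real.logb q (1 - (q : ℝ)⁻¹)) := by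
  have hq' : (1 : ℝ) < q := by exact_mod_cast hq
  have hq0 : (q : ℝ) ≠ 0 := by positivity
  have hc' : (c : ℝ) ≠ 0 := by exact_mod_cast hc
  have hq1 : (q : ℝ) - 1 ≠ 0 := by linarith
  have h1 : 1 - (q : ℝ)⁻¹ = (q - 1) / q := by field_simp
  rw [h1, Real.logb_div hq1 hq0, Real.logb_self_eq_one hq']
  push_cast [Nat.cast_sub (show 1 ≤ q by omega)]
  rw [Real.logb_mul (by positivity) (pow_ne_zero _ hq1), Real.logb_mul hc' (by positivity),
    Real.logb_pow, Real.logb_pow, Real.logb_self_eq_one hq']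
  ring

/-- Sizes for which the cardinalities produced by the function fields satisfy the wanted bounds. -/
theorem exists_sizes {l q G M : ℕ} (hl : 2 ≤ l) (hq : q = l ^ 2) {a b β y lam r ε : ℝ}
    (ha1 : 1 ≤ a) (hb1 : 1 ≤ b) (hβ : 0 < β) (hy : y = l - 1)
    (hlam : lam = y * Real.logb q (1 - (q : ℝ)⁻¹)) (hr : l + 1 ≤ r)
    (ha : r + β - 1 + ε ≤ a * (Fq q β y + r - 1 + lam - ε))
    (hb : Fq q (2 * β) y + 2 * r - 1 + lam + ε ≤ b * (Fq q β y + r - 1 + lam - ε))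
    (hG : 2 ≤ ε * G) (hM : Real.logb q M ≤ G * (Fq q β y + r - 1 + lam - ε))
    (hβG : 1 ≤ β * G)
    (hΦ : Fq q β y - ε ≤ Fq q (⌊β * G⌋₊ / G) y -
      (2 + 2 * Real.log ((y + β) * G)) / (Real.log q * G))
    {g : ℕ} (hg : g ≤ G) :
    ∃ N d m : ℕ, N = (l - 1) * G ∧ 2 * g + d + N ≤ m ∧
      ∃ K : ℕ, K = N.multichoose d * q ^ (m - g - d - N) * (q - 1) ^ N ∧ M ≤ K ∧
      ((q ^ (m - g) : ℕ) : ℝ) ≤ (K : ℝ) ^ a ∧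
      ((N.multichoose (2 * d) * q ^ (2 * m - g - 2 * d - N) * (q - 1) ^ N : ℕ) : ℝ) ≤
        (K : ℝ) ^ b := by
  have hl' : (2 : ℝ) ≤ l := by exact_mod_cast hl
  have hq2 : 2 ≤ q := by rw [hq]; nlinarith
  have hq' : (1 : ℝ) < q := by exact_mod_cast hq2
  have hlq := Real.log_pos hq'
  have hy1 : 1 ≤ y := by linarith
  have hG0 : G ≠ 0 := by rintro rfl; norm_num at hG
  have hGp : (0 : ℝ) < G := by exact_mod_cast Nat.pos_of_ne_zero hG0
  obtain ⟨N, hN⟩ : ∃ N, N = (l - 1) * G := ⟨_, rfl⟩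
  obtain ⟨d, hd⟩ : ∃ d, d = ⌊β * G⌋₊ := ⟨_, rfl⟩
  obtain ⟨s, hs⟩ : ∃ s, s = ⌈r * G⌉₊ := ⟨_, rfl⟩
  have hNr : (N : ℝ) = y * G := by
    rw [hN, hy]; push_cast [Nat.cast_sub (show 1 ≤ l by omega)]; ring
  have hN0 : N ≠ 0 := by rw [hN]; exact Nat.mul_ne_zero (by omega) hG0
  have hd0 : d ≠ 0 := by rw [hd]; exact (Nat.floor_pos.2 hβG).ne'
  have hdβ : (d : ℝ) ≤ β * G := by rw [hd]; exact Nat.floor_le (by positivity)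
  have hs1 : r * G ≤ s := by rw [hs]; exact Nat.le_ceil _
  have hs2 : (s : ℝ) ≤ r * G + 1 := by
    rw [hs]; exact (Nat.ceil_lt_add_one (by nlinarith)).le
  have hgr : (g : ℝ) ≤ G := by exact_mod_cast hg
  have hsN : 2 * g + N ≤ s := by
    have : (2 * g + N : ℝ) ≤ s := by rw [hNr, hy]; nlinarith
    exact_mod_cast this
  have hmc : ∀ k, N.multichoose k ≠ 0 := fun k => by
    rw [Nat.multichoose_eq]; exact (Nat.choose_pos (by omega)).ne'
  have hK0 : N.multichoose d * q ^ (s - g - N) * (q - 1) ^ N ≠ 0 :=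
    mul_ne_zero (mul_ne_zero (hmc d) (pow_ne_zero _ (by omega))) (pow_ne_zero _ (by omega))
  have hmcd : G * (Fq q β y - ε) ≤ Real.logb q (N.multichoose d) := by
    refine (mul_le_mul_of_nonneg_left hΦ hGp.le).trans
      (le_trans ?_ (le_logb_multichoose hq2 hN0 hd0))
    rw [← hd, mul_sub, Fq_mul (by positivity) (by linarith) hGp, mul_div_cancel₀ _ hGp.ne',
      hNr, mul_comm (G : ℝ) y]
    have h1 : Real.log (y * G + d) ≤ Real.log ((y + β) * G) :=
      Real.log_le_log (by positivity) (by linarith)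
    have h2 : (G : ℝ) * ((2 + 2 * Real.log ((y + β) * G)) / (Real.log q * G)) =
        (2 + 2 * Real.log ((y + β) * G)) / Real.log q := by field_simp
    rw [h2]
    gcongr
  have hNlam : N * (1 + Real.logb q (1 - (q : ℝ)⁻¹)) = N + G * lam := by
    rw [hlam, hNr]; ring
  have hK : G * (Fq q β y + r - 1 + lam - ε) + (G - g) ≤
      Real.logb q ((N.multichoose d * q ^ (s - g - N) * (q - 1) ^ N : ℕ) : ℝ) := by
    rw [logb_mul_pow_mul_pow hq2 (hmc d), hNlam, Nat.sub_sub, Nat.cast_sub (by omega)]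
    push_cast
    linarith
  refine ⟨N, d, d + s, hN, by omega, _, rfl, ?_⟩
  rw [show d + s - g - d - N = s - g - N by omega,
    show 2 * (d + s) - g - 2 * d - N = 2 * s - g - N by omega]
  refine ⟨?_, natCast_le_rpow_of_logb_le hq2 hK0 ?_, natCast_le_rpow_of_logb_le hq2 hK0 ?_⟩
  · have h := natCast_le_rpow_of_logb_le (B := M) (a := 1) hq2 hK0 (by linarith)
    rw [Real.rpow_one] at h
    exact_mod_cast h
  · refine le_trans ?_ (mul_le_mul_of_nonneg_left hK (by linarith))
    push_cast [Nat.cast_sub (show g ≤ d + s by omega)]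
    rw [Real.logb_pow, Real.logb_self_eq_one hq', Nat.cast_sub (by omega)]
    push_cast
    have h1 := mul_le_mul_of_nonneg_left ha hGp.le
    have h2 : (G : ℝ) - g ≤ a * (G - g) := le_mul_of_one_le_left (by linarith) ha1
    linarith
  · refine le_trans ?_ (mul_le_mul_of_nonneg_left hK (by linarith))
    have h0 := log_multichoose_le hq2 (x := 2 * β) (by positivity) (by linarith) hNr hN0
      (d := 2 * d) (by push_cast; linarith)
    rw [logb_mul_pow_mul_pow hq2 (hmc _), hNlam, Nat.sub_sub, Nat.cast_sub (by omega)]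
    push_cast
    have h1 := mul_le_mul_of_nonneg_left hb hGp.le
    have h2 : (G : ℝ) - g ≤ b * (G - g) := le_mul_of_one_le_left (by linarith) hb1
    linarith

open Filter Topology in
theorem eventually_sizes {l q : ℕ} (hl : 2 ≤ l) (hq : q = l ^ 2) {a b β y lam r : ℝ}
    (ha1 : 1 ≤ a) (ha2 : a < 2) (hb1 : 1 ≤ b) (hb2 : b < 2) (hβ : 0 < β) (hy : y = l - 1)
    (hlam : lam = y * Real.logb q (1 - (q : ℝ)⁻¹)) (hr : l + 1 ≤ r)
    (h0 : 0 < Fq q β y + r - 1 + lam)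
    (ha : r + β - 1 < a * (Fq q β y + r - 1 + lam))
    (hb : Fq q (2 * β) y + 2 * r - 1 + lam < b * (Fq q β y + r - 1 + lam)) (M : ℕ) :
    ∃ n : ℕ, ∀ g ≤ l ^ (n + 1), ∃ N d m : ℕ, N = (l - 1) * l ^ (n + 1) ∧ 2 * g + d + N ≤ m ∧
      ∃ K : ℕ, K = N.multichoose d * q ^ (m - g - d - N) * (q - 1) ^ N ∧ M ≤ K ∧
      ((q ^ (m - g) : ℕ) : ℝ) ≤ (K : ℝ) ^ a ∧
      ((N.multichoose (2 * d) * q ^ (2 * m - g - 2 * d - N) * (q - 1) ^ N : ℕ) : ℝ) ≤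
        (K : ℝ) ^ b := by
  have hl' : (2 : ℝ) ≤ l := by exact_mod_cast hl
  set Y := Fq q β y + r - 1 + lam with hY
  obtain ⟨ε, hε, hεY, hεa, hεb⟩ : ∃ ε : ℝ, 0 < ε ∧ ε ≤ Y / 2 ∧ ε ≤ (a * Y - (r + β - 1)) / 3 ∧
      ε ≤ (b * Y - (Fq q (2 * β) y + 2 * r - 1 + lam)) / 3 :=
    ⟨min (Y / 2) (min ((a * Y - (r + β - 1)) / 3)
      ((b * Y - (Fq q (2 * β) y + 2 * r - 1 + lam)) / 3)),
      lt_min (by linarith) (lt_min (by linarith) (by linarith)), min_le_left _ _,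
      (min_le_right _ _).trans (min_le_left _ _), (min_le_right _ _).trans (min_le_right _ _)⟩
  have hG : Tendsto (fun n : ℕ => ((l ^ (n + 1) : ℕ) : ℝ)) atTop atTop := by
    refine tendsto_natCast_atTop_atTop.comp ?_
    exact (tendsto_pow_atTop_atTop_of_one_lt (show 1 < l by omega)).comp (tendsto_add_atTop_nat 1)
  have hY' : 0 < Y - ε := by linarith
  have hΦ := ((tendsto_Fq_floor q (y := y) hβ (c := y + β) (by linarith) (Real.log q)).comp
    hG).eventually (eventually_ge_nhds (show Fq q β y - ε < Fq q β y by linarith))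
  obtain ⟨n, h1, h2, h3, h4⟩ := ((hG.const_mul_atTop hε).eventually_ge_atTop 2 |>.and
    ((hG.atTop_mul_const hY').eventually_ge_atTop (Real.logb q M) |>.and
    ((hG.const_mul_atTop hβ).eventually_ge_atTop 1 |>.and hΦ))).exists
  exact ⟨n, fun g hg => exists_sizes hl hq ha1 hb1 hβ hy hlam hr
    (by nlinarith) (by nlinarith) h1 h2 h3 h4 hg⟩

theorem exists_add_pow_eq {F : Type} [Field F] [Fintype F] {l : ℕ} (hl : 2 ≤ l)
    (hF : Fintype.card F = l ^ 2) : (l : F) = 0 ∧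
      ∀ (Ω : Type) [Field Ω] [Algebra F Ω] (a b : Ω), (a + b) ^ l = a ^ l + b ^ l := by
  obtain ⟨p, hp⟩ := CharP.exists F
  obtain ⟨k, hpp, hk⟩ := FiniteField.card F p
  have : Fact p.Prime := ⟨hpp⟩
  obtain ⟨j, -, rfl⟩ := (Nat.dvd_prime_pow hpp).1 (show l ∣ p ^ (k : ℕ) from
    hk ▸ hF ▸ Dvd.intro_left l (by ring))
  have hj : j ≠ 0 := by rintro rfl; simp at hl
  refine ⟨by simp [hj], fun Ω _ _ a b => ?_⟩
  have : CharP Ω p := charP_of_injective_algebraMap (algebraMap F Ω).injective p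
  exact add_pow_char_pow a b p j

/-- Let `q` be a prime power that is a perfect square and `a, b ∈ (1,2)`. If there
exist `β > 0` and `α > √q + 1` satisfying the two inequalities below (with
`D = F_q(β, √q−1) + α + 2(√q−1) log_q(1−q⁻¹) − 2`), then there exist arbitrarily large
finite `A ⊆ 𝔽_q((t))` with `|A+A| ≤ |A|^a` and `|AA| ≤ |A|^b`. -/
theorem statement19 (q : ℕ) (hq : IsPrimePow q) (hsq : ∃ m : ℕ, q = m ^ 2)
    (a b : ℝ) (ha1 : 1 < a) (ha2 : a < 2) (hb1 : 1 < b) (hb2 : b < 2)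
    (h : ∃ β : ℝ, 0 < β ∧ ∃ α : ℝ, Real.sqrt q + 1 < α ∧
      a > (α + β - 1) /
        (Fq q β (Real.sqrt q - 1) + α +
          2 * (Real.sqrt q - 1) * Real.logb q (1 - (q : ℝ)⁻¹) - 2) ∧
      b > 1 + (2 * Real.logb q 2 + Fq q (2 * β) (Real.sqrt q - 1) -
          Fq q β (Real.sqrt q - 1) + α - 1 +
          (Real.sqrt q - 1) * Real.logb q (1 - (q : ℝ)⁻¹)) /
        (Fq q β (Real.sqrt q - 1) + α +
          2 * (Real.sqrt q - 1) * Real.logb q (1 - (q : ℝ)⁻¹) - 2))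
    (F : Type) [Field F] [Fintype F] (hF : Fintype.card F = q) :
    ∀ N : ℕ, ∃ A : Set (LaurentSeries F), A.Finite ∧ N ≤ A.ncard ∧
      ((A + A).ncard : ℝ) ≤ (A.ncard : ℝ) ^ a ∧
      ((A * A).ncard : ℝ) ≤ (A.ncard : ℝ) ^ b := by
  intro M
  obtain ⟨l, rfl⟩ := hsq
  have hl : 2 ≤ l := by
    by_contra! hl
    have := hq.two_le
    interval_cases l <;> omega
  have hsqrt : Real.sqrt ((l ^ 2 : ℕ) : ℝ) = l := by
    rw [Nat.cast_pow, Real.sqrt_sq (Nat.cast_nonneg l)]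
  obtain ⟨β, hβ, α, hα, ha, hb⟩ := h
  rw [hsqrt] at hα ha hb
  rw [mul_assoc 2] at ha hb
  obtain ⟨r, hr, h0, har, hbr⟩ := exists_pole_order hl rfl ha2 hb2 hβ rfl rfl hα ha hb
  obtain ⟨n, hn⟩ := eventually_sizes hl rfl ha1.le ha2 hb1.le hb2 hβ rfl rfl hr h0 har hbr M
  obtain ⟨hl0, hadd⟩ := exists_add_pow_eq hl hF
  obtain ⟨g, hg, hA⟩ := exists_laurentSeries_sum_product hl hF hl0 hadd n
  obtain ⟨N, d, m, hN, hm, K, hK, hMK, hKa, hKb⟩ := hn g hg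
  obtain ⟨A, hfin, hcard, hsum, hprod⟩ := hA N d m hN hm
  rw [← hK] at hcard
  refine ⟨A, hfin, by rwa [hcard], ?_, ?_⟩ <;> rw [hcard]
  · exact (Nat.cast_le.2 hsum).trans hKa
  · exact (Nat.cast_le.2 hprod).trans hKb
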